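/- arXiv:2210.12665 — 5 statements merged into one kernel-verified Lean document; each statement's English description precedes it below -/
import Mathlib

section
/- Let P be a closed path polyomino. Then the number of vertices of P equals twice the number of cells of P, i.e., |V(P)| = 2·rank(P). -/
open scoped MonomialOrder

/-- A cell of `ℤ²`, identified with its lower-left corner. -/
abbrev Cell : Type := ℤ × ℤ

/-- The four vertices of a cell. -/
def cellVerts (c : Cell) : Finset Cell :=
  {c, (c.1 + 1, c.2), (c.1, c.2 + 1), (c.1 + 1, c.2 + 1)}

/-- Two cells are edge-adjacent if their lower-left corners differ by `(±1,0)` or `(0,±1)`. -/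
def EdgeAdj (c d : Cell) : Prop :=
  (c.1 = d.1 ∧ (c.2 = d.2 + 1 ∨ d.2 = c.2 + 1)) ∨
  (c.2 = d.2 ∧ (c.1 = d.1 + 1 ∨ d.1 = c.1 + 1))

/-- `L` is a path of cells from `C` to `D`, all cells lying in `S`:
consecutive cells are edge-adjacent and all cells are distinct. -/
def IsCellPath (S : Set Cell) (C D : Cell) (L : List Cell) : Prop :=
  L.head? = some C ∧ L.getLast? = some D ∧
  L.Chain' EdgeAdj ∧ L.Nodup ∧ ∀ c ∈ L, c ∈ S

/-- A polyomino: a finite nonempty collection of cells, any two of which are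
connected by a path of cells of the collection. -/
def IsPolyomino (P : Finset Cell) : Prop :=
  P.Nonempty ∧ ∀ C ∈ P, ∀ D ∈ P, ∃ L, IsCellPath (↑P) C D L

/-- The vertex set `V(P)` of a collection of cells. -/
def polyVerts (P : Finset Cell) : Finset Cell := P.biUnion cellVerts

/-- `A : ZMod n → Cell` realizes `P` as a closed path of cells:
consecutive cells (cyclically) share an edge, all cells are distinct, cells that are
not cyclically within distance 2 share no vertex, and `P` is the set of cells of the sequence. -/
def IsClosedPathSeq (n : ℕ) (A : ZMod n → Cell) (P : Finset Cell) : Prop :=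
  (∀ i, EdgeAdj (A i) (A (i + 1))) ∧
  Function.Injective A ∧
  (∀ i j : ZMod n, j ∉ ({i - 2, i - 1, i, i + 1, i + 2} : Set (ZMod n)) →
    cellVerts (A i) ∩ cellVerts (A j) = ∅) ∧
  (P : Set Cell) = Set.range A

/-- A closed path polyomino. -/
def IsClosedPath (P : Finset Cell) : Prop :=
  ∃ n : ℕ, 5 < n ∧ ∃ A : ZMod n → Cell, IsClosedPathSeq n A P
lemma cellVerts_mem_iff (c v : Cell) : v ∈ cellVerts c ↔
    (v.1 = c.1 ∨ v.1 = c.1 + 1) ∧ (v.2 = c.2 ∨ v.2 = c.2 + 1) := by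
  obtain ⟨a, b⟩ := c
  obtain ⟨x, y⟩ := v
  simp only [cellVerts, Finset.mem_insert, Finset.mem_singleton, Prod.mk.injEq]
  tauto

lemma card_sdiff_of_edgeAdj (c d : Cell) (h : EdgeAdj c d) :
    (cellVerts d \ cellVerts c).card = 2 := by
  obtain ⟨a, b⟩ := c
  obtain ⟨x, y⟩ := d
  rcases h with ⟨h1, h2 | h2⟩ | ⟨h1, h2 | h2⟩ <;> simp only at h1 h2
  · have : cellVerts (x, y) \ cellVerts (a, b) = {(x, y), (x + 1, y)} := by
      ext ⟨p, q⟩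
      simp only [Finset.mem_sdiff, cellVerts_mem_iff, Finset.mem_insert, Finset.mem_singleton,
        Prod.mk.injEq]
      omega
    rw [this]; exact Finset.card_pair (by simp)
  · have : cellVerts (x, y) \ cellVerts (a, b) = {(x, y + 1), (x + 1, y + 1)} := by
      ext ⟨p, q⟩
      simp only [Finset.mem_sdiff, cellVerts_mem_iff, Finset.mem_insert, Finset.mem_singleton,
        Prod.mk.injEq]
      omega
    rw [this]; exact Finset.card_pair (by simp)
  · have : cellVerts (x, y) \ cellVerts (a, b) = {(x, y), (x, y + 1)} := by
      ext ⟨p, q⟩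
      simp only [Finset.mem_sdiff, cellVerts_mem_iff, Finset.mem_insert, Finset.mem_singleton,
        Prod.mk.injEq]
      omega
    rw [this]; exact Finset.card_pair (by simp)
  · have : cellVerts (x, y) \ cellVerts (a, b) = {(x + 1, y), (x + 1, y + 1)} := by
      ext ⟨p, q⟩
      simp only [Finset.mem_sdiff, cellVerts_mem_iff, Finset.mem_insert, Finset.mem_singleton,
        Prod.mk.injEq]
      omega
    rw [this]; exact Finset.card_pair (by simp)

lemma mem_middle (c d e v : Cell) (h1 : EdgeAdj c d) (h2 : EdgeAdj d e) (hne : c ≠ e)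
    (hc : v ∈ cellVerts c) (he : v ∈ cellVerts e) : v ∈ cellVerts d := by
  rw [cellVerts_mem_iff] at *
  rw [Ne, Prod.ext_iff] at hne
  unfold EdgeAdj at *
  omega

lemma zmod_ne_zero (n : ℕ) (hn : 5 < n) (k : ℕ) (h0 : 0 < k) (hk : k ≤ 5) :
    (k : ZMod n) ≠ 0 := by
  rw [Ne, ZMod.natCast_eq_zero_iff]
  intro h
  have := Nat.le_of_dvd h0 h
  omega

/-- If `P` is a closed path polyomino, then `|V(P)| = 2 · rank(P)`. -/
theorem closedPath_card_verts_eq_two_mul_rank (P : Finset Cell) (hP : IsClosedPath P) :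
    (polyVerts P).card = 2 * P.card := by
  obtain ⟨n, hn, A, hadj, hinj, hdis, hrange⟩ := hP
  haveI : NeZero n := ⟨by omega⟩
  have hPA : P = Finset.univ.image A := by
    apply Finset.coe_injective; rw [hrange]; simp
  have e1 := zmod_ne_zero n hn 1 (by omega) (by omega)
  have e2 := zmod_ne_zero n hn 2 (by omega) (by omega)
  have e3 := zmod_ne_zero n hn 3 (by omega) (by omega)
  have e4 := zmod_ne_zero n hn 4 (by omega) (by omega)
  have e5 := zmod_ne_zero n hn 5 (by omega) (by omega)
  push_cast at e1 e2 e3 e4 e5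
  have hcard : P.card = n := by
    rw [hPA, Finset.card_image_of_injective _ hinj, Finset.card_univ, ZMod.card]
  have hV : polyVerts P = Finset.univ.biUnion
      (fun i : ZMod n => cellVerts (A (i + 1)) \ cellVerts (A i)) := by
    ext v
    simp only [polyVerts, hPA, Finset.mem_biUnion, Finset.mem_image, Finset.mem_univ, true_and,
      Finset.mem_sdiff]
    constructor
    · rintro ⟨_, ⟨i, rfl⟩, hv⟩
      by_contra hcon
      push Not at hcon
      have step : ∀ j, v ∈ cellVerts (A j) → v ∈ cellVerts (A (j - 1)) := by
        intro j hj
        apply hcon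
        rwa [sub_add_cancel]
      have h3 := step _ (step _ (step _ hv))
      have := hdis i (i - 1 - 1 - 1) (by
        simp only [Set.mem_insert_iff, Set.mem_singleton_iff]
        rintro (h | h | h | h | h)
        · exact e1 (by linear_combination -h)
        · exact e2 (by linear_combination -h)
        · exact e3 (by linear_combination -h)
        · exact e4 (by linear_combination -h)
        · exact e5 (by linear_combination -h))
      have hmem := Finset.mem_inter.2 ⟨hv, h3⟩
      rw [this] at hmem
      simp at hmem
    · rintro ⟨i, hv, _⟩
      exact ⟨_, ⟨i + 1, rfl⟩, hv⟩
  have key : ∀ i v, v ∈ cellVerts (A (i + 1)) → v ∉ cellVerts (A (i + 2)) →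
      v ∈ cellVerts (A (i + 3)) → False := by
    intro i v h1 h2 h3
    apply h2
    have a1 := hadj (i + 1)
    have a2 := hadj (i + 2)
    rw [show i + 1 + 1 = i + 2 by ring] at a1
    rw [show i + 2 + 1 = i + 3 by ring] at a2
    refine mem_middle _ _ _ v a1 a2 ?_ h1 h3
    intro h
    exact e2 (by linear_combination -(hinj h))
  rw [hV, Finset.card_biUnion, Finset.sum_congr rfl
    (fun i _ => card_sdiff_of_edgeAdj _ _ (hadj i)), hcard]
  · simp [ZMod.card, mul_comm]
  · intro i _ j _ hij
    rw [Function.onFun, Finset.disjoint_left]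
    intro v hi hj
    rw [Finset.mem_sdiff] at hi hj
    by_cases hm : j + 1 ∈ ({i + 1 - 2, i + 1 - 1, i + 1, i + 1 + 1, i + 1 + 2} : Set (ZMod n))
    · simp only [Set.mem_insert_iff, Set.mem_singleton_iff] at hm
      rcases hm with h | h | h | h | h
      · have hi' : i = j + 2 := by linear_combination -h
        subst hi'
        exact key j v hj.1 hi.2 (by rw [show j + 3 = j + 2 + 1 by ring]; exact hi.1)
      · have hi' : i = j + 1 := by linear_combination -h
        subst hi'
        exact hi.2 hj.1
      · exact hij (by linear_combination -h)
      · have hi' : j = i + 1 := by linear_combination h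
        subst hi'
        exact hj.2 hi.1
      · have hi' : j = i + 2 := by linear_combination h
        subst hi'
        exact key i v hi.1 hj.2 (by rw [show i + 3 = i + 2 + 1 by ring]; exact hj.1)
    · have := hdis _ _ hm
      have hmem := Finset.mem_inter.2 ⟨hi.1, hj.1⟩
      rw [this] at hmem
      simp at hmem
end

section
/- Let P be a closed path polyomino and K a field. Then the Krull dimension of the coordinate ring K[P] = S_P/I_P equals |V(P)| − rank(P). -/
open scoped MonomialOrder

/-- `[a,b]` is an inner interval of `P`: it is a proper interval of `ℤ²` and every cell
of `ℤ²` contained in it belongs to `P`. -/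
def IsInnerInterval (P : Finset Cell) (a b : Cell) : Prop :=
  a.1 < b.1 ∧ a.2 < b.2 ∧
  ∀ c : Cell, a.1 ≤ c.1 → c.1 + 1 ≤ b.1 → a.2 ≤ c.2 → c.2 + 1 ≤ b.2 → c ∈ P

/-- The inner 2-minors of `P` : for each inner interval `[a,b]` of `P` with diagonal
corners `a, b` and anti-diagonal corners `c, d`, the binomial `x_a x_b - x_c x_d`. -/
def innerMinors (K : Type*) [Field K] (P : Finset Cell) :
    Set (MvPolynomial {v // v ∈ polyVerts P} K) :=
  { f | ∃ a b c d : {v // v ∈ polyVerts P},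
      IsInnerInterval P (a : Cell) (b : Cell) ∧
      (c : Cell) = ((a : Cell).1, (b : Cell).2) ∧
      (d : Cell) = ((b : Cell).1, (a : Cell).2) ∧
      f = MvPolynomial.X a * MvPolynomial.X b - MvPolynomial.X c * MvPolynomial.X d }

/-- The polyomino ideal `I_P ⊆ S_P = K[x_v : v ∈ V(P)]`, generated by the
inner 2-minors of `P`. -/
noncomputable def polyIdeal (K : Type*) [Field K] (P : Finset Cell) :
    Ideal (MvPolynomial {v // v ∈ polyVerts P} K) :=
  Ideal.span (innerMinors K P)

/-- The height of an ideal: the infimum of the heights of the prime ideals containing it. -/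
noncomputable def idealHeight {R : Type*} [CommRing R] (I : Ideal R) : ℕ∞ :=
  ⨅ (p : PrimeSpectrum R) (_ : I ≤ p.asIdeal), Order.height p

universe u₁ u₂ u₃

/-- `g` is the initial term of `f` with respect to the monomial order `m`. -/
def IsInitialTerm {σ : Type u₁} {K : Type u₂} [Field K] (m : MonomialOrder.{u₁, u₃} σ)
    (f g : MvPolynomial σ K) : Prop :=
  ∃ d ∈ f.support, (∀ e ∈ f.support, e ≼[m] d) ∧
    g = MvPolynomial.monomial d (MvPolynomial.coeff d f)

/-- A graded ideal `I` of a polynomial ring is of König type if, with `h` the height of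
`I`, there are homogeneous polynomials `f 0, …, f (h-1)` forming part of a minimal system
of homogeneous generators of `I` and a monomial order such that the corresponding initial
terms form a regular sequence. -/
def IsKoenigType {σ : Type u₁} {K : Type u₂} [Field K] (I : Ideal (MvPolynomial σ K)) : Prop :=
  ∃ h : ℕ, idealHeight I = (h : ℕ∞) ∧
    ∃ (f : Fin h → MvPolynomial σ K) (G : Set (MvPolynomial σ K)),
      Function.Injective f ∧ (∀ i, f i ∈ G) ∧
      (∀ g ∈ G, ∃ n, MvPolynomial.IsHomogeneous g n) ∧
      Ideal.span G = I ∧ (∀ g ∈ G, Ideal.span (G \ {g}) ≠ I) ∧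
      ∃ (m : MonomialOrder.{u₁, u₁} σ) (ini : Fin h → MvPolynomial σ K),
        (∀ i, IsInitialTerm m (f i) (ini i)) ∧
        RingTheory.Sequence.IsRegular (MvPolynomial σ K) (List.ofFn ini)

def dv : Fin 4 → ℤ × ℤ := ![(1,0),(0,1),(-1,0),(0,-1)]
def crs (a b : ℤ × ℤ) : ℤ := a.1 * b.2 - a.2 * b.1
def nxt (a b : ℤ × ℤ) (s : ℤ) : ℤ := if crs a b = 0 then s else crs a b
def mm (a b : ℤ × ℤ) (s : ℤ) : ℤ := if crs a b ≠ 0 ∧ nxt a b s = s then 3 else 1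
/-- vertex position relative to the cell -/
def tpos (b : ℤ × ℤ) (s : ℤ) : ℤ × ℤ := ((1 + b.1 - s * b.2) / 2, (1 + b.2 + s * b.1) / 2)
def upos (m : ℤ) (b : ℤ × ℤ) (s : ℤ) : ℤ × ℤ :=
  ((1 - m * b.1 + s * b.2) / 2, (1 - m * b.2 - s * b.1) / 2)
def okk (a b : ℤ × ℤ) : Prop := a + b ≠ 0
def nou (a b c : ℤ × ℤ) : Prop :=
  2 ≤ a.1 + b.1 + c.1 ∨ a.1 + b.1 + c.1 ≤ -2 ∨ 2 ≤ a.2 + b.2 + c.2 ∨ a.2 + b.2 + c.2 ≤ -2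
instance (a b) : Decidable (okk a b) := by unfold okk; infer_instance
instance (a b c) : Decidable (nou a b c) := by unfold nou; infer_instance

set_option maxRecDepth 100000 in
set_option maxHeartbeats 4000000 in
theorem window : ∀ i0 i1 i2 i3 : Fin 4, ∀ b : Bool,
    let e0 := dv i0; let e1 := dv i1; let e2 := dv i2; let e3 := dv i3
    okk e0 e1 → okk e1 e2 → okk e2 e3 → nou e0 e1 e2 → nou e1 e2 e3 →
    let s0 : ℤ := cond b 1 (-1)
    let s1 := nxt e0 e1 s0; let s2 := nxt e1 e2 s1; let s3 := nxt e2 e3 s2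
    let t0 := tpos e0 s0; let t1 := e1 + tpos e1 s1; let t2 := e1 + e2 + tpos e2 s2
    let u1 := e1 + upos (mm e0 e1 s0) e1 s1
    let u2 := e1 + e2 + upos (mm e1 e2 s1) e2 s2
    let u3 := e1 + e2 + e3 + upos (mm e2 e3 s2) e3 s3
    t0 ≠ t1 ∧ t0 ≠ t2 ∧ u1 ≠ u2 ∧ u1 ≠ u3 ∧ u1 ≠ t1 ∧ u1 ≠ t2 ∧ u1 ≠ t0 ∧ u2 ≠ t0 ∧ u3 ≠ t0 ∧
      (mm e1 e2 s1 = 3 → mm e0 e1 s0 = 1) := by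
  decide

theorem dim_le_of_integral {A R : Type*} [CommRing A] [CommRing R] [Algebra A R]
    [Algebra.IsIntegral A R] : ringKrullDim R ≤ ringKrullDim A := by
  refine Order.krullDim_le_of_strictMono (PrimeSpectrum.comap (algebraMap A R)) ?_
  intro p q h
  exact Ideal.IsIntegral.comap_lt_comap h

section upper
variable {K : Type*} [Field K] {σ : Type*} [Fintype σ] {ι : Type*} [Fintype ι]
  {R : Type*} [CommRing R] [Algebra K R]

theorem upper_aux (x : σ → R) (hx : Algebra.adjoin K (Set.range x) = ⊤)
    (a b c d : ι → σ) (hab : Function.Injective (Sum.elim a b))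
    (rel : ∀ i, x (a i) * x (b i) = x (c i) * x (d i))
    (w : σ → ℕ) (hw0 : ∀ v, 0 < w v) (hw : ∀ i, w (c i) + w (d i) < w (a i) + w (b i)) :
    ringKrullDim R ≤ (Fintype.card σ - Fintype.card ι : ℕ) := by
  classical
  let τ := ι ⊕ {v // v ∉ Set.range (Sum.elim a b)}
  let θ : τ → R := Sum.elim (fun i => x (a i) ^ w (b i) - x (b i) ^ w (a i)) (fun v => x v)
  let φ : MvPolynomial τ K →ₐ[K] R := MvPolynomial.aeval θ
  let A : Subalgebra K R := φ.range
  have hθ : ∀ j, θ j ∈ A := fun j => ⟨MvPolynomial.X j, by simp [φ]⟩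
  have hcard : Fintype.card τ = Fintype.card σ - Fintype.card ι := by
    have h1 : Fintype.card {v // v ∈ Set.range (Sum.elim a b)} = Fintype.card (ι ⊕ ι) :=
      (Fintype.card_congr (Equiv.ofInjective _ hab)).symm
    have h2 := Fintype.card_subtype_compl (fun v => v ∈ Set.range (Sum.elim a b))
    have h3 := Fintype.card_le_of_injective _ hab
    simp only [Fintype.card_sum, τ] at *
    rw [h2, h1]
    omega
  let mon : (σ →₀ ℕ) → R := fun f => MvPolynomial.aeval x (MvPolynomial.monomial f (1 : K))
  have mon_add : ∀ f g, mon (f + g) = mon f * mon g := by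
    intro f g
    simp only [mon]
    rw [← map_mul, MvPolynomial.monomial_mul, one_mul]
  have mon_single : ∀ v k, mon (Finsupp.single v k) = x v ^ k := by
    intro v k
    simp only [mon, MvPolynomial.aeval_monomial, map_one, one_mul]
    exact Finsupp.prod_single_index (pow_zero _)
  let wt := Finsupp.weight (R := ℕ) w
  have wt_single : ∀ v k, wt (Finsupp.single v k) = k * w v := by
    intro v k; simp [wt, Finsupp.weight_single]
  let B := ∑ v, w v
  let T : Set (σ →₀ ℕ) := Set.Icc 0 (Finsupp.equivFunOnFinite.symm (fun _ => B))
  have hT : T.Finite := Set.finite_Icc _ _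
  let M : Submodule A R := Submodule.span A (mon '' T)
  have hA : ∀ r ∈ A, ∀ m ∈ M, r * m ∈ M := by
    intro r hr m hm
    exact M.smul_mem (⟨r, hr⟩ : A) hm
  -- key step
  have key : ∀ (p q r s : σ) (f : σ →₀ ℕ) , x p * x q = x r * x s → w r + w s < w p + w q →
      x p ^ w q - x q ^ w p ∈ A → w q < f p →
      (∀ g, wt g < wt f → mon g ∈ M) → mon f ∈ M := by
    intro p q r s f h1 h2 h3 h4 ih
    obtain ⟨f', rfl⟩ : ∃ f', f = Finsupp.single p (w q) + (Finsupp.single p 1 + f') := by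
      refine ⟨f - Finsupp.single p (w q + 1), ?_⟩
      rw [← add_assoc, ← Finsupp.single_add, add_tsub_cancel_of_le]
      exact Finsupp.single_le_iff.2 h4
    have e1 : mon (Finsupp.single p (w q) + (Finsupp.single p 1 + f')) =
        (x p ^ w q - x q ^ w p) * mon (Finsupp.single p 1 + f') +
        mon (Finsupp.single q (w p - 1) + (Finsupp.single r 1 + (Finsupp.single s 1 + f'))) := by
      simp only [mon_add, mon_single]
      obtain ⟨k, hk⟩ : ∃ k, w p = k + 1 := ⟨w p - 1, by have := hw0 p; omega⟩
      simp only [hk, Nat.add_sub_cancel, pow_one]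
      linear_combination (x q ^ k * mon f') * h1
    rw [e1]
    refine M.add_mem (hA _ h3 _ (ih _ ?_)) (ih _ ?_)
    · simp only [map_add, wt_single]
      have := Nat.mul_pos (hw0 q) (hw0 p)
      omega
    · simp only [map_add, wt_single]
      obtain ⟨k, hk⟩ : ∃ k, w p = k + 1 := ⟨w p - 1, by have := hw0 p; omega⟩
      rw [hk] at h2 ⊢
      simp only [Nat.add_sub_cancel]
      nlinarith
  have main : ∀ N, ∀ f, wt f = N → mon f ∈ M := by
    intro N
    induction N using Nat.strong_induction_on with
    | _ N IH =>
    intro f hf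
    have ih : ∀ g, wt g < wt f → mon g ∈ M := fun g hg => IH _ (hf ▸ hg) g rfl
    by_cases c1 : ∃ v, v ∉ Set.range (Sum.elim a b) ∧ 1 ≤ f v
    · obtain ⟨v, hv, hfv⟩ := c1
      obtain ⟨f', rfl⟩ : ∃ f', f = Finsupp.single v 1 + f' := by
        refine ⟨f - Finsupp.single v 1, ?_⟩
        rw [add_tsub_cancel_of_le]
        simpa [Finsupp.single_le_iff] using hfv
      rw [mon_add, mon_single, pow_one]
      refine hA _ (hθ (Sum.inr ⟨v, hv⟩)) _ (ih _ ?_)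
      simp only [map_add, wt_single]
      have := hw0 v
      omega
    by_cases c2 : ∃ i, w (b i) < f (a i)
    · obtain ⟨i, hi⟩ := c2
      exact key _ _ _ _ f (rel i) (hw i) (hθ (Sum.inl i)) hi ih
    by_cases c3 : ∃ i, w (a i) < f (b i)
    · obtain ⟨i, hi⟩ := c3
      refine key _ _ (c i) (d i) f (by rw [mul_comm, rel i]) (by have := hw i; omega) ?_ hi ih
      have := A.neg_mem (hθ (Sum.inl i))
      simpa [θ] using this
    push Not at c1 c2 c3
    refine Submodule.subset_span ⟨f, ⟨zero_le, ?_⟩, rfl⟩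
    intro v
    have hB : ∀ v, w v ≤ B := fun v => Finset.single_le_sum (f := w) (fun _ _ => Nat.zero_le _) (Finset.mem_univ v)
    show f v ≤ B
    by_cases hv : v ∈ Set.range (Sum.elim a b)
    · obtain ⟨i | i, rfl⟩ := hv
      · exact (c2 i).trans (hB _)
      · exact (c3 i).trans (hB _)
    · have := c1 v hv
      omega
  have hM : M = ⊤ := by
    rw [eq_top_iff]
    rintro r -
    have hr : r ∈ (MvPolynomial.aeval (R := K) x).range := by
      rw [← Algebra.adjoin_range_eq_range_aeval, hx]; trivial
    obtain ⟨p, rfl⟩ := hr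
    show MvPolynomial.aeval x p ∈ M
    rw [p.as_sum, map_sum]
    refine M.sum_mem fun f _ => ?_
    have : MvPolynomial.aeval x (MvPolynomial.monomial f (p.coeff f)) =
        algebraMap K R (p.coeff f) * mon f := by
      simp [mon, MvPolynomial.aeval_monomial]
    rw [this]
    exact hA _ (A.algebraMap_mem _) _ (main _ f rfl)
  have : Module.Finite A R := ⟨⟨(hT.image mon).toFinset, by simpa using hM⟩⟩
  calc ringKrullDim R ≤ ringKrullDim A := dim_le_of_integral
    _ ≤ ringKrullDim (MvPolynomial τ K) :=
      ringKrullDim_le_of_surjective φ.rangeRestrict.toRingHom φ.rangeRestrict_surjective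
    _ = _ := by
      rw [MvPolynomial.ringKrullDim_of_isNoetherianRing, ringKrullDim_eq_zero_of_field, zero_add,
        Nat.card_eq_fintype_card, hcard]

theorem upper (x : σ → R) (hx : Algebra.adjoin K (Set.range x) = ⊤)
    (a b c d : ι → σ) (hab : Function.Injective (Sum.elim a b))
    (rel : ∀ i, x (a i) * x (b i) = x (c i) * x (d i))
    (W : σ → ℤ) (hW : ∀ i, W (c i) + W (d i) < W (a i) + W (b i)) :
    ringKrullDim R ≤ (Fintype.card σ - Fintype.card ι : ℕ) := by
  let N : ℤ := 1 + ∑ v, |W v|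
  have hN : ∀ v, 0 < W v + N := by
    intro v
    have h1 := Finset.single_le_sum (f := fun v => |W v|) (fun _ _ => abs_nonneg _) (Finset.mem_univ v)
    have h2 := neg_abs_le (W v)
    simp only [N] at *
    linarith
  refine upper_aux x hx a b c d hab rel (fun v => (W v + N).toNat) (fun v => ?_) (fun i => ?_)
  · have := hN v
    omega
  · have := hN (a i); have := hN (b i); have := hN (c i); have := hN (d i); have := hW i
    omega
end upper

theorem height_max {K : Type*} [Field K] (ι : Type*) [Finite ι] :
    ∀ (P : Ideal (MvPolynomial ι K)), P.IsMaximal → P.height = Nat.card ι := by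
  induction ι using Finite.induction_empty_option with
  | @of_equiv α β e H =>
    intro P hP
    have := RingEquiv.height_map (MvPolynomial.renameEquiv K e.symm).toRingEquiv P
    rw [← this, H _ (Ideal.map_isMaximal_of_equiv _), Nat.card_congr e]
  | h_empty =>
    intro P hP
    have hd : ringKrullDim (MvPolynomial PEmpty K) = 0 := by simp
    have h := Ideal.height_le_ringKrullDim_of_ne_top hP.ne_top
    rw [hd] at h
    have : P.height ≤ 0 := by exact_mod_cast h
    simpa using this
  | @h_option α _ IH =>
    intro P hP
    let e := (MvPolynomial.optionEquivLeft K α).toRingEquiv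
    have hm : (P.map e).IsMaximal := Ideal.map_isMaximal_of_equiv e
    rw [← RingEquiv.height_map e P]
    have h2 : ((P.map e).under (MvPolynomial α K)).IsMaximal :=
      Polynomial.isMaximal_comap_C_of_isJacobsonRing (P.map e)
    generalize P.map e = P' at *
    have hl : P'.LiesOver (P'.under (MvPolynomial α K)) := ⟨rfl⟩
    rw [Polynomial.height_eq_height_add_one (P'.under (MvPolynomial α K)) P', IH _ h2]
    simp


theorem dim_loc_quot {S L Q : Type*} [CommRing S] [CommRing L] [CommRing Q] [Algebra S L]
    (M : Submonoid S) [IsLocalization M L] (π : L →+* Q) (hπ : Function.Surjective π)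
    (I : Ideal S) (h : ∀ f ∈ I, π (algebraMap S L f) = 0) :
    ringKrullDim Q ≤ ringKrullDim (S ⧸ I) := by
  let φ : S →+* Q := π.comp (algebraMap S L)
  have hφ : ∀ f ∈ I, φ f = 0 := h
  let ψ := Ideal.Quotient.lift I φ hφ
  have hφi : Function.Injective (PrimeSpectrum.comap φ) := by
    have : PrimeSpectrum.comap φ = PrimeSpectrum.comap (algebraMap S L) ∘
        PrimeSpectrum.comap π := rfl
    rw [this]
    exact (PrimeSpectrum.localization_comap_injective L M).comp
      (PrimeSpectrum.comap_injective_of_surjective _ hπ)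
  have hψi : Function.Injective (PrimeSpectrum.comap ψ) := by
    have : PrimeSpectrum.comap φ = PrimeSpectrum.comap (Ideal.Quotient.mk I) ∘
        PrimeSpectrum.comap ψ := by
      have h0 : φ = ψ.comp (Ideal.Quotient.mk I) := by
        ext x
        simp [ψ]
      rw [h0]
      rfl
    rw [this] at hφi
    exact hφi.of_comp
  refine Order.krullDim_le_of_strictMono (PrimeSpectrum.comap ψ) ?_
  exact Monotone.strictMono_of_injective (fun p q h => Ideal.comap_mono h) hψi

theorem quot_kill {S : Type*} [CommRing S] {L : Type*} [CommRing L] [Algebra S L] (I : Ideal S)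
    (s : Set S) (m : Ideal S) [m.IsPrime] [IsLocalization.AtPrime L m] (J : Ideal L)
    (hJ : ∀ f ∈ s, algebraMap S L f ∈ J)
    (hI : ∀ (φ : S →+* L ⧸ J), (∀ f ∈ s, φ f = 0) →
      (∀ f ∉ m, IsUnit (φ f)) → ∀ f ∈ I, φ f = 0) :
    ringKrullDim (L ⧸ J) ≤ ringKrullDim (S ⧸ I) := by
  refine dim_loc_quot m.primeCompl (Ideal.Quotient.mk J) Ideal.Quotient.mk_surjective I ?_
  refine hI ((Ideal.Quotient.mk J).comp (algebraMap S L)) ?_ ?_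
  · intro f hf
    exact Ideal.Quotient.eq_zero_iff_mem.2 (hJ f hf)
  · intro f hf
    exact (IsLocalization.map_units L (⟨f, hf⟩ : m.primeCompl)).map (Ideal.Quotient.mk J)

universe uK uS
theorem lower {K : Type uK} [Field K] {σ : Type uS} [Finite σ] (I : Ideal (MvPolynomial σ K))
    (s : Finset (MvPolynomial σ K)) (m : Ideal (MvPolynomial σ K)) [m.IsMaximal]
    (hs : ∀ f ∈ s, f ∈ m)
    (hI : ∀ (Q : Type (max uK uS)) [CommRing Q] (φ : MvPolynomial σ K →+* Q), (∀ f ∈ s, φ f = 0) →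
      (∀ f ∉ m, IsUnit (φ f)) → ∀ f ∈ I, φ f = 0) :
    ((Nat.card σ - s.card : ℕ) : WithBot ℕ∞) ≤ ringKrullDim (MvPolynomial σ K ⧸ I) := by
  classical
  let L := Localization.AtPrime m
  let al := algebraMap (MvPolynomial σ K) L
  let s' : Finset L := s.image al
  have h1 : ringKrullDim L = (Nat.card σ : ℕ) := by
    rw [IsLocalization.AtPrime.ringKrullDim_eq_height m, height_max σ m inferInstance]
    rfl
  have h2 : ringKrullDim L ≤ ringKrullDim (L ⧸ Ideal.span (s' : Set L)) + (s'.card : ℕ) := by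
    refine ringKrullDim_le_ringKrullDim_quotient_add_card s' ?_
    rw [IsLocalRing.ringJacobson_eq_maximalIdeal]
    intro f hf
    simp only [s', Finset.coe_image, Set.mem_image] at hf
    obtain ⟨g, hg, rfl⟩ := hf
    exact (IsLocalization.AtPrime.to_map_mem_maximal_iff L m g).2 (hs g hg)
  have h3 : ringKrullDim (L ⧸ Ideal.span (s' : Set L)) ≤ ringKrullDim (MvPolynomial σ K ⧸ I) := by
    refine quot_kill I (s : Set (MvPolynomial σ K)) m (Ideal.span (s' : Set L)) ?_ ?_
    · intro f hf
      refine Ideal.subset_span ?_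
      simp only [s', Finset.coe_image]
      exact ⟨f, hf, rfl⟩
    · intro φ h1 h2
      exact hI (L ⧸ Ideal.span (s' : Set L)) φ h1 h2
  have h4 : s'.card ≤ s.card := Finset.card_image_le
  rw [h1] at h2
  have h5 : ((Nat.card σ : ℕ) : WithBot ℕ∞) ≤
      ringKrullDim (MvPolynomial σ K ⧸ I) + (s.card : ℕ) :=
    h2.trans (add_le_add h3 (by exact_mod_cast h4))
  generalize ringKrullDim (MvPolynomial σ K ⧸ I) = D at h5
  induction D using WithBot.recBotCoe with
  | bot => simp at h5
  | coe D =>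
    induction D using ENat.recTopCoe with
    | top => exact le_top
    | coe D =>
      have : Nat.card σ ≤ D + s.card := by exact_mod_cast h5
      have : Nat.card σ - s.card ≤ D := by omega
      have h6 : ((Nat.card σ - s.card : ℕ) : ℕ∞) ≤ (D : ℕ∞) := Nat.cast_le.2 this
      exact WithBot.coe_le_coe.2 h6

theorem vert_mem {P : Finset Cell} {c v : Cell} (hc : c ∈ P) (h1 : v.1 = c.1 ∨ v.1 = c.1 + 1)
    (h2 : v.2 = c.2 ∨ v.2 = c.2 + 1) : v ∈ polyVerts P := by
  unfold polyVerts
  rw [Finset.mem_biUnion]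
  refine ⟨c, hc, ?_⟩
  obtain ⟨x, y⟩ := v
  obtain ⟨p, q⟩ := c
  simp only [cellVerts, Finset.mem_insert, Finset.mem_singleton, Prod.mk.injEq] at *
  omega

theorem tele_mul {Q : Type*} [CommRing Q] {a b c d e f : Q} (hb : IsUnit b) (he : IsUnit e)
    (h1 : a * e = d * b) (h2 : b * f = e * c) : a * f = d * c := by
  refine (hb.mul he).mul_left_cancel ?_
  calc b * e * (a * f) = (a * e) * (b * f) := by ring
    _ = (d * b) * (e * c) := by rw [h1, h2]
    _ = b * e * (d * c) := by ring

theorem tele {Q : Type*} [CommRing Q] (g : Cell → Q) (hg : ∀ v, IsUnit (g v)) (P : Finset Cell)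
    (hP : ∀ c ∈ P, g c * g (c.1 + 1, c.2 + 1) = g (c.1, c.2 + 1) * g (c.1 + 1, c.2))
    (a : Cell) (q : ℕ) (p : ℕ)
    (h : ∀ i j : ℕ, i < p → j < q → (a.1 + i, a.2 + j) ∈ P) :
      g a * g (a.1 + p, a.2 + q) = g (a.1, a.2 + q) * g (a.1 + p, a.2) := by
  induction p with
  | zero => simp; ring
  | succ p ih =>
    have h1 := ih (fun i j hi hj => h i j (by omega) hj)
    have h2 : g (a.1 + p, a.2) * g (a.1 + p + 1, a.2 + q) =
        g (a.1 + p, a.2 + q) * g (a.1 + p + 1, a.2) := by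
      clear h1 ih
      induction q with
      | zero => simp
      | succ q ih =>
        have h3 := ih (fun i j hi hj => h i j hi (by omega))
        have h4 := hP _ (h p q (by omega) (by omega))
        have := tele_mul (hg (a.1 + p, a.2 + q)) (hg (a.1 + p + 1, a.2 + q))
          (h3.trans (mul_comm _ _)) (h4.trans (mul_comm _ _))
        push_cast
        rw [← add_assoc]
        exact this.trans (mul_comm _ _)
    have := tele_mul (hg (a.1 + p, a.2)) (hg (a.1 + p, a.2 + q)) h1 h2
    push_cast
    rw [← add_assoc]
    exact this

theorem lower_main (K : Type*) [Field K] (P : Finset Cell) :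
    (((polyVerts P).card - P.card : ℕ) : WithBot ℕ∞) ≤
    ringKrullDim (MvPolynomial {v // v ∈ polyVerts P} K ⧸ polyIdeal K P) := by
  classical
  let V := {v // v ∈ polyVerts P}
  let G : Cell → MvPolynomial V K := fun v =>
    if h : v ∈ polyVerts P then MvPolynomial.X ⟨v, h⟩ else 1
  have hG : ∀ v : V, G v = MvPolynomial.X v := fun v => by simp [G]
  let F : Cell → MvPolynomial V K := fun c =>
    G c * G (c.1 + 1, c.2 + 1) - G (c.1, c.2 + 1) * G (c.1 + 1, c.2)
  let ev : MvPolynomial V K →+* K := MvPolynomial.eval (fun _ => 1)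
  have hev : ∀ v, ev (G v) = 1 := by
    intro v
    simp only [G, ev]
    split_ifs <;> simp
  have hsurj : Function.Surjective ev := fun k => ⟨MvPolynomial.C k, by simp [ev]⟩
  have hm : (RingHom.ker ev).IsMaximal := RingHom.ker_isMaximal_of_surjective ev hsurj
  have key := lower (polyIdeal K P) (P.image F) (RingHom.ker ev) ?_ ?_
  · refine le_trans ?_ key
    have h1 : (P.image F).card ≤ P.card := Finset.card_image_le
    have h2 : Nat.card V = (polyVerts P).card := by simp [V]
    have h3 : (polyVerts P).card - P.card ≤ Nat.card V - (P.image F).card := by omega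
    exact Nat.cast_le.2 h3
  · intro f hf
    obtain ⟨c, hc, rfl⟩ := Finset.mem_image.1 hf
    simp [RingHom.mem_ker, F, hev]
  · intro Q _ φ h1 h2 f hf
    have hu : ∀ v, IsUnit (φ (G v)) := fun v => h2 _ (by simp [RingHom.mem_ker, hev])
    have hc : ∀ c ∈ P, φ (G c) * φ (G (c.1 + 1, c.2 + 1)) =
        φ (G (c.1, c.2 + 1)) * φ (G (c.1 + 1, c.2)) := by
      intro c hc
      have := h1 _ (Finset.mem_image_of_mem F hc)
      simpa [F, sub_eq_zero] using this
    have hle : polyIdeal K P ≤ RingHom.ker φ := by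
      refine Ideal.span_le.2 ?_
      rintro f ⟨a, b, c, d, ⟨hi1, hi2, hi3⟩, hcc, hdd, rfl⟩
      have hp : ((b : Cell).1 : ℤ) = (a : Cell).1 + ((b : Cell).1 - (a : Cell).1).toNat := by omega
      have hq : ((b : Cell).2 : ℤ) = (a : Cell).2 + ((b : Cell).2 - (a : Cell).2).toNat := by omega
      have ht := tele (fun v => φ (G v)) hu P hc a ((b : Cell).2 - (a : Cell).2).toNat
        ((b : Cell).1 - (a : Cell).1).toNat (fun i j hi hj => hi3 _ (by simp) (by simp; omega)
          (by simp) (by simp; omega))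
      rw [← hp, ← hq, ← hcc, ← hdd] at ht
      have hb : G ((b : Cell).1, (b : Cell).2) = MvPolynomial.X b := hG b
      rw [hb, hG, hG, hG] at ht
      simp only [SetLike.mem_coe, RingHom.mem_ker, map_sub, map_mul, ht, sub_self]
    exact hle hf

def cpos (b : ℤ × ℤ) (s : ℤ) : ℤ × ℤ := ((1 + b.1 + s * b.2) / 2, (1 + b.2 - s * b.1) / 2)
def dpos (m : ℤ) (b : ℤ × ℤ) (s : ℤ) : ℤ × ℤ :=
  ((1 - m * b.1 - s * b.2) / 2, (1 - m * b.2 + s * b.1) / 2)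

theorem dv_cases {e : ℤ × ℤ} (h : ∃ k, e = dv k) :
    e = (1, 0) ∨ e = (0, 1) ∨ e = (-1, 0) ∨ e = (0, -1) := by
  obtain ⟨k, rfl⟩ := h
  revert k
  decide

theorem local_mul {R : Type*} [CommRing R] (G : Cell → R) (P : Finset Cell)
    (hG : ∀ a b, IsInnerInterval P a b → G a * G b = G (a.1, b.2) * G (b.1, a.2))
    (x : Cell) (e : ℤ × ℤ) (s m : ℤ) (he : ∃ k, e = dv k) (hs : s = 1 ∨ s = -1)
    (hm : m = 1 ∨ m = 3) (hx : x ∈ P) (hx' : m = 3 → x - e ∈ P) :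
    G (x + upos m e s) * G (x + tpos e s) = G (x + cpos e s) * G (x + dpos m e s) := by
  obtain ⟨p, q⟩ := x
  have one : G (p, q) * G (p + 1, q + 1) = G (p, q + 1) * G (p + 1, q) := by
    refine hG _ _ ⟨by simp, by simp, ?_⟩
    rintro ⟨y, z⟩ h1 h2 h3 h4
    simp only at h1 h2 h3 h4
    have : y = p := by omega
    have : z = q := by omega
    subst_vars
    exact hx
  have hor : ∀ r, (r, q) ∈ P → (r + 1, q) ∈ P →
      G (r, q) * G (r + 2, q + 1) = G (r, q + 1) * G (r + 2, q) := by
    intro r hr1 hr2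
    refine hG _ _ ⟨by simp, by simp, ?_⟩
    rintro ⟨y, z⟩ h1 h2 h3 h4
    simp only at h1 h2 h3 h4
    have : z = q := by omega
    have : y = r ∨ y = r + 1 := by omega
    subst_vars
    rcases this with rfl | rfl
    · exact hr1
    · exact hr2
  have ver : ∀ r, (p, r) ∈ P → (p, r + 1) ∈ P →
      G (p, r) * G (p + 1, r + 2) = G (p, r + 2) * G (p + 1, r) := by
    intro r hr1 hr2
    refine hG _ _ ⟨by simp, by simp, ?_⟩
    rintro ⟨y, z⟩ h1 h2 h3 h4
    simp only at h1 h2 h3 h4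
    have : y = p := by omega
    have : z = r ∨ z = r + 1 := by omega
    subst_vars
    rcases this with rfl | rfl
    · exact hr1
    · exact hr2
  rcases hm with rfl | rfl
  · rcases dv_cases he with rfl | rfl | rfl | rfl <;> rcases hs with rfl | rfl <;>
      simp [upos, tpos, cpos, dpos] <;>
      first | linear_combination one | linear_combination -one
  · have h := hx' rfl
    rcases dv_cases he with rfl | rfl | rfl | rfl
    · have := hor (p - 1) (by simpa using h) (by simpa using hx)
      rw [show p - 1 + 2 = p + 1 by ring, sub_eq_add_neg] at this
      rcases hs with rfl | rfl <;> simp [upos, tpos, cpos, dpos] <;>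
        first | linear_combination this | linear_combination -this
    · have := ver (q - 1) (by simpa using h) (by simpa using hx)
      rw [show q - 1 + 2 = q + 1 by ring, sub_eq_add_neg] at this
      rcases hs with rfl | rfl <;> simp [upos, tpos, cpos, dpos] <;>
        first | linear_combination this | linear_combination -this
    · have := hor p (by simpa using hx) (by simpa using h)
      rcases hs with rfl | rfl <;> simp [upos, tpos, cpos, dpos] <;>
        first | linear_combination this | linear_combination -this
    · have := ver q (by simpa using hx) (by simpa using h)
      rcases hs with rfl | rfl <;> simp [upos, tpos, cpos, dpos] <;>
        first | linear_combination this | linear_combination -this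

def curv (W : Cell → ℤ) (c : Cell) : ℤ :=
  W c + W (c.1 + 1, c.2 + 1) - W (c.1, c.2 + 1) - W (c.1 + 1, c.2)

theorem local_add (W : Cell → ℤ)
    (x : Cell) (e : ℤ × ℤ) (s m : ℤ) (he : ∃ k, e = dv k) (hs : s = 1 ∨ s = -1)
    (hm : m = 1 ∨ m = 3) (h1 : m = 1 → curv W x = s * (e.1 ^ 2 - e.2 ^ 2))
    (h3 : m = 3 → curv W x = 2 * (s * (e.1 ^ 2 - e.2 ^ 2)) ∧
      curv W (x - e) = - (s * (e.1 ^ 2 - e.2 ^ 2))) :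
    W (x + cpos e s) + W (x + dpos m e s) < W (x + upos m e s) + W (x + tpos e s) := by
  obtain ⟨p, q⟩ := x
  rcases hm with rfl | rfl
  · have := h1 rfl
    clear h1 h3
    rcases dv_cases he with rfl | rfl | rfl | rfl <;> rcases hs with rfl | rfl <;>
      simp [upos, tpos, cpos, dpos, curv] at * <;> linarith
  · obtain ⟨h, h'⟩ := h3 rfl
    clear h1 h3
    rcases dv_cases he with rfl | rfl | rfl | rfl <;> rcases hs with rfl | rfl <;>
      simp [upos, tpos, cpos, dpos, curv, sub_eq_add_neg, add_assoc] at * <;> linarith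

theorem local_vert (x : Cell) (e : ℤ × ℤ) (s m : ℤ) (he : ∃ k, e = dv k) (hs : s = 1 ∨ s = -1)
    (hm : m = 1 ∨ m = 3) :
    x + tpos e s ∈ cellVerts x ∧ x + cpos e s ∈ cellVerts x ∧
    x + upos m e s ∈ cellVerts (x - e) ∧ x + dpos m e s ∈ cellVerts (x - e) := by
  obtain ⟨p, q⟩ := x
  rcases hm with rfl | rfl <;>
  rcases dv_cases he with rfl | rfl | rfl | rfl <;> rcases hs with rfl | rfl <;>
    simp [upos, tpos, cpos, dpos, cellVerts] <;> omega

theorem exists_sign {n : ℕ} [NeZero n] (c : ZMod n → ℤ) (hc : ∀ i, c i = 0 ∨ c i = 1 ∨ c i = -1) :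
    ∃ s : ZMod n → ℤ, (∀ i, s i = 1 ∨ s i = -1) ∧
      ∀ i, s i = if c i = 0 then s (i - 1) else c i := by
  classical
  by_cases h : ∀ i, c i = 0
  · exact ⟨fun _ => 1, fun _ => Or.inl rfl, fun i => by simp [h]⟩
  · push Not at h
    obtain ⟨j, hj⟩ := h
    have hex : ∀ i : ZMod n, ∃ k : ℕ, c (i - k) ≠ 0 := by
      intro i
      refine ⟨(i - j).val, ?_⟩
      simpa using hj
    refine ⟨fun i => c (i - (Nat.find (hex i) : ℕ)), ?_, ?_⟩
    · intro i
      have := Nat.find_spec (hex i)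
      rcases hc (i - (Nat.find (hex i) : ℕ)) with h | h
      · exact absurd h this
      · exact h
    · intro i
      split_ifs with h0
      · have : Nat.find (hex i) = Nat.find (hex (i - 1)) + 1 := by
          rw [Nat.find_eq_iff]
          constructor
          · have := Nat.find_spec (hex (i - 1))
            push_cast
            rwa [show i - ((Nat.find (hex (i - 1)) : ZMod n) + 1) =
              i - 1 - (Nat.find (hex (i - 1)) : ZMod n) by ring]
          · intro k hk
            rcases k with _ | k
            · simpa using h0
            · have := Nat.find_min (hex (i - 1)) (m := k) (by omega)
              push_cast
              rwa [show i - ((k : ZMod n) + 1) = i - 1 - k by ring]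
        simp only [this]
        push_cast
        congr 1
        ring
      · have : Nat.find (hex i) = 0 := by
          rw [Nat.find_eq_zero]
          simpa using h0
        simp [this]

theorem crs_cases : ∀ k l : Fin 4, crs (dv k) (dv l) = 0 ∨ crs (dv k) (dv l) = 1 ∨
    crs (dv k) (dv l) = -1 := by decide

theorem mm_cases (a b : ℤ × ℤ) (s : ℤ) : mm a b s = 1 ∨ mm a b s = 3 := by
  unfold mm; split_ifs <;> simp

theorem mm_three {a b : ℤ × ℤ} {s : ℤ} (ha : ∃ k, a = dv k) (hb : ∃ k, b = dv k)
    (h : mm a b s = 3) :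
    nxt a b s = s ∧ a.1 ^ 2 - a.2 ^ 2 = - (b.1 ^ 2 - b.2 ^ 2) := by
  unfold mm at h
  split_ifs at h with h1
  · refine ⟨h1.2, ?_⟩
    have := h1.1
    clear h h1
    obtain ⟨k, rfl⟩ := ha
    obtain ⟨l, rfl⟩ := hb
    revert k l
    decide
  · omega

theorem weight_curv {ι : Type*} [Fintype ι] (A : ι → Cell) (hA : Function.Injective A)
    (κ : ι → ℤ) (j : ι) :
    curv (fun v => ∑ i, κ i * (if (A i).1 < v.1 ∧ (A i).2 < v.2 then 1 else 0)) (A j) = κ j := by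
  classical
  unfold curv
  simp only
  rw [← Finset.sum_add_distrib, ← Finset.sum_sub_distrib, ← Finset.sum_sub_distrib]
  rw [Finset.sum_eq_single j]
  · simp
  · intro i _ hij
    have hne : (A i).1 ≠ (A j).1 ∨ (A i).2 ≠ (A j).2 := by
      by_contra! h
      exact hij (hA (Prod.ext h.1 h.2))
    rw [← mul_add, ← mul_sub, ← mul_sub]
    refine mul_eq_zero_of_right _ ?_
    split_ifs <;> omega
  · simp

theorem mem_cellVerts_iff {c v : Cell} : v ∈ cellVerts c ↔
    (v.1 = c.1 ∨ v.1 = c.1 + 1) ∧ (v.2 = c.2 ∨ v.2 = c.2 + 1) := by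
  obtain ⟨x, y⟩ := v
  obtain ⟨p, q⟩ := c
  simp only [cellVerts, Finset.mem_insert, Finset.mem_singleton, Prod.mk.injEq]
  omega

theorem window' {e0 e1 e2 e3 : ℤ × ℤ} {s0 s1 s2 s3 : ℤ} (h0 : ∃ k, e0 = dv k)
    (h1 : ∃ k, e1 = dv k) (h2 : ∃ k, e2 = dv k) (h3 : ∃ k, e3 = dv k) (hs : s0 = 1 ∨ s0 = -1)
    (o1 : okk e0 e1) (o2 : okk e1 e2) (o3 : okk e2 e3) (n1 : nou e0 e1 e2) (n2 : nou e1 e2 e3)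
    (hs1 : s1 = nxt e0 e1 s0) (hs2 : s2 = nxt e1 e2 s1) (hs3 : s3 = nxt e2 e3 s2)
    {t0 t1 t2 u1 u2 u3 x0 x1 x2 x3 : ℤ × ℤ}
    (hx1 : x1 = x0 + e1) (hx2 : x2 = x1 + e2) (hx3 : x3 = x2 + e3)
    (ht0 : t0 = x0 + tpos e0 s0) (ht1 : t1 = x1 + tpos e1 s1) (ht2 : t2 = x2 + tpos e2 s2)
    (hu1 : u1 = x1 + upos (mm e0 e1 s0) e1 s1)
    (hu2 : u2 = x2 + upos (mm e1 e2 s1) e2 s2)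
    (hu3 : u3 = x3 + upos (mm e2 e3 s2) e3 s3) :
    t0 ≠ t1 ∧ t0 ≠ t2 ∧ u1 ≠ u2 ∧ u1 ≠ u3 ∧ u1 ≠ t1 ∧ u1 ≠ t2 ∧ u1 ≠ t0 ∧ u2 ≠ t0 ∧ u3 ≠ t0 ∧
      (mm e1 e2 s1 = 3 → mm e0 e1 s0 = 1) := by
  obtain ⟨k0, rfl⟩ := h0
  obtain ⟨k1, rfl⟩ := h1
  obtain ⟨k2, rfl⟩ := h2
  obtain ⟨k3, rfl⟩ := h3
  obtain ⟨b, rfl⟩ : ∃ b : Bool, s0 = cond b 1 (-1) := by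
    rcases hs with rfl | rfl
    · exact ⟨true, rfl⟩
    · exact ⟨false, rfl⟩
  have w := window k0 k1 k2 k3 b o1 o2 o3 n1 n2
  subst hs1 hs2 hs3 hx1 hx2 hx3 ht0 ht1 ht2 hu1 hu2 hu3
  simpa only [add_assoc, ne_eq, add_right_inj] using w

theorem upper_main (K : Type*) [Field K] (P : Finset Cell) (hP : IsClosedPath P) :
    ringKrullDim (MvPolynomial {v // v ∈ polyVerts P} K ⧸ polyIdeal K P) ≤
    (((polyVerts P).card - P.card : ℕ) : WithBot ℕ∞) := by
  classical
  obtain ⟨n, hn, A, hadj, hinj, hdisj, hrange⟩ := hP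
  have : NeZero n := ⟨by omega⟩
  have hnz : ∀ k : ℕ, 0 < k → k < 6 → (k : ZMod n) ≠ 0 := by
    intro k hk hk5 h
    rw [ZMod.natCast_eq_zero_iff] at h
    have := Nat.le_of_dvd hk h
    omega
  have z1 : (1 : ZMod n) ≠ 0 := by simpa using hnz 1 (by norm_num) (by norm_num)
  have z2 : (2 : ZMod n) ≠ 0 := by simpa using hnz 2 (by norm_num) (by norm_num)
  have z3 : (3 : ZMod n) ≠ 0 := by simpa using hnz 3 (by norm_num) (by norm_num)
  have z4 : (4 : ZMod n) ≠ 0 := by simpa using hnz 4 (by norm_num) (by norm_num)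
  have z5 : (5 : ZMod n) ≠ 0 := by simpa using hnz 5 (by norm_num) (by norm_num)
  have hAP : ∀ i, A i ∈ P := by
    intro i
    have : A i ∈ (P : Set Cell) := hrange ▸ Set.mem_range_self i
    exact this
  have hcard : P.card = n := by
    have h1 : P = Finset.univ.image A := by
      apply Finset.coe_injective
      rw [hrange]
      simp
    rw [h1, Finset.card_image_of_injective _ hinj, Finset.card_univ, ZMod.card]
  -- directions
  let e : ZMod n → ℤ × ℤ := fun i => A i - A (i - 1)
  have he : ∀ i, ∃ k, e i = dv k := by
    intro i
    have h := hadj (i - 1)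
    rw [sub_add_cancel] at h
    have hh : e i = ((A i).1 - (A (i - 1)).1, (A i).2 - (A (i - 1)).2) := rfl
    rw [hh]
    rcases h with ⟨h1, h2 | h2⟩ | ⟨h1, h2 | h2⟩
    · exact ⟨3, by simp only [dv]; ext <;> simp <;> omega⟩
    · exact ⟨1, by simp only [dv]; ext <;> simp <;> omega⟩
    · exact ⟨2, by simp only [dv]; ext <;> simp <;> omega⟩
    · exact ⟨0, by simp only [dv]; ext <;> simp <;> omega⟩
  have hprev : ∀ i, A i - e i = A (i - 1) := fun i => by simp [e]
  have hstep : ∀ i, A (i + 1) = A i + e (i + 1) := fun i => by simp [e]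
  obtain ⟨s, hs, hsn⟩ := exists_sign (fun i => crs (e (i - 1)) (e i)) (by
    intro i
    obtain ⟨k, hk⟩ := he (i - 1)
    obtain ⟨l, hl⟩ := he i
    simp only [hk, hl]
    exact crs_cases k l)
  have hsn' : ∀ i, s i = nxt (e (i - 1)) (e i) (s (i - 1)) := hsn
  have hsn1 : ∀ i, s (i + 1) = nxt (e i) (e (i + 1)) (s i) := by
    intro i
    have := hsn' (i + 1)
    rwa [add_sub_cancel_right] at this
  have hok : ∀ i, okk (e i) (e (i + 1)) := by
    intro i h
    have h2 : A (i + 1) = A (i - 1) := by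
      have : e i + e (i + 1) = A (i + 1) - A (i - 1) := by simp [e]
      rw [this] at h
      exact sub_eq_zero.1 h
    have := hinj h2
    apply z2
    linear_combination this
  have hclose : ∀ i j, ∀ v, v ∈ cellVerts (A i) → v ∈ cellVerts (A j) →
      j = i - 2 ∨ j = i - 1 ∨ j = i ∨ j = i + 1 ∨ j = i + 2 := by
    intro i j v h1 h2
    by_contra h
    have := hdisj i j (by simpa using h)
    have h3 : v ∈ cellVerts (A i) ∩ cellVerts (A j) := Finset.mem_inter.2 ⟨h1, h2⟩
    rw [this] at h3
    simp at h3
  have hno : ∀ i, nou (e i) (e (i + 1)) (e (i + 2)) := by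
    intro i
    by_contra h
    have hsum : e i + e (i + 1) + e (i + 2) = A (i + 2) - A (i - 1) := by
      have h12 : i + 2 - 1 = i + 1 := by ring
      simp [e, h12]
    have hs1 := congrArg Prod.fst hsum
    have hs2 := congrArg Prod.snd hsum
    simp only [Prod.fst_add, Prod.snd_add, Prod.fst_sub, Prod.snd_sub] at hs1 hs2
    unfold nou at h
    rw [hs1, hs2] at h
    have := hclose (i - 1) (i + 2)
      (max (A (i - 1)).1 (A (i + 2)).1, max (A (i - 1)).2 (A (i + 2)).2)
      (by rw [mem_cellVerts_iff]; simp only; omega)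
      (by rw [mem_cellVerts_iff]; simp only; omega)
    rcases this with h | h | h | h | h
    · exact z5 (by linear_combination h)
    · exact z4 (by linear_combination h)
    · exact z3 (by linear_combination h)
    · exact z2 (by linear_combination h)
    · exact z1 (by linear_combination h)
  let m : ZMod n → ℤ := fun i => mm (e (i - 1)) (e i) (s (i - 1))
  have hm : ∀ i, m i = 1 ∨ m i = 3 := fun i => mm_cases _ _ _
  let t : ZMod n → Cell := fun i => A i + tpos (e i) (s i)
  let u : ZMod n → Cell := fun i => A i + upos (m i) (e i) (s i)
  let c : ZMod n → Cell := fun i => A i + cpos (e i) (s i)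
  let d : ZMod n → Cell := fun i => A i + dpos (m i) (e i) (s i)
  have hm1 : ∀ i, m (i + 1) = mm (e i) (e (i + 1)) (s i) := by
    intro i; simp only [m, add_sub_cancel_right]
  have a2 : ∀ i : ZMod n, i + 1 + 1 = i + 2 := fun i => by ring
  have a3 : ∀ i : ZMod n, i + 2 + 1 = i + 3 := fun i => by ring
  have a3' : ∀ i : ZMod n, i + 1 + 2 = i + 3 := fun i => by ring
  have win : ∀ i, t i ≠ t (i + 1) ∧ t i ≠ t (i + 2) ∧ u (i + 1) ≠ u (i + 2) ∧
      u (i + 1) ≠ u (i + 3) ∧ u (i + 1) ≠ t (i + 1) ∧ u (i + 1) ≠ t (i + 2) ∧ u (i + 1) ≠ t i ∧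
      u (i + 2) ≠ t i ∧ u (i + 3) ≠ t i ∧ (m (i + 2) = 3 → m (i + 1) = 1) := by
    intro i
    have o2 := hok (i + 1)
    have o3 := hok (i + 2)
    have n2 := hno (i + 1)
    have q2 := hsn1 (i + 1)
    have q3 := hsn1 (i + 2)
    have p2 := hm1 (i + 1)
    have p3 := hm1 (i + 2)
    have r2 := hstep (i + 1)
    have r3 := hstep (i + 2)
    rw [a2] at o2 q2 p2 r2
    rw [a2, a3'] at n2
    rw [a3] at o3 q3 p3 r3
    have w := window' (he i) (he (i + 1)) (he (i + 2)) (he (i + 3)) (hs i) (hok i) o2 o3 (hno i) n2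
      (hsn1 i) q2 q3 (hstep i) r2 r3 (t0 := t i) (t1 := t (i + 1)) (t2 := t (i + 2))
      (u1 := u (i + 1)) (u2 := u (i + 2)) (u3 := u (i + 3)) rfl rfl rfl
      (by rw [← hm1]) (by rw [← p2]) (by rw [← p3])
    rw [← hm1, ← p2] at w
    exact w
  have hloc := fun i => local_vert (A i) (e i) (s i) (m i) (he i) (hs i) (hm i)
  have ht : ∀ i, t i ∈ cellVerts (A i) := fun i => (hloc i).1
  have hu : ∀ i, u i ∈ cellVerts (A (i - 1)) := fun i => by rw [← hprev]; exact (hloc i).2.2.1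
  have hin : ∀ i v, v ∈ cellVerts (A i) → v ∈ polyVerts P := fun i v h =>
    Finset.mem_biUnion.2 ⟨A i, hAP i, h⟩
  have htinj : ∀ i j, t i = t j → i = j := by
    intro i j h
    rcases hclose i j (t i) (ht i) (h ▸ ht j) with h' | h' | h' | h' | h'
    · exfalso
      have := (win j).2.1
      rw [show j + 2 = i by rw [h']; ring] at this
      exact this h.symm
    · exfalso
      have := (win j).1
      rw [show j + 1 = i by rw [h']; ring] at this
      exact this h.symm
    · exact h'.symm
    · exfalso
      rw [h'] at h
      exact (win i).1 h
    · exfalso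
      rw [h'] at h
      exact (win i).2.1 h
  have huinj : ∀ i j, u i = u j → i = j := by
    intro i j h
    have w1 : ∀ i, u i ≠ u (i + 1) := by
      intro i
      have := (win (i - 1)).2.2.1
      rwa [show i - 1 + 1 = i by ring, show i - 1 + 2 = i + 1 by ring] at this
    have w2 : ∀ i, u i ≠ u (i + 2) := by
      intro i
      have := (win (i - 1)).2.2.2.1
      rwa [show i - 1 + 1 = i by ring, show i - 1 + 3 = i + 2 by ring] at this
    rcases hclose (i - 1) (j - 1) (u i) (hu i) (h ▸ hu j) with h' | h' | h' | h' | h'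
    · exfalso
      have := w2 j
      rw [show j + 2 = i by linear_combination h'] at this
      exact this h.symm
    · exfalso
      have := w1 j
      rw [show j + 1 = i by linear_combination h'] at this
      exact this h.symm
    · linear_combination -h'
    · exfalso
      rw [show j = i + 1 by linear_combination h'] at h
      exact w1 i h
    · exfalso
      rw [show j = i + 2 by linear_combination h'] at h
      exact w2 i h
  have hut : ∀ i j, u i ≠ t j := by
    intro i j h
    rcases hclose (i - 1) j (u i) (hu i) (h ▸ ht j) with h' | h' | h' | h' | h'
    · rw [show i = j + 3 by linear_combination -h'] at h
      exact (win j).2.2.2.2.2.2.2.2.1 h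
    · rw [show i = j + 2 by linear_combination -h'] at h
      exact (win j).2.2.2.2.2.2.2.1 h
    · rw [show i = j + 1 by linear_combination -h'] at h
      exact (win j).2.2.2.2.2.2.1 h
    · have := (win (i - 1)).2.2.2.2.1
      rw [show i - 1 + 1 = i by ring] at this
      rw [show j = i by linear_combination h'] at h
      exact this h
    · have := (win (i - 1)).2.2.2.2.2.1
      rw [show i - 1 + 1 = i by ring] at this
      rw [show j = i - 1 + 2 by linear_combination h'] at h
      exact this h
  -- weights
  let κ : ZMod n → ℤ := fun i =>
    (if m i = 3 then 2 else 1) * (s i * ((e i).1 ^ 2 - (e i).2 ^ 2))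
  let W : Cell → ℤ := fun v => ∑ i, κ i * (if (A i).1 < v.1 ∧ (A i).2 < v.2 then 1 else 0)
  have hcurv : ∀ j, curv W (A j) = κ j := weight_curv A hinj κ
  have hWlt : ∀ i, W (c i) + W (d i) < W (u i) + W (t i) := by
    intro i
    refine local_add W (A i) (e i) (s i) (m i) (he i) (hs i) (hm i) ?_ ?_
    · intro h
      rw [hcurv]
      simp [κ, h]
    · intro h
      rw [hprev, hcurv, hcurv]
      have h1 : m (i - 1) = 1 := by
        have := (win (i - 2)).2.2.2.2.2.2.2.2.2
        rw [show i - 2 + 2 = i by ring, show i - 2 + 1 = i - 1 by ring] at this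
        exact this h
      obtain ⟨h2, h3⟩ := mm_three (he (i - 1)) (he i) h
      rw [← hsn'] at h2
      simp only [κ, h, h1, ← h2, h3]
      constructor
      · simp
      · norm_num
        ring
  -- the algebra
  let R := MvPolynomial {v // v ∈ polyVerts P} K ⧸ polyIdeal K P
  let x : {v // v ∈ polyVerts P} → R := fun v => Ideal.Quotient.mk _ (MvPolynomial.X v)
  let G : Cell → R := fun v => if h : v ∈ polyVerts P then x ⟨v, h⟩ else 0
  have hGx : ∀ v (h : v ∈ polyVerts P), G v = x ⟨v, h⟩ := fun v h => by simp [G, h]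
  have hG : ∀ a b, IsInnerInterval P a b → G a * G b = G (a.1, b.2) * G (b.1, a.2) := by
    intro a b hab
    obtain ⟨h1, h2, h3⟩ := id hab
    have ha : a ∈ polyVerts P := vert_mem (h3 a (by omega) (by omega) (by omega) (by omega))
      (by omega) (by omega)
    have hb : b ∈ polyVerts P := vert_mem (c := (b.1 - 1, b.2 - 1))
      (h3 _ (by simp only; omega) (by simp only; omega) (by simp only; omega) (by simp only; omega))
      (by simp) (by simp)
    have hc : (a.1, b.2) ∈ polyVerts P := vert_mem (c := (a.1, b.2 - 1))
      (h3 _ (by simp only; omega) (by simp only; omega) (by simp only; omega) (by simp only; omega))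
      (by simp) (by simp)
    have hd : (b.1, a.2) ∈ polyVerts P := vert_mem (c := (b.1 - 1, a.2))
      (h3 _ (by simp only; omega) (by simp only; omega) (by simp only; omega) (by simp only; omega))
      (by simp) (by simp)
    rw [hGx a ha, hGx b hb, hGx _ hc, hGx _ hd]
    have hmem : MvPolynomial.X ⟨a, ha⟩ * MvPolynomial.X ⟨b, hb⟩ -
        MvPolynomial.X ⟨_, hc⟩ * MvPolynomial.X ⟨_, hd⟩ ∈ polyIdeal K P :=
      Ideal.subset_span ⟨⟨a, ha⟩, ⟨b, hb⟩, ⟨_, hc⟩, ⟨_, hd⟩, hab, rfl, rfl, rfl⟩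
    have := Ideal.Quotient.eq.2 hmem
    simpa only [map_mul] using this
  have hx : Algebra.adjoin K (Set.range x) = ⊤ := by
    have h1 := MvPolynomial.adjoin_range_X (σ := {v // v ∈ polyVerts P}) (R := K)
    have h2 := congrArg (Subalgebra.map (Ideal.Quotient.mkₐ K (polyIdeal K P))) h1
    rw [AlgHom.map_adjoin, ← Set.range_comp, Algebra.map_top,
      (AlgHom.range_eq_top _).2 (Ideal.Quotient.mkₐ_surjective K _)] at h2
    exact h2
  have fin := upper (K := K) x hx
    (fun i => ⟨u i, hin _ _ (hu i)⟩) (fun i => ⟨t i, hin _ _ (ht i)⟩)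
    (fun i => ⟨c i, hin i _ (hloc i).2.1⟩)
    (fun i => ⟨d i, hin (i - 1) _ (by rw [← hprev]; exact (hloc i).2.2.2)⟩)
    ?_ ?_ (fun v => W v) hWlt
  · rw [ZMod.card, Fintype.card_coe] at fin
    rw [hcard]
    exact fin
  · rintro (i | i) (j | j) h
    · simp only [Sum.elim_inl, Subtype.mk.injEq] at h
      rw [huinj i j h]
    · simp only [Sum.elim_inl, Sum.elim_inr, Subtype.mk.injEq] at h
      exact absurd h (hut i j)
    · simp only [Sum.elim_inl, Sum.elim_inr, Subtype.mk.injEq] at h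
      exact absurd h.symm (hut j i)
    · simp only [Sum.elim_inr, Subtype.mk.injEq] at h
      rw [htinj i j h]
  · intro i
    have := local_mul G P hG (A i) (e i) (s i) (m i) (he i) (hs i) (hm i) (hAP i)
      (fun _ => by rw [hprev]; exact hAP _)
    rw [hGx _ (hin _ _ (hu i)), hGx _ (hin _ _ (ht i)), hGx _ (hin i _ (hloc i).2.1),
      hGx _ (hin (i - 1) _ (by rw [← hprev]; exact (hloc i).2.2.2))] at this
    exact this

/-- If `P` is a closed path polyomino and `K` a field, then the Krull
dimension of `K[P] = S_P / I_P` equals `|V(P)| - rank(P)`. -/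
theorem closedPath_krullDim (K : Type*) [Field K] (P : Finset Cell) (hP : IsClosedPath P) :
    ringKrullDim (MvPolynomial {v // v ∈ polyVerts P} K ⧸ polyIdeal K P) =
      (((polyVerts P).card - P.card : ℕ) : WithBot (WithTop ℕ)) := by
  exact le_antisymm (upper_main K P hP) (lower_main K P)
end

section
/- Let P be a closed path polyomino and K a field. Then the Krull dimension of the coordinate ring K[P] = S_P/I_P equals rank(P), the number of cells of P. -/
open scoped MonomialOrder

universe u₁ u₂ u₃

theorem cp_upper {K R V ι : Type*} [Field K] [CommRing R] [Algebra K R] [Fintype V]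
    [Fintype ι] (x : V → R)
    (hx : Function.Surjective (MvPolynomial.aeval x : MvPolynomial V K →ₐ[K] R))
    (wt : V → ℕ) (hwt : ∀ v, 0 < wt v) (q m o o' : ι → V)
    (hcov : ∀ v, ∃ i, q i = v ∨ m i = v)
    (hrel : ∀ i, x (q i) * x (m i) = x (o i) * x (o' i))
    (hlt : ∀ i, wt (o i) + wt (o' i) < wt (q i) + wt (m i)) :
    ringKrullDim R ≤ ((Fintype.card ι : ℕ) : WithBot ℕ∞) := by
  classical
  let θ : ι → R := fun i => x (q i) ^ wt (m i) + x (m i) ^ wt (q i)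
  let alg : Algebra (MvPolynomial ι K) R := (MvPolynomial.aeval θ).toAlgebra
  have algX : ∀ i, algebraMap (MvPolynomial ι K) R (MvPolynomial.X i) = θ i := by
    intro i
    exact MvPolynomial.aeval_X θ i
  have algC : ∀ c, algebraMap (MvPolynomial ι K) R (MvPolynomial.C c) = algebraMap K R c := by
    intro c
    exact MvPolynomial.aeval_C θ c
  let N := ∑ v, wt v
  have hN : ∀ v, wt v ≤ N := fun v => Finset.single_le_sum (f := wt) (fun _ _ => Nat.zero_le _)
    (Finset.mem_univ v)
  let mon : (V → ℕ) → R := fun α => ∏ v, x v ^ α v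
  let W : (V → ℕ) → ℕ := fun α => ∑ v, wt v * α v
  have mon_add : ∀ α β, mon (α + β) = mon α * mon β := by
    intro α β
    simp [mon, pow_add, Finset.prod_mul_distrib]
  have W_add : ∀ α β, W (α + β) = W α + W β := by
    intro α β
    simp [W, mul_add, Finset.sum_add_distrib]
  have mon_single : ∀ a k, mon (Pi.single a k) = x a ^ k := by
    intro a k
    simp only [mon]
    rw [Finset.prod_eq_single a] <;> simp +contextual
  have W_single : ∀ a k, W (Pi.single a k) = wt a * k := by
    intro a k
    simp only [W]
    rw [Finset.sum_eq_single a] <;> simp +contextual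
  let M : Submodule (MvPolynomial ι K) R := Submodule.span _
    (Set.range (fun α : V → Fin (N + 1) => mon (fun v => (α v : ℕ))))
  have key : ∀ k, ∀ α, W α = k → mon α ∈ M := by
    intro k
    induction k using Nat.strong_induction_on with
    | _ k ih =>
    intro α hα
    by_cases hb : ∀ v, α v ≤ N
    · apply Submodule.subset_span
      exact ⟨fun v => ⟨α v, Nat.lt_succ_of_le (hb v)⟩, rfl⟩
    push Not at hb
    obtain ⟨a, ha⟩ := hb
    obtain ⟨i, hi⟩ := hcov a
    have gen : ∃ b, x a ^ wt b + x b ^ wt a = θ i ∧ x a * x b = x (o i) * x (o' i) ∧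
        wt (o i) + wt (o' i) < wt a + wt b := by
      rcases hi with rfl | rfl
      · exact ⟨m i, rfl, hrel i, hlt i⟩
      · exact ⟨q i, add_comm _ _, by rw [mul_comm]; exact hrel i, by rw [add_comm (wt (m i))]; exact hlt i⟩
    obtain ⟨b, hθ, hr, hl⟩ := gen
    obtain ⟨β, rfl⟩ : ∃ β : V → ℕ, α = (Pi.single a (wt b + 1) : V → ℕ) + β := by
      refine ⟨α - Pi.single a (wt b + 1), ?_⟩
      funext v
      have := hN b
      show α v = (Pi.single a (wt b + 1) : V → ℕ) v + (α v - (Pi.single a (wt b + 1) : V → ℕ) v)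
      by_cases hv : v = a
      · subst hv
        rw [Pi.single_eq_same]
        omega
      · rw [Pi.single_eq_of_ne hv]
        omega
    have hb0 := hwt b
    have ha0 := hwt a
    rw [W_add, W_single] at hα
    have e : mon (Pi.single a (wt b + 1) + β) =
        (MvPolynomial.X i : MvPolynomial ι K) • mon (Pi.single a 1 + β) -
        mon (Pi.single b (wt a - 1) + Pi.single (o i) 1 + Pi.single (o' i) 1 + β) := by
      rw [Algebra.smul_def, algX, ← hθ]
      simp only [mon_add, mon_single, pow_one]
      obtain ⟨c, hc⟩ : ∃ c, wt a = c + 1 := ⟨wt a - 1, by omega⟩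
      rw [hc, Nat.add_sub_cancel]
      linear_combination (-x b ^ c * mon β) * hr
    rw [e]
    refine M.sub_mem (M.smul_mem _ (ih _ ?_ _ rfl)) (ih _ ?_ _ rfl)
    · simp only [W_add, W_single]
      nlinarith
    · simp only [W_add, W_single]
      obtain ⟨c, hc⟩ : ∃ c, wt a = c + 1 := ⟨wt a - 1, by omega⟩
      rw [hc] at hα hl
      rw [hc, Nat.add_sub_cancel]
      nlinarith
  have hM : M = ⊤ := by
    rw [eq_top_iff]
    rintro r -
    obtain ⟨p, rfl⟩ := hx r
    induction p using MvPolynomial.induction_on' with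
    | monomial u c =>
      rw [MvPolynomial.aeval_monomial, ← algC, ← Algebra.smul_def]
      refine M.smul_mem _ ?_
      rw [Finsupp.prod_fintype _ _ (by simp)]
      exact key _ (fun v => u v) rfl
    | add p q hp hq => rw [map_add]; exact M.add_mem hp hq
  have fin : Module.Finite (MvPolynomial ι K) R :=
    ⟨by rw [← hM]; exact Submodule.fg_span (Set.finite_range _)⟩
  have : ringKrullDim R ≤ ringKrullDim (MvPolynomial ι K) := by
    refine Order.krullDim_le_of_strictMono (PrimeSpectrum.comap (algebraMap (MvPolynomial ι K) R)) ?_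
    intro I J hIJ
    exact Ideal.IsIntegral.comap_lt_comap (R := MvPolynomial ι K) (A := R) (I := I.asIdeal) (J := J.asIdeal) hIJ
  refine this.trans ?_
  rw [MvPolynomial.ringKrullDim_of_isNoetherianRing, ringKrullDim_eq_zero_of_field, zero_add,
    Nat.card_eq_fintype_card]

theorem cp_height_max {K : Type*} [Field K] {V : Type*} [Finite V] :
    ∀ (M : Ideal (MvPolynomial V K)) [M.IsMaximal], M.height = (Nat.card V : ℕ∞) := by
  induction V using Finite.induction_empty_option with
  | of_equiv e H =>
    intro M hM
    let f := (MvPolynomial.renameEquiv K e).toRingEquiv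
    have : (M.comap f).IsMaximal := Ideal.comap_isMaximal_of_equiv f
    have h2 := H (M.comap f)
    rw [← Nat.card_congr e, ← h2]
    exact (RingEquiv.height_comap f M).symm
  | h_empty =>
    intro M hM
    have h := Ideal.height_le_ringKrullDim_of_ne_top hM.ne_top
    simp at h
    simpa using h
  | h_option IH =>
    rename_i α _
    intro M hM
    let f := (MvPolynomial.optionEquivLeft K α).toRingEquiv
    have : (M.map f).IsMaximal := Ideal.map_isMaximal_of_equiv f
    rw [← RingEquiv.height_map f M]
    have hmax : ((M.map f).under (MvPolynomial α K)).IsMaximal :=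
      Polynomial.isMaximal_comap_C_of_isJacobsonRing (M.map f)
    have hover : (M.map f).LiesOver ((M.map f).under (MvPolynomial α K)) := ⟨rfl⟩
    have h1 := Polynomial.height_eq_height_add_one ((M.map f).under (MvPolynomial α K)) (M.map f)
    rw [h1, IH]
    simp

theorem cp_lower {K V ι : Type*} [Field K] [Fintype V] [Fintype ι]
    (g : ι → MvPolynomial V K) (I m : Ideal (MvPolynomial V K)) [m.IsMaximal]
    (hIm : ∀ i, g i ∈ m)
    (hloc : ∀ p : Ideal (MvPolynomial V K), p.IsPrime → p ≤ m → (∀ i, g i ∈ p) → I ≤ p) 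
    (n : ℕ) (hn : n + Fintype.card ι ≤ Fintype.card V) :
    (n : WithBot ℕ∞) ≤ ringKrullDim (MvPolynomial V K ⧸ I) := by
  classical
  let J := Ideal.span (Set.range g)
  have hJm : J ≤ m := by rw [Ideal.span_le]; rintro _ ⟨i, rfl⟩; exact hIm i
  have h1 := Ideal.height_le_height_add_encard_of_subset (Set.range g) (p := m)
    (by rintro _ ⟨i, rfl⟩; exact hIm i)
  have h2 : (Set.range g).encard ≤ Fintype.card ι := by
    rw [← Set.image_univ]
    refine (Set.encard_image_le _ _).trans ?_
    simp
  have hp : (m.map (Ideal.Quotient.mk J)).IsPrime := Ideal.isPrime_map_quotientMk_of_isPrime hJm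
  have h3 : ((m.map (Ideal.Quotient.mk J)).height : WithBot ℕ∞) ≤ ringKrullDim (MvPolynomial V K ⧸ I) := by
    let m' : PrimeSpectrum (MvPolynomial V K ⧸ J) := ⟨_, hp⟩
    have : (m.map (Ideal.Quotient.mk J)).height = Order.height m' := by
      exact PrimeSpectrum.height_eq_orderHeight m'
    rw [this, Order.height_eq_krullDim_Iic, ringKrullDim_quotient]
    have mem : ∀ x : Set.Iic m', PrimeSpectrum.comap (Ideal.Quotient.mk J) x.1 ∈
        PrimeSpectrum.zeroLocus (I : Set (MvPolynomial V K)) := by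
      rintro ⟨x, hx⟩
      refine hloc _ (PrimeSpectrum.isPrime _) ?_ ?_
      · have : x.asIdeal ≤ m.map (Ideal.Quotient.mk J) := hx
        refine (Ideal.comap_mono this).trans ?_
        rw [Ideal.comap_map_of_surjective _ Ideal.Quotient.mk_surjective]
        simpa [← RingHom.ker_eq_comap_bot] using hJm
      · intro i
        show Ideal.Quotient.mk J (g i) ∈ x.asIdeal
        rw [Ideal.Quotient.eq_zero_iff_mem.mpr (Ideal.subset_span (Set.mem_range_self i))]
        exact zero_mem _
    refine Order.krullDim_le_of_strictMono (fun x => (⟨PrimeSpectrum.comap (Ideal.Quotient.mk J) x.1, mem x⟩ :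
      PrimeSpectrum.zeroLocus (I : Set (MvPolynomial V K)))) ?_
    intro x y hxy
    have hxy : x.1.asIdeal < y.1.asIdeal := hxy
    refine lt_of_le_not_ge (Ideal.comap_mono hxy.le) ?_
    intro h
    refine hxy.not_ge ?_
    intro z hz
    obtain ⟨w, rfl⟩ := Ideal.Quotient.mk_surjective z
    exact h hz
  refine le_trans ?_ h3
  rw [cp_height_max] at h1
  have h4 : ((n + Fintype.card ι : ℕ) : ℕ∞) ≤ (m.map (Ideal.Quotient.mk J)).height + Fintype.card ι :=
    (le_trans (by rw [Nat.card_eq_fintype_card]; exact_mod_cast hn) h1).trans (by gcongr)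
  push_cast at h4
  have := (ENat.add_le_add_iff_right (ENat.natCast_ne_top _)).mp h4
  exact_mod_cast this

/-- Offset of the far corner of a cell entered in direction `d`, on side `s`. -/
def cpFar (d : ℤ × ℤ) (s : ℤ) : ℤ × ℤ := ((1 + d.1 - s * d.2) / 2, (1 + d.2 + s * d.1) / 2)

def cpCross (d e : ℤ × ℤ) : ℤ := d.1 * e.2 - d.2 * e.1

def cpNext (d e : ℤ × ℤ) (s : ℤ) : ℤ := if cpCross d e = 0 then s else - cpCross d e

def cpDirs : List (ℤ × ℤ) := [(1, 0), (-1, 0), (0, 1), (0, -1)]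

def cpSides : List ℤ := [1, -1]

def cpOpp (q m o : ℤ × ℤ) : ℤ × ℤ := (q.1 + m.1 - o.1, q.2 + m.2 - o.2)

def cpLo (q m : ℤ × ℤ) : ℤ × ℤ := (min q.1 m.1, min q.2 m.2)
def cpHi (q m : ℤ × ℤ) : ℤ × ℤ := (max q.1 m.1, max q.2 m.2)

def cpSq (q m o o' : ℤ × ℤ) : Prop :=
  (o = (q.1, m.2) ∧ o' = (m.1, q.2)) ∨ (o = (m.1, q.2) ∧ o' = (q.1, m.2))

instance (q m o o' : ℤ × ℤ) : Decidable (cpSq q m o o') := by unfold cpSq; infer_instance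

def cpLoc (d0 d1 d2 : ℤ × ℤ) (s0 s1 : ℤ) (q m o o' : ℤ × ℤ) : Prop :=
  cpSq q m o o' ∧ (cpLo q m).1 < (cpHi q m).1 ∧ (cpLo q m).2 < (cpHi q m).2 ∧
  ((cpLo q m = (0, 0) ∧ cpHi q m = (1, 1)) ∨
    (cpLo q m = cpLo (0, 0) (-d2) ∧ cpHi q m = cpHi (0, 0) (-d2) + (1, 1))) ∧
  (o = -d2 - d1 + cpFar d0 s0 ∨
    (o = -d2 + cpFar d1 (-s1) ∧ d1 = d2 ∧ d2.1 * o.1 + d2.2 * o.2 < d2.1 * m.1 + d2.2 * m.2) ∨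
    (o = -d2 - d1 + cpFar d0 (-s0) ∧ d0 = d2 ∧
      d2.1 * o.1 + d2.2 * o.2 < d2.1 * m.1 + d2.2 * m.2))

instance (d0 d1 d2 : ℤ × ℤ) (s0 s1 : ℤ) (q m o o' : ℤ × ℤ) :
    Decidable (cpLoc d0 d1 d2 s0 s1 q m o o') := by unfold cpLoc; infer_instance

def cpLoc' (d0 d1 d2 : ℤ × ℤ) (s0 s1 s2 : ℤ) : Prop :=
  cpLoc d0 d1 d2 s0 s1 (-d2 + cpFar d1 s1) (cpFar d2 (-s2))
    (cpOpp (-d2 + cpFar d1 s1) (cpFar d2 (-s2)) (cpFar d2 s2)) (cpFar d2 s2)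

instance (d0 d1 d2 : ℤ × ℤ) (s0 s1 s2 : ℤ) :
    Decidable (cpLoc' d0 d1 d2 s0 s1 s2) := by unfold cpLoc'; infer_instance

set_option maxRecDepth 100000 in
theorem cp_local : ∀ d0 ∈ cpDirs, ∀ d1 ∈ cpDirs, ∀ d2 ∈ cpDirs, ∀ s0 ∈ cpSides,
    d1 ≠ -d0 → d2 ≠ -d1 → ¬ (cpCross d0 d1 ≠ 0 ∧ d2 = -d0) →
    cpLoc' d0 d1 d2 s0 (cpNext d0 d1 s0) (cpNext d1 d2 (cpNext d0 d1 s0)) := by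
  decide

theorem cp_side {n : ℕ} [NeZero n] (ε : ZMod n → ℤ) (hε : ∀ i, ε i = 0 ∨ ε i = 1 ∨ ε i = -1) :
    ∃ σ : ZMod n → ℤ, (∀ i, σ i = 1 ∨ σ i = -1) ∧
      ∀ i, σ (i + 1) = if ε i = 0 then σ i else - ε i := by
  classical
  by_cases h0 : ∀ i, ε i = 0
  · exact ⟨fun _ => 1, by simp, by simp [h0]⟩
  push Not at h0
  obtain ⟨j, hj⟩ := h0
  have ex : ∀ i : ZMod n, ∃ k : ℕ, ε (i - 1 - k) ≠ 0 := by
    intro i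
    refine ⟨(i - 1 - j).val, ?_⟩
    rw [ZMod.natCast_zmod_val]
    simpa using hj
  refine ⟨fun i => - ε (i - 1 - (Nat.find (ex i) : ℕ)), ?_, ?_⟩
  · intro i
    have h1 := Nat.find_spec (ex i)
    rcases hε (i - 1 - (Nat.find (ex i) : ℕ)) with h | h | h
    · exact absurd h h1
    · right; simp [h]
    · left; simp [h]
  · intro i
    by_cases hi : ε i = 0
    · rw [if_pos hi]
      have : Nat.find (ex (i + 1)) = Nat.find (ex i) + 1 := by
        rw [Nat.find_eq_iff]
        constructor
        · have h1 := Nat.find_spec (ex i)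
          convert h1 using 2
          push_cast
          ring
        · intro k hk
          rcases k with _ | k
          · simpa using hi
          · have := Nat.find_min (ex i) (show k < _ by omega)
            convert this using 3
            push_cast
            ring
      simp only [this]
      congr 2
      push_cast
      ring
    · rw [if_neg hi]
      have : Nat.find (ex (i + 1)) = 0 := by
        rw [Nat.find_eq_zero]
        simpa using hi
      simp only [this]
      simp

theorem cp_mem_verts (x a : Cell) : x ∈ cellVerts a ↔
    (x.1 = a.1 ∨ x.1 = a.1 + 1) ∧ (x.2 = a.2 ∨ x.2 = a.2 + 1) := by
  obtain ⟨x1, x2⟩ := x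
  obtain ⟨a1, a2⟩ := a
  simp only [cellVerts, Finset.mem_insert, Finset.mem_singleton, Prod.mk.injEq]
  omega

theorem cp_sub_mem (a b : Cell) (h : EdgeAdj a b) : b - a ∈ cpDirs := by
  obtain ⟨x1, x2⟩ := b
  obtain ⟨a1, a2⟩ := a
  simp only [EdgeAdj] at h
  simp only [cpDirs, List.mem_cons, Prod.mk_sub_mk, Prod.mk.injEq, List.not_mem_nil, or_false]
  omega

theorem cp_far_mem (a d : Cell) (hd : d ∈ cpDirs) (s : ℤ) (hs : s = 1 ∨ s = -1) :
    a + cpFar d s ∈ cellVerts a ∧ a + cpFar d s ∉ cellVerts (a - d) := by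
  obtain ⟨a1, a2⟩ := a
  rw [cp_mem_verts, cp_mem_verts]
  simp only [cpDirs, List.mem_cons, List.not_mem_nil, or_false] at hd
  rcases hd with rfl | rfl | rfl | rfl <;> rcases hs with rfl | rfl <;>
    norm_num [cpFar] <;> omega

theorem cp_far_cover (x a d : Cell) (hd : d ∈ cpDirs) (hx : x ∈ cellVerts a) :
    x ∈ cellVerts (a - d) ∨ x = a + cpFar d 1 ∨ x = a + cpFar d (-1) := by
  obtain ⟨a1, a2⟩ := a
  obtain ⟨x1, x2⟩ := x
  rw [cp_mem_verts] at hx ⊢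
  simp only [cpDirs, List.mem_cons, List.not_mem_nil, or_false] at hd
  rcases hd with rfl | rfl | rfl | rfl <;> 
    norm_num [cpFar] at hx ⊢ <;> omega

theorem cp_far_ne (a d : Cell) (hd : d ∈ cpDirs) : a + cpFar d 1 ≠ a + cpFar d (-1) := by
  simp only [cpDirs, List.mem_cons, List.not_mem_nil, or_false] at hd
  rcases hd with rfl | rfl | rfl | rfl <;> simp [cpFar]

theorem cp_inter (x a d e : Cell) (hd : d ∈ cpDirs) (he : e ∈ cpDirs) (hne : e ≠ -d)
    (hx : x ∈ cellVerts a) (hx' : x ∈ cellVerts (a + d + e)) : x ∈ cellVerts (a + d) := by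
  obtain ⟨a1, a2⟩ := a
  obtain ⟨x1, x2⟩ := x
  rw [cp_mem_verts] at hx hx' ⊢
  simp only [cpDirs, List.mem_cons, List.not_mem_nil, or_false] at hd he
  rcases hd with rfl | rfl | rfl | rfl <;> rcases he with rfl | rfl | rfl | rfl <;>
    simp at hx hx' hne ⊢ <;> omega

theorem cp_meet (a d : Cell) (hd : d ∈ cpDirs) : (cellVerts a ∩ cellVerts (a + d)).Nonempty := by
  obtain ⟨a1, a2⟩ := a
  simp only [cpDirs, List.mem_cons, List.not_mem_nil, or_false] at hd
  simp only [Finset.Nonempty, Finset.mem_inter, cp_mem_verts]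
  rcases hd with rfl | rfl | rfl | rfl
  · exact ⟨(a1 + 1, a2), by simp⟩
  · exact ⟨(a1, a2), by simp⟩
  · exact ⟨(a1, a2 + 1), by simp⟩
  · exact ⟨(a1, a2), by simp⟩

/-- In a field, cell relations imply interval relations. -/
theorem cp_interval {L : Type*} [Field L] (f : ℤ → ℤ → L) (hf : ∀ x y, f x y ≠ 0)
    (a1 a2 b1 b2 : ℤ) (h1 : a1 ≤ b1) (h2 : a2 ≤ b2)
    (hc : ∀ x y, a1 ≤ x → x + 1 ≤ b1 → a2 ≤ y → y + 1 ≤ b2 →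
      f x y * f (x + 1) (y + 1) = f x (y + 1) * f (x + 1) y) :
    f a1 a2 * f b1 b2 = f a1 b2 * f b1 a2 := by
  have row : ∀ x, a1 ≤ x → x + 1 ≤ b1 → ∀ y, a2 ≤ y → (y ≤ b2 →
      f x a2 * f (x + 1) y = f x y * f (x + 1) a2) := by
    intro x hx hx' y hy
    induction y, hy using Int.leInduction with
    | base => intro _; ring
    | succ y hy ih =>
      intro hy'
      have e1 := ih (by omega)
      have e2 := hc x y hx hx' hy hy'
      apply mul_left_cancel₀ (mul_ne_zero (hf x y) (hf (x + 1) y))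
      linear_combination (f x (y + 1) * f (x + 1) y) * e1 + (f x a2 * f (x + 1) y) * e2
  have col : ∀ x, a1 ≤ x → (x ≤ b1 → f a1 a2 * f x b2 = f a1 b2 * f x a2) := by
    intro x hx
    induction x, hx using Int.leInduction with
    | base => intro _; ring
    | succ x hx ih =>
      intro hx'
      have e1 := ih (by omega)
      have e2 := row x hx hx' b2 h2 le_rfl
      apply mul_left_cancel₀ (mul_ne_zero (hf x b2) (hf x a2))
      linear_combination (f x b2 * f (x + 1) a2) * e1 + (f a1 a2 * f x b2) * e2
  exact col b1 h1 le_rfl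

theorem cp_natCast_ne {n : ℕ} (k : ℕ) (hk : 0 < k) (hkn : k < n) : (k : ZMod n) ≠ 0 := by
  intro h
  rw [ZMod.natCast_eq_zero_iff] at h
  exact absurd (Nat.le_of_dvd hk h) (by omega)

/-- All the combinatorial data extracted from a closed path. -/
theorem cp_data (n : ℕ) (hn : 5 < n) (A : ZMod n → Cell) (P : Finset Cell)
    (h : IsClosedPathSeq n A P) :
    ∃ (q m o : ZMod n → Cell) (wt : Cell → ℕ),
      (∀ v, 0 < wt v) ∧
      (∀ v ∈ polyVerts P, ∃ i, q i = v ∨ m i = v) ∧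
      (∀ i, q i ∈ polyVerts P) ∧ (∀ i, m i ∈ polyVerts P) ∧ (∀ i, o i ∈ polyVerts P) ∧
      (∀ i, cpSq (q i) (m i) (o i) (q (i + 1)) ∧
        IsInnerInterval P (cpLo (q i) (m i)) (cpHi (q i) (m i))) ∧
      (∀ i, wt (o i) + wt (q (i + 1)) < wt (q i) + wt (m i)) ∧
      Function.Injective q ∧ Function.Injective m ∧ ∀ i j, q i ≠ m j := by
  classical
  obtain ⟨hadj, hinj, hdis, hP⟩ := h
  haveI : NeZero n := ⟨by omega⟩
  have c1 := cp_natCast_ne (n := n) 1 (by omega) (by omega)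
  have c2 := cp_natCast_ne (n := n) 2 (by omega) (by omega)
  have c3 := cp_natCast_ne (n := n) 3 (by omega) (by omega)
  have c4 := cp_natCast_ne (n := n) 4 (by omega) (by omega)
  have c5 := cp_natCast_ne (n := n) 5 (by omega) (by omega)
  push_cast at c1 c2 c3 c4 c5
  have hAP : ∀ i, A i ∈ P := by
    intro i
    have : A i ∈ (P : Set Cell) := hP ▸ Set.mem_range_self i
    exact this
  have hPA : ∀ c ∈ P, ∃ i, A i = c := by
    intro c hc
    have : c ∈ Set.range A := hP ▸ hc
    exact this
  have hVP : ∀ i x, x ∈ cellVerts (A i) → x ∈ polyVerts P := by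
    intro i x hx
    exact Finset.mem_biUnion.mpr ⟨A i, hAP i, hx⟩
  have hfar3 : ∀ i x, x ∈ cellVerts (A i) → x ∉ cellVerts (A (i - 3)) := by
    intro i x hx hx'
    have := hdis i (i - 3) (by
      simp only [Set.mem_insert_iff, Set.mem_singleton_iff, not_or]
      refine ⟨fun h => c1 ?_, fun h => c2 ?_, fun h => c3 ?_, fun h => c4 ?_, fun h => c5 ?_⟩
      · linear_combination -h
      · linear_combination -h
      · linear_combination -h
      · linear_combination -h
      · linear_combination -h)
    have hh : x ∈ cellVerts (A i) ∩ cellVerts (A (i - 3)) := Finset.mem_inter.mpr ⟨hx, hx'⟩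
    rw [this] at hh
    exact absurd hh (Finset.notMem_empty x)
  let d : ZMod n → Cell := fun i => A i - A (i - 1)
  have hd : ∀ i, d i ∈ cpDirs := by
    intro i
    have := hadj (i - 1)
    rw [sub_add_cancel] at this
    exact cp_sub_mem _ _ this
  have hAd : ∀ i, A i - d i = A (i - 1) := fun i => by simp [d]
  have hback : ∀ i, d (i + 1) ≠ - d i := by
    intro i hi
    have e : A (i + 1) = A (i - 1) := by
      have h1 := hAd (i + 1)
      have h2 := hAd i
      rw [add_sub_cancel_right, hi] at h1
      rw [← h2, ← h1]
      abel
    have := hinj e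
    exact c2 (by linear_combination this)
  have hback' : ∀ i, d i ≠ - d (i - 1) := by
    intro i
    have := hback (i - 1)
    rwa [sub_add_cancel] at this
  have hU : ∀ i, d i ≠ - d (i - 2) := by
    intro i hi
    have e : A i = A (i - 3) + d (i - 1) := by
      have h1 := hAd i
      have h2 := hAd (i - 1)
      have h3 := hAd (i - 2)
      rw [show i - 1 - 1 = i - 2 by ring] at h2
      rw [show i - 2 - 1 = i - 3 by ring] at h3
      rw [hi] at h1
      rw [← h3, ← h2, ← h1]
      abel
    obtain ⟨x, hx⟩ := cp_meet (A (i - 3)) (d (i - 1)) (hd _)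
    rw [Finset.mem_inter, ← e] at hx
    exact hfar3 i x hx.2 hx.1
  let F : ZMod n → ℤ → Cell := fun i s => A i + cpFar (d i) s
  have hF1 : ∀ i s, (s = 1 ∨ s = -1) → F i s ∈ cellVerts (A i) := fun i s hs =>
    (cp_far_mem (A i) (d i) (hd i) s hs).1
  have hF2 : ∀ i s, (s = 1 ∨ s = -1) → F i s ∉ cellVerts (A (i - 1)) := fun i s hs => by
    have := (cp_far_mem (A i) (d i) (hd i) s hs).2
    rwa [hAd] at this
  have hF3 : ∀ i s, (s = 1 ∨ s = -1) → F i s ∉ cellVerts (A (i - 2)) := fun i s hs hh => by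
    have h1 := hAd i
    have h2 := hAd (i - 1)
    rw [show i - 1 - 1 = i - 2 by ring] at h2
    have e1 : A (i - 2) + d (i - 1) = A (i - 1) := by rw [← h2]; abel
    have e2 : A (i - 2) + d (i - 1) + d i = A i := by rw [e1, ← h1]; abel
    have := cp_inter (F i s) (A (i - 2)) (d (i - 1)) (d i) (hd _) (hd _) (hback' i) hh
      (by rw [e2]; exact hF1 i s hs)
    rw [e1] at this
    exact hF2 i s hs this
  have hcov1 : ∀ i x, x ∈ cellVerts (A i) →
      x ∈ cellVerts (A (i - 1)) ∨ ∃ s, (s = 1 ∨ s = -1) ∧ x = F i s := by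
    intro i x hx
    rcases cp_far_cover x (A i) (d i) (hd i) hx with h | h | h
    · left; rwa [hAd] at h
    · exact Or.inr ⟨1, Or.inl rfl, h⟩
    · exact Or.inr ⟨-1, Or.inr rfl, h⟩
  have hcov : ∀ x ∈ polyVerts P, ∃ i s, (s = 1 ∨ s = -1) ∧ x = F i s := by
    intro x hx
    obtain ⟨c, hc, hxc⟩ := Finset.mem_biUnion.mp hx
    obtain ⟨i, rfl⟩ := hPA c hc
    rcases hcov1 i x hxc with h1 | ⟨s, h1⟩
    · rcases hcov1 _ x h1 with h2 | ⟨s, h2⟩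
      · rcases hcov1 _ x h2 with h3 | ⟨s, h3⟩
        · rw [show i - 1 - 1 - 1 = i - 3 by ring] at h3
          exact absurd h3 (hfar3 i x hxc)
        · exact ⟨_, s, h3⟩
      · exact ⟨_, s, h2⟩
    · exact ⟨_, s, h1⟩
  have hFinj : ∀ i j s t, (s = 1 ∨ s = -1) → (t = 1 ∨ t = -1) → F i s = F j t → i = j ∧ s = t := by
    intro i j s t hs ht e
    by_cases hij : j ∈ ({i - 2, i - 1, i, i + 1, i + 2} : Set (ZMod n))
    · simp only [Set.mem_insert_iff, Set.mem_singleton_iff] at hij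
      rcases hij with rfl | rfl | rfl | rfl | rfl
      · exact absurd (e ▸ hF1 _ t ht) (hF3 i s hs)
      · exact absurd (e ▸ hF1 _ t ht) (hF2 i s hs)
      · refine ⟨rfl, ?_⟩
        have := cp_far_ne (A j) (d j) (hd j)
        rcases hs with rfl | rfl <;> rcases ht with rfl | rfl
        · rfl
        · exact absurd e this
        · exact absurd e.symm this
        · rfl
      · have h1 := hF2 (i + 1) t ht
        rw [add_sub_cancel_right, ← e] at h1
        exact absurd (hF1 i s hs) h1
      · have h1 := hF3 (i + 2) t ht
        rw [add_sub_cancel_right, ← e] at h1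
        exact absurd (hF1 i s hs) h1
    · have h1 := hdis i j hij
      have hh : F i s ∈ cellVerts (A i) ∩ cellVerts (A j) :=
        Finset.mem_inter.mpr ⟨hF1 i s hs, e ▸ hF1 j t ht⟩
      rw [h1] at hh
      exact absurd hh (Finset.notMem_empty _)
  obtain ⟨σ, hσ, hσs⟩ := cp_side (fun i => cpCross (d i) (d (i + 1))) (by
    intro i
    have key : ∀ d0 ∈ cpDirs, ∀ d1 ∈ cpDirs,
      cpCross d0 d1 = 0 ∨ cpCross d0 d1 = 1 ∨ cpCross d0 d1 = -1 := by decide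
    exact key _ (hd _) _ (hd _))
  have hσ' : ∀ i, -σ i = 1 ∨ -σ i = -1 := fun i => by rcases hσ i with h | h <;> simp [h]
  have hσn : ∀ i, σ (i + 1) = cpNext (d i) (d (i + 1)) (σ i) := hσs
  have hloc : ∀ i, cpLoc' (d (i - 2)) (d (i - 1)) (d i) (σ (i - 2)) (σ (i - 1)) (σ i) := by
    intro i
    have e1 := hσn (i - 2)
    have e2 := hσn (i - 1)
    rw [show i - 2 + 1 = i - 1 by ring] at e1
    rw [sub_add_cancel] at e2
    have b1 := hback (i - 2)
    rw [show i - 2 + 1 = i - 1 by ring] at b1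
    have := cp_local (d (i - 2)) (hd _) (d (i - 1)) (hd _) (d i) (hd _) (σ (i - 2))
      (by rcases hσ (i - 2) with h | h <;> simp [cpSides, h]) b1 (hback' i)
      (fun hh => hU i hh.2)
    rwa [← e1, ← e2] at this
  let m : ZMod n → Cell := fun i => F i (-σ i)
  let q : ZMod n → Cell := fun i => F (i - 1) (σ (i - 1))
  have hqs : ∀ i, q (i + 1) = F i (σ i) := fun i => by simp [q]
  have hminj : Function.Injective m := fun i j e => (hFinj i j _ _ (hσ' i) (hσ' j) e).1
  have hqinj : Function.Injective q := fun i j e => by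
    have := (hFinj (i - 1) (j - 1) _ _ (hσ _) (hσ _) e).1
    linear_combination this
  have hqm : ∀ i j, q i ≠ m j := by
    intro i j e
    obtain ⟨e1, e2⟩ := hFinj (i - 1) j _ _ (hσ _) (hσ' _) e
    rw [e1] at e2
    rcases hσ j with h | h <;> rw [h] at e2 <;> norm_num at e2
  let hz : ZMod n → ℤ := fun i => (d i).1 * (m i).1 + (d i).2 * (m i).2
  obtain ⟨C, hC⟩ : ∃ C : ℤ, ∀ i, 2 ≤ C + hz i := by
    obtain ⟨B, hB⟩ := (Set.finite_range hz).bddBelow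
    refine ⟨2 - B, fun i => ?_⟩
    have := hB (Set.mem_range_self i)
    linarith
  let wt : Cell → ℕ := fun v => if hv : ∃ i, m i = v then (C + hz hv.choose).toNat else 1
  have wtm : ∀ i, wt (m i) = (C + hz i).toNat := by
    intro i
    have ex : ∃ j, m j = m i := ⟨i, rfl⟩
    have : ex.choose = i := hminj ex.choose_spec
    simp only [wt]
    rw [dif_pos ex, this]
  have wtq : ∀ i, wt (q i) = 1 := by
    intro i
    simp only [wt]
    rw [dif_neg]
    rintro ⟨j, hj⟩
    exact hqm i j hj.symm
  let o : ZMod n → Cell := fun i => cpOpp (q i) (m i) (q (i + 1))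
  -- coordinates relative to `A i`
  have rq : ∀ i, q i = A i + (-d i + cpFar (d (i - 1)) (σ (i - 1))) := by
    intro i
    show A (i - 1) + _ = _
    rw [← hAd i]
    abel
  have rm : ∀ i, m i = A i + cpFar (d i) (-σ i) := fun i => rfl
  have rq' : ∀ i, q (i + 1) = A i + cpFar (d i) (σ i) := fun i => hqs i
  have ro : ∀ i, o i = A i + cpOpp (-d i + cpFar (d (i - 1)) (σ (i - 1))) (cpFar (d i) (-σ i))
      (cpFar (d i) (σ i)) := by
    intro i
    simp only [o]
    rw [rq, rm, rq']
    simp only [cpOpp, Prod.ext_iff, Prod.fst_add, Prod.snd_add]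
    constructor <;> ring
  have hA2 : ∀ i, A (i - 2) = A i + (-d i - d (i - 1)) := by
    intro i
    have h2 := hAd (i - 1)
    rw [show i - 1 - 1 = i - 2 by ring, ← hAd i] at h2
    rw [← h2]; abel
  have hoc : ∀ i, (∃ j, o i = q j) ∨ ∃ j, o i = m j ∧ hz j < hz i := by
    intro i
    obtain ⟨-, -, -, -, h5⟩ := hloc i
    rcases h5 with h5 | ⟨h5, e, hl⟩ | ⟨h5, e, hl⟩
    · left
      refine ⟨i - 1, ?_⟩
      rw [ro, h5, ← add_assoc, ← hA2]
      simp only [q]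
      rw [show i - 1 - 1 = i - 2 by ring]
    · right
      have e2 : o i = m (i - 1) := by
        rw [ro, h5, ← add_assoc, ← sub_eq_add_neg, hAd]
      refine ⟨i - 1, e2, ?_⟩
      simp only [hz]
      rw [← e2, e, ro, rm]
      simp only [Prod.fst_add, Prod.snd_add]
      linarith
    · right
      have e2 : o i = m (i - 2) := by
        rw [ro, h5, ← add_assoc, ← hA2]
      refine ⟨i - 2, e2, ?_⟩
      simp only [hz]
      rw [← e2, e, ro, rm]
      simp only [Prod.fst_add, Prod.snd_add]
      linarith
  have hqV : ∀ i, q i ∈ polyVerts P := fun i => hVP _ _ (hF1 _ _ (hσ _))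
  have hmV : ∀ i, m i ∈ polyVerts P := fun i => hVP _ _ (hF1 _ _ (hσ' _))
  refine ⟨q, m, o, wt, ?_, ?_, hqV, hmV, ?_, ?_, ?_, hqinj, hminj, hqm⟩
  · intro v
    simp only [wt]
    split_ifs with hv
    · have := hC hv.choose
      omega
    · exact Nat.one_pos
  · intro v hv
    obtain ⟨i, s, hs, rfl⟩ := hcov v hv
    by_cases e : s = σ i
    · exact ⟨i + 1, Or.inl (by rw [hqs, e])⟩
    · refine ⟨i, Or.inr ?_⟩
      have : -σ i = s := by
        rcases hs with rfl | rfl <;> rcases hσ i with h | h <;> rw [h] at e ⊢ <;> simp at e ⊢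
      simp only [m, this]
  · intro i
    rcases hoc i with ⟨j, hj⟩ | ⟨j, hj, -⟩
    · rw [hj]; exact hqV j
    · rw [hj]; exact hmV j
  · intro i
    obtain ⟨h1, h2, h3, h4, -⟩ := hloc i
    have lo : cpLo (q i) (m i) = A i + cpLo (-d i + cpFar (d (i - 1)) (σ (i - 1))) (cpFar (d i) (-σ i)) := by
      rw [rq, rm]
      simp only [cpLo, Prod.ext_iff, Prod.fst_add, Prod.snd_add, min_add_add_left, and_self]
    have hi : cpHi (q i) (m i) = A i + cpHi (-d i + cpFar (d (i - 1)) (σ (i - 1))) (cpFar (d i) (-σ i)) := by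
      rw [rq, rm]
      simp only [cpHi, Prod.ext_iff, Prod.fst_add, Prod.snd_add, max_add_add_left, and_self]
    constructor
    · rw [ro, rq', rm, rq]
      rcases h1 with ⟨h1, h1'⟩ | ⟨h1, h1'⟩
      · left; rw [h1]; exact ⟨rfl, by rw [h1']; rfl⟩
      · right; rw [h1]; exact ⟨rfl, by rw [h1']; rfl⟩
    · rw [lo, hi]
      refine ⟨by simpa using h2, by simpa using h3, ?_⟩
      intro c k1 k2 k3 k4
      rcases h4 with ⟨h4, h4'⟩ | ⟨h4, h4'⟩
      · rw [h4] at k1 k3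
        rw [h4'] at k2 k4
        have : c = A i := by
          simp only [Prod.fst_add, Prod.snd_add] at k1 k2 k3 k4
          ext <;> omega
        rw [this]; exact hAP i
      · rw [h4] at k1 k3
        rw [h4'] at k2 k4
        have : c = A i ∨ c = A i - d i := by
          have hdi := hd i
          generalize d i = e at *
          generalize A i = a at *
          obtain ⟨a1, a2⟩ := a
          obtain ⟨x1, x2⟩ := c
          clear h4 h4' h1 h2 h3 lo hi
          simp only [cpDirs, List.mem_cons, List.not_mem_nil, or_false] at hdi
          rcases hdi with rfl | rfl | rfl | rfl <;> simp [cpLo, cpHi] at k1 k2 k3 k4 ⊢ <;> omega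
        rcases this with h | h
        · rw [h]; exact hAP i
        · rw [h, hAd]; exact hAP _
  · intro i
    rw [wtq, wtq, wtm]
    have h1 := hC i
    rcases hoc i with ⟨j, hj⟩ | ⟨j, hj, hl⟩
    · rw [hj, wtq]; omega
    · have h2 := hC j
      rw [hj, wtm]; omega

/-- If `P` is a closed path polyomino and `K` a field, then the Krull
dimension of `K[P] = S_P / I_P` equals `rank(P)`, the number of cells of `P`. -/
theorem closedPath_krullDim_eq_rank (K : Type*) [Field K] (P : Finset Cell)
    (hP : IsClosedPath P) :
    ringKrullDim (MvPolynomial {v // v ∈ polyVerts P} K ⧸ polyIdeal K P) =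
      ((P.card : ℕ) : WithBot (WithTop ℕ)) := by
  classical
  obtain ⟨n, hn, A, hA⟩ := hP
  haveI : NeZero n := ⟨by omega⟩
  obtain ⟨q, m, o, wt, hwt, hcov, hqV, hmV, hoV, hsq, hlt, hqinj, hminj, hqm⟩ := cp_data n hn A P hA
  obtain ⟨hadj, hinj, hdis, hPA⟩ := hA
  have hcard : P.card = n := by
    have : P = Finset.univ.image A := by
      apply Finset.coe_injective
      rw [hPA]; simp
    rw [this, Finset.card_image_of_injective _ hinj, Finset.card_univ, ZMod.card]
  rw [hcard]
  apply le_antisymm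
  · let x : {v // v ∈ polyVerts P} → MvPolynomial {v // v ∈ polyVerts P} K ⧸ polyIdeal K P :=
      fun v => Ideal.Quotient.mk _ (MvPolynomial.X v)
    have hx : Function.Surjective (MvPolynomial.aeval x :
        MvPolynomial {v // v ∈ polyVerts P} K →ₐ[K] _) := by
      have : (MvPolynomial.aeval x : MvPolynomial {v // v ∈ polyVerts P} K →ₐ[K] _) =
          Ideal.Quotient.mkₐ K (polyIdeal K P) := by
        apply MvPolynomial.algHom_ext
        intro i
        simp [x]
      rw [this]
      exact Ideal.Quotient.mkₐ_surjective K _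
    have rel : ∀ a b c d : {v // v ∈ polyVerts P}, IsInnerInterval P (a : Cell) (b : Cell) →
        (c : Cell) = ((a : Cell).1, (b : Cell).2) → (d : Cell) = ((b : Cell).1, (a : Cell).2) →
        x a * x b = x c * x d := by
      intro a b c d h1 h2 h3
      simp only [x]
      rw [← map_mul, ← map_mul, Ideal.Quotient.eq]
      exact Ideal.subset_span ⟨a, b, c, d, h1, h2, h3, rfl⟩
    have sq : ∀ a b c d : {v // v ∈ polyVerts P}, cpSq a b c d →
        IsInnerInterval P (cpLo a b) (cpHi a b) → x a * x b = x c * x d := by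
      rintro ⟨⟨a1, a2⟩, ha⟩ ⟨⟨b1, b2⟩, hb⟩ ⟨⟨c1, c2⟩, hc⟩ ⟨⟨d1, d2⟩, hd⟩ h1 h2
      simp only [cpSq, Prod.mk.injEq] at h1
      rcases le_total a1 b1 with k1 | k1 <;> rcases le_total a2 b2 with k2 | k2 <;>
        simp only [cpLo, cpHi, min_eq_left k1, min_eq_right k1, max_eq_left k1, max_eq_right k1,
          min_eq_left k2, min_eq_right k2, max_eq_left k2, max_eq_right k2] at h2 <;>
        rcases h1 with ⟨⟨rfl, rfl⟩, rfl, rfl⟩ | ⟨⟨rfl, rfl⟩, rfl, rfl⟩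
      all_goals first
        | (have h3 := rel ⟨_, ha⟩ ⟨_, hb⟩ ⟨_, hc⟩ ⟨_, hd⟩ h2 rfl rfl; linear_combination h3)
        | (have h3 := rel ⟨_, ha⟩ ⟨_, hb⟩ ⟨_, hd⟩ ⟨_, hc⟩ h2 rfl rfl; linear_combination h3)
        | (have h3 := rel ⟨_, hb⟩ ⟨_, ha⟩ ⟨_, hc⟩ ⟨_, hd⟩ h2 rfl rfl; linear_combination h3)
        | (have h3 := rel ⟨_, hb⟩ ⟨_, ha⟩ ⟨_, hd⟩ ⟨_, hc⟩ h2 rfl rfl; linear_combination h3)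
        | (have h3 := rel ⟨_, hc⟩ ⟨_, hd⟩ ⟨_, ha⟩ ⟨_, hb⟩ h2 rfl rfl; linear_combination -h3)
        | (have h3 := rel ⟨_, hc⟩ ⟨_, hd⟩ ⟨_, hb⟩ ⟨_, ha⟩ h2 rfl rfl; linear_combination -h3)
        | (have h3 := rel ⟨_, hd⟩ ⟨_, hc⟩ ⟨_, ha⟩ ⟨_, hb⟩ h2 rfl rfl; linear_combination -h3)
        | (have h3 := rel ⟨_, hd⟩ ⟨_, hc⟩ ⟨_, hb⟩ ⟨_, ha⟩ h2 rfl rfl; linear_combination -h3)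
    have := cp_upper (ι := ZMod n) x hx (fun v => wt v) (fun v => hwt v) (fun i => ⟨q i, hqV i⟩)
      (fun i => ⟨m i, hmV i⟩) (fun i => ⟨o i, hoV i⟩) (fun i => ⟨q (i + 1), hqV (i + 1)⟩)
      (by
        rintro ⟨v, hv⟩
        obtain ⟨i, hi⟩ := hcov v hv
        exact ⟨i, by simpa [Subtype.ext_iff] using hi⟩)
      (fun i => sq _ _ _ _ (hsq i).1 (hsq i).2) hlt
    rwa [ZMod.card] at this
  · have hverts : ∀ i x, x ∈ cellVerts (A i) → x ∈ polyVerts P := by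
      intro i x hx
      have : A i ∈ (P : Set Cell) := hPA ▸ Set.mem_range_self i
      exact Finset.mem_biUnion.mpr ⟨A i, this, hx⟩
    let g : ZMod n → MvPolynomial {v // v ∈ polyVerts P} K := fun i =>
      MvPolynomial.X ⟨A i, hverts i _ (by simp [cellVerts])⟩ *
        MvPolynomial.X ⟨((A i).1 + 1, (A i).2 + 1), hverts i _ (by simp [cellVerts])⟩ -
      MvPolynomial.X ⟨((A i).1, (A i).2 + 1), hverts i _ (by simp [cellVerts])⟩ *
        MvPolynomial.X ⟨((A i).1 + 1, (A i).2), hverts i _ (by simp [cellVerts])⟩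
    let ev : MvPolynomial {v // v ∈ polyVerts P} K →+* K := MvPolynomial.eval (fun _ => 1)
    have hev : Function.Surjective ev := fun c => ⟨MvPolynomial.C c, by simp [ev]⟩
    haveI : (RingHom.ker ev).IsMaximal := RingHom.ker_isMaximal_of_surjective ev hev
    refine cp_lower g (polyIdeal K P) (RingHom.ker ev) ?_ ?_ n ?_
    · intro i
      rw [RingHom.mem_ker]
      simp [g, ev]
    · intro p hp hpm hg
      haveI := hp
      rw [polyIdeal, Ideal.span_le]
      rintro _ ⟨⟨⟨a1, a2⟩, ha⟩, ⟨⟨b1, b2⟩, hb⟩, ⟨c, hc⟩, ⟨d, hd⟩, ⟨k1, k2, k3⟩, h2, h3, rfl⟩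
      simp only at h2 h3 k1 k2 k3
      subst h2 h3
      let L := FractionRing (MvPolynomial {v // v ∈ polyVerts P} K ⧸ p)
      let φ : MvPolynomial {v // v ∈ polyVerts P} K →+* L :=
        (algebraMap (MvPolynomial {v // v ∈ polyVerts P} K ⧸ p) L).comp (Ideal.Quotient.mk p)
      have hφ : ∀ f, φ f = 0 ↔ f ∈ p := by
        intro f
        simp only [φ, RingHom.comp_apply]
        rw [map_eq_zero_iff _ (IsFractionRing.injective _ L), Ideal.Quotient.eq_zero_iff_mem]
      let f : ℤ → ℤ → L := fun x y =>
        if h : (x, y) ∈ polyVerts P then φ (MvPolynomial.X ⟨(x, y), h⟩) else 1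
      have hfv : ∀ x y (h : (x, y) ∈ polyVerts P), f x y = φ (MvPolynomial.X ⟨(x, y), h⟩) :=
        fun x y h => dif_pos h
      have hf : ∀ x y, f x y ≠ 0 := by
        intro x y
        by_cases h : (x, y) ∈ polyVerts P
        · rw [hfv x y h, Ne, hφ]
          intro hh
          have := hpm hh
          rw [RingHom.mem_ker] at this
          simp [ev] at this
        · simp only [f]
          rw [dif_neg h]
          exact one_ne_zero
      have key := cp_interval f hf a1 a2 b1 b2 k1.le k2.le (by
        intro x y e1 e2 e3 e4
        have hxy : (x, y) ∈ Set.range A := hPA ▸ (k3 (x, y) e1 e2 e3 e4)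
        obtain ⟨i, hi⟩ := hxy
        have h0 := (hφ _).mpr (hg i)
        simp only [g, hi, map_sub, map_mul, sub_eq_zero] at h0
        rw [hfv x y (hverts i _ (by simp [cellVerts, hi])),
          hfv (x + 1) (y + 1) (hverts i _ (by simp [cellVerts, hi])),
          hfv x (y + 1) (hverts i _ (by simp [cellVerts, hi])),
          hfv (x + 1) y (hverts i _ (by simp [cellVerts, hi]))]
        exact h0)
      rw [SetLike.mem_coe, ← hφ, map_sub, map_mul, map_mul, sub_eq_zero]
      rw [hfv _ _ ha, hfv _ _ hb, hfv _ _ hc, hfv _ _ hd] at key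
      exact key
    · let e : ZMod n ⊕ ZMod n → {v // v ∈ polyVerts P} :=
        Sum.elim (fun i => ⟨q i, hqV i⟩) (fun i => ⟨m i, hmV i⟩)
      have he : Function.Injective e := by
        rintro (i | i) (j | j) h
        · exact congrArg _ (hqinj (congrArg Subtype.val h))
        · exact absurd (congrArg Subtype.val h) (hqm i j)
        · exact absurd (congrArg Subtype.val h).symm (hqm j i)
        · exact congrArg _ (hminj (congrArg Subtype.val h))
      have := Fintype.card_le_of_injective e he
      rw [Fintype.card_sum, ZMod.card] at this
      rw [ZMod.card]
      exact this
end

section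
/- Let P be a closed path polyomino and K a field. Then the height of the polyomino ideal I_P in S_P equals rank(P), the number of cells of P. -/
open scoped MonomialOrder

universe u₁ u₂ u₃

open AlgebraicIndependent

set_option linter.unusedSimpArgs false

lemma aux_poly {R A : Type*} [CommRing R] [IsNoetherianRing R] [CommRing A] [IsDomain A]
    (g : R →+* A) (a : A) :
    (RingHom.ker g).height ≤ (RingHom.ker (Polynomial.eval₂RingHom g a)).height ∧
    ((∃ h : Polynomial R, h.map g ≠ 0 ∧ h.eval₂ g a = 0) →
      (RingHom.ker g).height + 1 ≤ (RingHom.ker (Polynomial.eval₂RingHom g a)).height) := by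
  have hp : (RingHom.ker g).IsPrime := RingHom.ker_isPrime g
  have hP : (RingHom.ker (Polynomial.eval₂RingHom g a)).IsPrime := RingHom.ker_isPrime _
  have hQ : ((RingHom.ker g).map Polynomial.C).IsPrime := Ideal.isPrime_map_C_of_isPrime
  have hle : (RingHom.ker g).map Polynomial.C ≤ RingHom.ker (Polynomial.eval₂RingHom g a) := by
    rw [Ideal.map_le_iff_le_comap]
    intro r hr
    simpa [RingHom.mem_ker] using hr
  have hover : ((RingHom.ker g).map Polynomial.C).LiesOver (RingHom.ker g) := by
    constructor
    ext r
    simp only [Ideal.mem_comap, Ideal.under, Polynomial.algebraMap_eq, Ideal.mem_map_C_iff,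
      Polynomial.coeff_C]
    constructor
    · intro h n
      split_ifs
      · exact h
      · simp
    · intro h
      simpa using h 0
  have h1 : (RingHom.ker g).height ≤ ((RingHom.ker g).map Polynomial.C).height := by
    rw [Ideal.height_eq_height_add_of_liesOver_of_hasGoingDown (RingHom.ker g)
      ((RingHom.ker g).map Polynomial.C)]
    exact le_self_add
  refine ⟨h1.trans (Ideal.height_mono hle), ?_⟩
  rintro ⟨h, hh, h0⟩
  have hlt : (RingHom.ker g).map Polynomial.C < RingHom.ker (Polynomial.eval₂RingHom g a) := by
    refine lt_of_le_of_ne hle fun heq => hh ?_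
    have : h ∈ (RingHom.ker g).map Polynomial.C := by
      rw [heq]; simpa [RingHom.mem_ker] using h0
    rw [Ideal.mem_map_C_iff] at this
    ext n
    simpa using this n
  exact (add_le_add_left h1 1).trans (Ideal.height_add_one_le_of_lt_of_isPrime hlt)

lemma height_add_rk {K A : Type*} [Field K] [CommRing A] [IsDomain A] [Algebra K A]
    (ι : Type*) [Finite ι] (x : ι → A) :
    (Nat.card ι : ℕ∞) ≤ (RingHom.ker (MvPolynomial.aeval (R := K) x)).height +
      (matroid K A).eRk (Set.range x) := by
  induction ι using Finite.induction_empty_option with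
  | @of_equiv α β e H =>
    have h1 := H (x ∘ e)
    rw [Nat.card_congr e, EquivLike.range_comp] at h1
    refine h1.trans (le_of_eq ?_)
    congr 1
    rw [← RingEquiv.height_comap (MvPolynomial.renameEquiv K e).toRingEquiv]
    congr 1
    ext p
    simp [RingHom.mem_ker, MvPolynomial.aeval_rename]
  | h_empty => simp
  | @h_option α _ IH =>
    have h1 := IH (x ∘ some)
    set g : MvPolynomial α K →ₐ[K] A := MvPolynomial.aeval (x ∘ some) with hg
    have hk : (RingHom.ker (MvPolynomial.aeval (R := K) x)).height =
        (RingHom.ker (Polynomial.eval₂RingHom (g : MvPolynomial α K →+* A) (x none))).height := by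
      rw [← RingEquiv.height_comap (MvPolynomial.optionEquivLeft K α).toRingEquiv]
      congr 1
      ext p
      have : MvPolynomial.aeval (R := K) x p =
          Polynomial.eval₂ (g : MvPolynomial α K →+* A) (x none)
            (MvPolynomial.optionEquivLeft K α p) := by
        induction p using MvPolynomial.induction_on with
        | C a => simp [MvPolynomial.optionEquivLeft_C]
        | add p q hp hq => simp [hp, hq, Polynomial.eval₂_add]
        | mul_X p i hp =>
          rw [map_mul, map_mul, Polynomial.eval₂_mul, hp]
          congr 1
          cases i with
          | none => simp [MvPolynomial.optionEquivLeft_X_none]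
          | some i => simp [MvPolynomial.optionEquivLeft_X_some, hg]
      simp [RingHom.mem_ker, this]
    have hr : Set.range x = insert (x none) (Set.range (x ∘ some)) := by
      ext y; simp [Option.exists, eq_comm]
    rw [hk, hr, Finite.card_option]
    obtain ⟨ha, hb⟩ := aux_poly (g : MvPolynomial α K →+* A) (x none)
    have hkg : (RingHom.ker (g : MvPolynomial α K →+* A)) = RingHom.ker g := rfl
    rw [hkg] at ha hb
    push_cast
    by_cases hc : x none ∈ (matroid K A).closure (Set.range (x ∘ some))
    · have := hb (by
        rw [matroid_closure_eq, SetLike.mem_coe, Subalgebra.mem_algebraicClosure] at hc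
        obtain ⟨q, hq, hq0⟩ := hc
        have hrg : ∀ y : Algebra.adjoin K (Set.range (x ∘ some)), ∃ r, g r = y := by
          rintro ⟨y, hy⟩
          rw [Algebra.adjoin_range_eq_range_aeval] at hy
          exact hy
        let g' : MvPolynomial α K →+* Algebra.adjoin K (Set.range (x ∘ some)) :=
          RingHom.codRestrict (g : MvPolynomial α K →+* A) _ (fun r => by
            rw [Algebra.adjoin_range_eq_range_aeval]; exact ⟨r, rfl⟩)
        have hg' : Function.Surjective g' := fun y => by
          obtain ⟨r, hr⟩ := hrg y
          exact ⟨r, Subtype.ext hr⟩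
        obtain ⟨h, rfl⟩ := Polynomial.map_surjective g' hg' q
        have hcomp : (algebraMap (Algebra.adjoin K (Set.range (x ∘ some))) A).comp g' =
          (g : MvPolynomial α K →+* A) := rfl
        refine ⟨h, ?_, ?_⟩
        · rw [← hcomp, ← Polynomial.map_map]
          exact (Polynomial.map_ne_zero_iff Subtype.val_injective).mpr hq
        · rw [Polynomial.aeval_def, Polynomial.eval₂_map] at hq0
          exact hq0)
      calc (Nat.card α : ℕ∞) + 1 ≤ _ + 1 := add_le_add_left h1 1
        _ = (RingHom.ker g).height + 1 + (matroid K A).eRk (Set.range (x ∘ some)) := by ring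
        _ ≤ _ := add_le_add this ((matroid K A).eRk_mono (Set.subset_insert _ _))
    · rw [Matroid.eRk_insert_eq_add_one ⟨by simp, hc⟩, ← add_assoc]
      exact add_le_add_left (h1.trans (add_le_add_left ha _)) 1


/-- The relations between the images of the vertices. -/
def CellRel {A : Type*} [CommRing A] (P : Finset Cell) (x : Cell → A) : Prop :=
  (∀ a b : ℤ, (a, b) ∈ P → x (a, b) * x (a + 1, b + 1) = x (a, b + 1) * x (a + 1, b)) ∧
  (∀ a b : ℤ, (a, b) ∈ P → (a + 1, b) ∈ P →
    x (a, b) * x (a + 2, b + 1) = x (a, b + 1) * x (a + 2, b)) ∧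
  (∀ a b : ℤ, (a, b) ∈ P → (a, b + 1) ∈ P →
    x (a, b) * x (a + 1, b + 2) = x (a, b + 2) * x (a + 1, b))

lemma mem_cellVerts {a b c d : ℤ} : (c, d) ∈ cellVerts (a, b) ↔
    (c = a ∨ c = a + 1) ∧ (d = b ∨ d = b + 1) := by
  simp only [cellVerts, Finset.mem_insert, Finset.mem_singleton, Prod.mk.injEq]
  omega

lemma step_geom {A : Type*} [CommRing A] {P : Finset Cell} {x : Cell → A} (hx : CellRel P x)
    {C D w : Cell} (hC : C ∈ P) (hD : D ∈ P) (h : EdgeAdj C D) (hw : w ∈ cellVerts C) :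
    ∃ u w' r, (∀ v ∈ cellVerts D, v ∈ cellVerts C ∨ v = u ∨ v = w') ∧ w' ∈ cellVerts D ∧
      r ∈ cellVerts C ∧ x w * x u = x w' * x r := by
  obtain ⟨a, b⟩ := C
  obtain ⟨c, d⟩ := D
  obtain ⟨e, f⟩ := w
  obtain ⟨h1, h2, h3⟩ := hx
  rw [mem_cellVerts] at hw
  simp only [EdgeAdj] at h
  rcases h with ⟨rfl, rfl | rfl⟩ | ⟨rfl, rfl | rfl⟩
  · -- downwards
    refine ⟨(2 * a + 1 - e, d), (e, d), (2 * a + 1 - e, f), ?_, ?_, ?_, ?_⟩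
    · rintro ⟨p, q⟩ hv
      simp only [mem_cellVerts, Prod.mk.injEq] at hv ⊢
      omega
    · simp only [mem_cellVerts, true_or, and_true, true_and]; omega
    · simp only [mem_cellVerts, true_or, and_true, true_and]; omega
    · have r1 := h1 _ _ hD
      have r2 := h3 _ _ hD hC
      rcases hw with ⟨rfl | rfl, rfl | rfl⟩ <;> ring_nf at r1 r2 ⊢ <;> grind
  · refine ⟨(2 * a + 1 - e, b + 2), (e, b + 2), (2 * a + 1 - e, f), ?_, ?_, ?_, ?_⟩
    · rintro ⟨p, q⟩ hv
      simp only [mem_cellVerts, Prod.mk.injEq] at hv ⊢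
      omega
    · simp only [mem_cellVerts, true_or, and_true, true_and]; omega
    · simp only [mem_cellVerts, true_or, and_true, true_and]; omega
    · have r1 := h1 _ _ hD
      have r2 := h3 _ _ hC hD
      rcases hw with ⟨rfl | rfl, rfl | rfl⟩ <;> ring_nf at r1 r2 ⊢ <;> grind
  · refine ⟨(c, 2 * b + 1 - f), (c, f), (e, 2 * b + 1 - f), ?_, ?_, ?_, ?_⟩
    · rintro ⟨p, q⟩ hv
      simp only [mem_cellVerts, Prod.mk.injEq] at hv ⊢
      omega
    · simp only [mem_cellVerts, true_or, and_true, true_and]; omega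
    · simp only [mem_cellVerts, true_or, and_true, true_and]; omega
    · have r1 := h1 _ _ hD
      have r2 := h2 _ _ hD hC
      rcases hw with ⟨rfl | rfl, rfl | rfl⟩ <;> ring_nf at r1 r2 ⊢ <;> grind
  · refine ⟨(a + 2, 2 * b + 1 - f), (a + 2, f), (e, 2 * b + 1 - f), ?_, ?_, ?_, ?_⟩
    · rintro ⟨p, q⟩ hv
      simp only [mem_cellVerts, Prod.mk.injEq] at hv ⊢
      omega
    · simp only [mem_cellVerts, true_or, and_true, true_and]; omega
    · simp only [mem_cellVerts, true_or, and_true, true_and]; omega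
    · have r1 := h1 _ _ hD
      have r2 := h2 _ _ hC hD
      rcases hw with ⟨rfl | rfl, rfl | rfl⟩ <;> ring_nf at r1 r2 ⊢ <;> grind

/-- Every vertex has its opposite in a cell. -/
lemma opp_geom {A : Type*} [CommRing A] {P : Finset Cell} {x : Cell → A} (hx : CellRel P x)
    {C w : Cell} (hC : C ∈ P) (hw : w ∈ cellVerts C) :
    ∃ p q o, (∀ v, v ∈ cellVerts C ↔ v = w ∨ v = p ∨ v = q ∨ v = o) ∧
      x w * x o = x p * x q := by
  obtain ⟨a, b⟩ := C
  obtain ⟨e, f⟩ := w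
  have r1 := hx.1 _ _ hC
  rw [mem_cellVerts] at hw
  refine ⟨(2 * a + 1 - e, f), (e, 2 * b + 1 - f), (2 * a + 1 - e, 2 * b + 1 - f), ?_, ?_⟩
  · rintro ⟨p, q⟩
    simp only [mem_cellVerts, Prod.mk.injEq]
    omega
  · rcases hw with ⟨rfl | rfl, rfl | rfl⟩ <;> ring_nf at r1 ⊢ <;> grind

set_option maxHeartbeats 4000000 in

lemma corner_geom {A : Type*} [CommRing A] {P : Finset Cell} {x : Cell → A} (hx : CellRel P x)
    {E B C D : Cell} (hE : E ∈ P) (hB : B ∈ P) (hC : C ∈ P)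
    (hBC : EdgeAdj B C) (hCD : EdgeAdj C D) (hEB : C - B = B - E) (hcor : D - C ≠ C - B)
    (hBD : B ≠ D) :
    ∃ z p q o, (∀ v, v ∈ cellVerts C ↔ v = z ∨ v = p ∨ v = q ∨ v = o) ∧
      (∀ v ∈ cellVerts B, v ∈ cellVerts E ∨ v = z ∨ v = p) ∧
      z ∈ cellVerts D ∧ q ∈ cellVerts D ∧ x z * x o = x p * x q ∧
      ∀ w ∈ cellVerts E, ∃ r ∈ cellVerts E, x w * x p = x z * x r ∨ x w * x z = x p * x r := by
  have hEB' : EdgeAdj E B := by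
    obtain ⟨a, b⟩ := C
    obtain ⟨c, d⟩ := B
    obtain ⟨e, f⟩ := E
    simp only [EdgeAdj, Prod.mk_sub_mk, Prod.mk.injEq] at *
    omega
  -- the inner corner
  obtain ⟨z, hzB, hzC, hzD⟩ : ∃ z, z ∈ cellVerts B ∧ z ∈ cellVerts C ∧ z ∈ cellVerts D := by
    obtain ⟨a, b⟩ := C
    obtain ⟨c, d⟩ := B
    obtain ⟨e, f⟩ := D
    refine ⟨(max (max a c) e, max (max b d) f), ?_⟩
    simp only [EdgeAdj, Prod.mk_sub_mk, Prod.mk.injEq, ne_eq, mem_cellVerts] at *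
    omega
  have hmain : ∃ p q o, (∀ v, v ∈ cellVerts C ↔ v = z ∨ v = p ∨ v = q ∨ v = o) ∧
      p ∈ cellVerts B ∧ p ≠ z ∧ q ∈ cellVerts D ∧ x z * x o = x p * x q := by
    clear hEB hEB' hE
    obtain ⟨a, b⟩ := C
    obtain ⟨c, d⟩ := B
    obtain ⟨e, f⟩ := D
    obtain ⟨g, h⟩ := z
    have r1 := hx.1 _ _ hC
    simp only [EdgeAdj, Prod.mk_sub_mk, Prod.mk.injEq, ne_eq, mem_cellVerts] at *
    have hrel : x (g, h) * x (2 * a + 1 - g, 2 * b + 1 - h) =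
        x (g, 2 * b + 1 - h) * x (2 * a + 1 - g, h) := by
      clear hBC hCD hcor hBD hzB hzD
      rcases hzC with ⟨rfl | rfl, rfl | rfl⟩ <;> ring_nf at r1 ⊢ <;> grind
    by_cases hbd : b = d
    · refine ⟨(g, 2 * b + 1 - h), (2 * a + 1 - g, h), (2 * a + 1 - g, 2 * b + 1 - h), ?_, ?_, ?_,
        ?_, hrel⟩
      · rintro ⟨s, t⟩
        simp only [mem_cellVerts, Prod.mk.injEq]
        clear hBC hCD hcor hBD hzB hzD
        omega
      all_goals simp only [Prod.mk.injEq, mem_cellVerts]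
      all_goals omega
    · refine ⟨(2 * a + 1 - g, h), (g, 2 * b + 1 - h), (2 * a + 1 - g, 2 * b + 1 - h), ?_, ?_, ?_,
        ?_, by rw [hrel, mul_comm]⟩
      · rintro ⟨s, t⟩
        simp only [mem_cellVerts, Prod.mk.injEq]
        clear hBC hCD hcor hBD hzB hzD
        omega
      all_goals simp only [Prod.mk.injEq, mem_cellVerts]
      all_goals omega
  obtain ⟨p, q, o, hV, hpB, hpz, hqD, hrel⟩ := hmain
  have hpC : p ∈ cellVerts C := (hV p).2 (by simp)
  clear hcor hCD hBD
  have hzE : (z ∉ cellVerts E ∧ p ∉ cellVerts E) ∧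
      ∀ v ∈ cellVerts B, v ∈ cellVerts E ∨ v = z ∨ v = p := by
    clear hV hrel hzD hqD
    obtain ⟨a, b⟩ := C
    obtain ⟨c, d⟩ := B
    obtain ⟨e, f⟩ := E
    obtain ⟨g, h⟩ := z
    obtain ⟨g', h'⟩ := p
    simp only [EdgeAdj, Prod.mk_sub_mk, Prod.mk.injEq, ne_eq, mem_cellVerts] at *
    clear hEB'
    constructor
    · omega
    rintro ⟨s, t⟩
    simp only [Prod.mk.injEq, mem_cellVerts]
    omega
  refine ⟨z, p, q, o, hV, hzE.2, hzD, hqD, hrel, ?_⟩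
  intro w hw
  obtain ⟨u, w', r, h1, h2, h3, h4⟩ := step_geom hx hE hB hEB' hw
  refine ⟨r, h3, ?_⟩
  have hz' := (h1 z hzB).resolve_left hzE.1.1
  have hp' := (h1 p hpB).resolve_left hzE.1.2
  rcases hz' with rfl | rfl <;> rcases hp' with rfl | rfl
  · exact absurd rfl hpz
  · exact Or.inr h4
  · exact Or.inl h4
  · exact absurd rfl hpz


/-- The algebraic rank of the images of a set of vertices. -/
noncomputable def vrk (K : Type*) {A : Type*} [Field K] [CommRing A] [IsDomain A] [Algebra K A]
    (x : Cell → A) (X : Set Cell) : ℕ∞ := (matroid K A).eRk (x '' X)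

section rk
variable {K A : Type*} [Field K] [CommRing A] [IsDomain A] [Algebra K A] {x : Cell → A}

lemma vrk_mono {X Y : Set Cell} (h : X ⊆ Y) : vrk K x X ≤ vrk K x Y :=
  Matroid.eRk_mono _ (Set.image_mono h)

lemma vrk_empty : vrk K x ∅ = 0 := by simp [vrk]

lemma vrk_insert (X : Set Cell) (v : Cell) : vrk K x (insert v X) ≤ vrk K x X + 1 := by
  rw [vrk, Set.image_insert_eq]
  exact Matroid.eRk_insert_le_add_one _ _ _

lemma vrk_insert_cl {X : Set Cell} {v : Cell} (h : x v ∈ (matroid K A).closure (x '' X)) :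
    vrk K x (insert v X) ≤ vrk K x X := by
  rw [vrk, vrk, Set.image_insert_eq, ← Matroid.eRk_closure_eq _ (x '' X)]
  refine Matroid.eRk_mono _ (Set.insert_subset h ?_)
  exact Matroid.subset_closure _ _ (by simp)

lemma vrk_insert_zero {X : Set Cell} {v : Cell} (h : x v = 0) :
    vrk K x (insert v X) ≤ vrk K x X := by
  refine vrk_insert_cl ?_
  rw [h, matroid_closure_eq]
  exact zero_mem _

lemma vrk_insert_alg {X : Set Cell} {w v r s : Cell} (hw : w ∈ X) (hr : r ∈ X) (hs : s ∈ X)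
    (h0 : x w ≠ 0) (h : x w * x v = x r * x s) : vrk K x (insert v X) ≤ vrk K x X := by
  have hm : ∀ y ∈ X, x y ∈ (matroid K A).closure (x '' X) := fun y hy =>
    Matroid.subset_closure _ _ (by simp) (Set.mem_image_of_mem _ hy)
  refine vrk_insert_cl ?_
  have hw' := hm w hw
  have hr' := hm r hr
  have hs' := hm s hs
  rw [matroid_closure_eq, SetLike.mem_coe] at *
  have hm' := mul_mem hr' hs'
  rw [← h] at hm'
  rw [Subalgebra.mem_algebraicClosure] at *
  exact IsAlgebraic.of_mul (mem_nonZeroDivisors_of_ne_zero h0) hw' hm'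

/-- The inductive invariant. -/
def Good (K : Type*) {A : Type*} [Field K] [CommRing A] [IsDomain A] [Algebra K A]
    (x : Cell → A) (X : Set Cell) (w : Cell) (t : ℕ) : Prop :=
  vrk K x X ≤ (t + 1 : ℕ) ∧ (x w = 0 → vrk K x X ≤ t)

lemma good_step {P : Finset Cell} (hx : CellRel P x) {C D w : Cell} (hC : C ∈ P) (hD : D ∈ P)
    (h : EdgeAdj C D) (hw : w ∈ cellVerts C) {X : Set Cell} (hX : (cellVerts C : Set Cell) ⊆ X)
    {t : ℕ} (hg : Good K x X w t) :
    ∃ w' ∈ cellVerts D, Good K x (X ∪ cellVerts D) w' (t + 1) := by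
  obtain ⟨u, w', r, h1, h2, h3, h4⟩ := step_geom hx hC hD h hw
  have hsub : X ∪ cellVerts D ⊆ insert u (insert w' X) := by
    rintro v (hv | hv)
    · exact Or.inr (Or.inr hv)
    · rcases h1 v hv with h | h | h
      · exact Or.inr (Or.inr (hX h))
      · exact Or.inl h
      · exact Or.inr (Or.inl h)
  refine ⟨w', h2, ?_⟩
  have hm := vrk_mono (K := K) (x := x) hsub
  have i1 := vrk_insert (K := K) (x := x) X w'
  have i2 := vrk_insert (K := K) (x := x) (insert w' X) u
  obtain ⟨g1, g2⟩ := hg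
  by_cases h0 : x w = 0
  · have g3 := g2 h0
    constructor
    · refine hm.trans (i2.trans ?_)
      push_cast
      gcongr
      exact i1.trans (by gcongr)
    · intro hw'
      refine hm.trans (i2.trans ?_)
      push_cast
      gcongr
      exact (vrk_insert_zero hw').trans g3
  · have i3 : vrk K x (insert u (insert w' X)) ≤ vrk K x (insert w' X) :=
      vrk_insert_alg (w := w) (r := w') (s := r) (Or.inr (hX hw)) (Or.inl rfl) (Or.inr (hX h3))
        h0 h4
    constructor
    · refine hm.trans (i3.trans (i1.trans ?_))
      push_cast at g1 ⊢
      gcongr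
    · intro hw'
      exact hm.trans (i3.trans ((vrk_insert_zero hw').trans g1))

lemma good_iter {P : Finset Cell} (hx : CellRel P x) (C : ℕ → Cell) (hC : ∀ k, C k ∈ P)
    (h : ∀ k, EdgeAdj (C k) (C (k + 1))) {w : Cell} (hw : w ∈ cellVerts (C 0)) {t : ℕ}
    (hg : Good K x (cellVerts (C 0)) w t) (m : ℕ) :
    ∃ w' ∈ cellVerts (C m), Good K x (⋃ k ≤ m, (cellVerts (C k) : Set Cell)) w' (t + m) := by
  induction m with
  | zero => exact ⟨w, hw, by simpa using hg⟩
  | succ m ih =>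
    obtain ⟨w', h1, h2⟩ := ih
    obtain ⟨w'', h3, h4⟩ := good_step hx (hC m) (hC (m + 1)) (h m) h1
      (Set.subset_biUnion_of_mem (u := fun k => (cellVerts (C k) : Set Cell))
        (show m ∈ {k | k ≤ m} by simp)) h2
    refine ⟨w'', h3, ?_⟩
    rwa [Set.biUnion_le_succ]

/-- The rank bound around the cycle, starting from a corner after a straight part. -/
lemma cycle_rank {P : Finset Cell} (hx : CellRel P x) (C : ℕ → Cell) (hC : ∀ k, C k ∈ P)
    (h : ∀ k, EdgeAdj (C k) (C (k + 1))) (n : ℕ) (hn : 5 < n) (hper : C n = C 0)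
    (hstr : C 0 - C (n - 1) = C (n - 1) - C (n - 2)) (hcor : C 1 - C 0 ≠ C 0 - C (n - 1))
    (hne : C (n - 1) ≠ C 1) :
    vrk K x (⋃ k < n, (cellVerts (C k) : Set Cell)) ≤ n := by
  obtain ⟨m, rfl⟩ : ∃ m, n = m + 3 := ⟨n - 3, by omega⟩
  have e1 : m + 3 - 1 = m + 2 := rfl
  have e2 : m + 3 - 2 = m + 1 := rfl
  rw [e1] at *
  rw [e2] at *
  have hadj := h (m + 2)
  rw [show m + 2 + 1 = m + 3 from rfl, hper] at hadj
  obtain ⟨z, p, q, o, hV, hB, hzD, hqD, hrel, hE⟩ := corner_geom hx (hC (m + 1)) (hC (m + 2))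
    (hC 0) hadj (h 0) hstr hcor hne
  have hVs : (cellVerts (C 0) : Set Cell) ⊆ insert o (insert z (insert p (insert q ∅))) := by
    intro v hv
    have := (hV v).1 hv
    simp only [Set.mem_insert_iff]; tauto
  by_cases hz : x z = 0
  · have hpq : x p = 0 ∨ x q = 0 := by
      rw [hz, zero_mul] at hrel
      exact mul_eq_zero.1 hrel.symm
    have b3 : vrk K x (insert z (insert p (insert q ∅))) ≤ 1 := by
      refine (vrk_insert_zero hz).trans ?_
      rcases hpq with h0 | h0
      · refine (vrk_insert_zero h0).trans ((vrk_insert _ _).trans ?_)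
        simp [vrk_empty]
      · refine (vrk_insert _ _).trans ?_
        have := (vrk_insert_zero (K := K) (X := ∅) h0)
        rw [vrk_empty] at this
        simpa using add_le_add_left this 1
    have hg : Good K x (cellVerts (C 0)) o 1 := by
      refine ⟨(vrk_mono hVs).trans ((vrk_insert _ _).trans ?_), fun h0 =>
        (vrk_mono hVs).trans ((vrk_insert_zero h0).trans (by simpa using b3))⟩
      exact add_le_add_left b3 1
    obtain ⟨w', -, hw⟩ := good_iter hx C hC h ((hV o).2 (by simp)) hg (m + 1)
    refine (vrk_mono ?_).trans (hw.1.trans (by norm_cast; omega))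
    intro v hv
    simp only [Set.mem_iUnion, Finset.mem_coe, exists_prop] at hv ⊢
    obtain ⟨k, hk, hv⟩ := hv
    by_cases hk' : k ≤ m + 1
    · exact ⟨k, hk', hv⟩
    obtain rfl : k = m + 2 := by omega
    rcases hB v hv with h1 | rfl | rfl
    · exact ⟨m + 1, le_rfl, h1⟩
    · exact ⟨0, by omega, (hV _).2 (by simp)⟩
    · exact ⟨0, by omega, (hV _).2 (by simp)⟩
  · obtain ⟨p', q', o', hV', hrel'⟩ := opp_geom hx (hC 1) hzD
    have hVs' : (cellVerts (C 1) : Set Cell) ⊆ insert o' (insert z (insert p' (insert q' ∅))) := by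
      intro v hv
      have := (hV' v).1 hv
      simp only [Set.mem_insert_iff]; tauto
    have hr1 : vrk K x (cellVerts (C 1)) ≤ (3 : ℕ) := by
      refine (vrk_mono hVs').trans ((vrk_insert_alg (w := z) (r := p') (s := q') (by simp) (by simp)
        (by simp) hz hrel').trans ?_)
      refine (vrk_insert _ _).trans ((add_le_add_left ((vrk_insert _ _).trans
        (add_le_add_left (vrk_insert _ _) 1)) 1).trans ?_)
      rw [vrk_empty]; norm_num
    have hg : Good K x (cellVerts (C 1)) z 2 := ⟨hr1, fun h0 => absurd h0 hz⟩
    obtain ⟨w, hwE, hw⟩ := good_iter hx (fun k => C (k + 1)) (fun k => hC _) (fun k => h _) hzD hg m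
    set Y : Set Cell := ⋃ k ≤ m, (cellVerts (C (k + 1)) : Set Cell) with hY
    have hYm : ∀ k ≤ m, ∀ v ∈ cellVerts (C (k + 1)), v ∈ Y := by
      intro k hk v hv
      simp only [hY, Set.mem_iUnion, Finset.mem_coe, exists_prop]
      exact ⟨k, hk, hv⟩
    have hzY := hYm 0 (by omega) z hzD
    have hqY := hYm 0 (by omega) q hqD
    have hwY := hYm m le_rfl w hwE
    have hp : vrk K x (insert p Y) ≤ (m + 3 : ℕ) := by
      have key : x w = 0 ∨ vrk K x (insert p Y) ≤ vrk K x Y := by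
        by_cases hw0 : x w = 0
        · exact Or.inl hw0
        right
        obtain ⟨r, hr, h1 | h1⟩ := hE w hwE
        · exact vrk_insert_alg hwY hzY (hYm m le_rfl r hr) hw0 h1
        · refine vrk_insert_alg (w := r) (r := w) (s := z) (hYm m le_rfl r hr) hwY hzY ?_ ?_
          · intro h0
            rw [h0, mul_zero] at h1
            exact (mul_ne_zero hw0 hz) h1
          · rw [h1, mul_comm]
      rcases key with h0 | h0
      · refine (vrk_insert _ _).trans ((add_le_add_left (hw.2 h0) 1).trans ?_)
        norm_cast; omega
      · refine h0.trans (hw.1.trans ?_)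
        norm_cast; omega
    have ho : vrk K x (insert o (insert p Y)) ≤ (m + 3 : ℕ) :=
      (vrk_insert_alg (w := z) (r := p) (s := q) (Or.inr hzY) (Or.inl rfl) (Or.inr hqY) hz
        hrel).trans hp
    refine (vrk_mono ?_).trans ho
    intro v hv
    simp only [Set.mem_iUnion, Finset.mem_coe, exists_prop] at hv
    obtain ⟨k, hk, hv⟩ := hv
    simp only [Set.mem_insert_iff]
    rcases k with _ | k
    · rcases (hV v).1 hv with rfl | rfl | rfl | rfl <;> tauto
    by_cases hk' : k ≤ m
    · exact Or.inr (Or.inr (hYm k hk' v hv))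
    obtain rfl : k = m + 1 := by omega
    rcases hB v hv with h1 | rfl | rfl
    · exact Or.inr (Or.inr (hYm m le_rfl v h1))
    · tauto
    · tauto

end rk


section comb
variable {n : ℕ} {A : ZMod n → Cell} {P : Finset Cell}

lemma zne (hn : 5 < n) (k : ℕ) (h0 : 0 < k) (h5 : k ≤ 5) : (k : ZMod n) ≠ 0 := by
  rw [Ne, ZMod.natCast_eq_zero_iff]
  intro h
  have := Nat.le_of_dvd h0 h
  omega

lemma zind (hn : 5 < n) (Q : ZMod n → Prop) (h : ∀ i, Q i → Q (i + 1)) (i0 : ZMod n) (h0 : Q i0)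
    (i : ZMod n) : Q i := by
  have : NeZero n := ⟨by omega⟩
  have key : ∀ k : ℕ, Q (i0 + k) := by
    intro k
    induction k with
    | zero => simpa using h0
    | succ k ih => have := h _ ih; push_cast; rwa [← add_assoc]
  have := key (i - i0).val
  rw [ZMod.natCast_zmod_val] at this
  simpa using this

lemma const_shift (hn : 5 < n) (A : ZMod n → Cell) (c : ZMod n)
    (h : ∀ i, A (i + 1 + c) - A (i + 1) = A (i + c) - A i) : A (0 + c) = A 0 := by
  have : NeZero n := ⟨by omega⟩
  have hc : ∀ i, A (i + c) - A i = A (0 + c) - A 0 :=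
    zind hn _ (fun i hi => (h i).trans hi) 0 rfl
  have hs : ∑ i, (A (i + c) - A i) = 0 := by
    rw [Finset.sum_sub_distrib, sub_eq_zero]
    exact Equiv.sum_comp (Equiv.addRight c) A
  rw [Finset.sum_congr rfl (fun i _ => hc i), Finset.sum_const, Finset.card_univ, ZMod.card] at hs
  have := (smul_eq_zero.1 hs).resolve_left (by omega)
  exact sub_eq_zero.1 this

set_option maxHeartbeats 4000000 in
lemma turn_geom {C D E F : Cell} (h1 : EdgeAdj C D) (h2 : EdgeAdj D E) (h3 : EdgeAdj E F)
    (n1 : E - D ≠ D - C) (n2 : F - E ≠ E - D) (n3 : C ≠ E) (n4 : D ≠ F)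
    (hd : cellVerts C ∩ cellVerts F = ∅) : F - E = D - C := by
  obtain ⟨a, b⟩ := C
  obtain ⟨c, d⟩ := D
  obtain ⟨e, f⟩ := E
  obtain ⟨g, h⟩ := F
  have hd' : ∀ s t, ¬ ((s, t) ∈ cellVerts (a, b) ∧ (s, t) ∈ cellVerts (g, h)) := by
    intro s t hst
    have := Finset.mem_inter.2 hst
    simp [hd] at this
  have hd'' := hd' (max a g) (max b h)
  clear hd hd'
  simp only [EdgeAdj, Prod.mk_sub_mk, Prod.mk.injEq, ne_eq, mem_cellVerts] at *
  rcases h1 with ⟨rfl, rfl | rfl⟩ | ⟨rfl, rfl | rfl⟩ <;>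
  rcases h2 with ⟨h2, h4 | h4⟩ | ⟨h2, h4 | h4⟩ <;>
  first
  | (exfalso; omega)
  | omega

lemma exists_corner (hn : 5 < n) (hA : IsClosedPathSeq n A P) :
    ∃ i, A i - A (i - 1) = A (i - 1) - A (i - 2) ∧ A (i + 1) - A i ≠ A i - A (i - 1) := by
  obtain ⟨h1, h2, h3, -⟩ := hA
  by_contra! hcon
  have z1 := zne hn 1 (by norm_num) (by norm_num)
  have z2 := zne hn 2 (by norm_num) (by norm_num)
  have z3 := zne hn 3 (by norm_num) (by norm_num)
  have z4 := zne hn 4 (by norm_num) (by norm_num)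
  have z5 := zne hn 5 (by norm_num) (by norm_num)
  push_cast at z1 z2 z3 z4 z5
  by_cases hex : ∃ i, A (i + 1) - A i = A i - A (i - 1)
  · obtain ⟨i0, hi0⟩ := hex
    have hall : ∀ i, A (i + 1) - A i = A i - A (i - 1) := by
      refine zind hn _ (fun i hi => ?_) i0 hi0
      refine hcon (i + 1) ?_
      rw [show i + 1 - 1 = i by ring, show i + 1 - 2 = i - 1 by ring]
      exact hi
    have := const_shift hn A 1 (fun i => by
      have := hall (i + 1)
      rwa [show i + 1 - 1 = i by ring] at this)
    have := h2 this
    rw [zero_add] at this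
    exact z1 this
  · push Not at hex
    have hturn : ∀ i, A (i + 3) - A (i + 2) = A (i + 1) - A i := by
      intro i
      have a1 := h1 i
      have a2 := h1 (i + 1)
      have a3 := h1 (i + 2)
      have c1 := hex (i + 1)
      have c2 := hex (i + 2)
      rw [show i + 1 + 1 = i + 2 by ring] at a2 c1
      rw [show i + 2 + 1 = i + 3 by ring] at a3 c2
      rw [show i + 1 - 1 = i by ring] at c1
      rw [show i + 2 - 1 = i + 1 by ring] at c2
      refine turn_geom a1 a2 a3 c1 c2 ?_ ?_ ?_
      · intro h
        have := h2 h
        exact z2 (by linear_combination - this)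
      · intro h
        have := h2 h
        exact z2 (by linear_combination - this)
      · refine h3 _ _ ?_
        simp only [Set.mem_insert_iff, Set.mem_singleton_iff, not_or]
        refine ⟨?_, ?_, ?_, ?_, ?_⟩ <;> intro h
        · exact z5 (by linear_combination h)
        · exact z4 (by linear_combination h)
        · exact z3 (by linear_combination h)
        · exact z2 (by linear_combination h)
        · exact z1 (by linear_combination h)
    have := const_shift hn A 2 (fun i => by
      have := hturn i
      rw [show i + 1 + 2 = i + 3 by ring]
      rw [sub_eq_sub_iff_add_eq_add] at this ⊢
      rw [this, add_comm])
    have := h2 this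
    rw [zero_add] at this
    exact z2 this

lemma new_card {C D : Cell} (h : EdgeAdj C D) : 2 ≤ (cellVerts D \ cellVerts C).card := by
  obtain ⟨a, b⟩ := C
  obtain ⟨c, d⟩ := D
  have key : ∃ s t s' t' : ℤ, (s, t) ≠ (s', t') ∧ (s, t) ∈ cellVerts (c, d) ∧
    (s', t') ∈ cellVerts (c, d) ∧ (s, t) ∉ cellVerts (a, b) ∧ (s', t') ∉ cellVerts (a, b) := by
    simp only [EdgeAdj, Prod.mk.injEq, ne_eq, mem_cellVerts] at *
    by_cases hac : a = c
    · by_cases hd : d = b + 1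
      · exact ⟨c, d + 1, c + 1, d + 1, by omega⟩
      · exact ⟨c, d, c + 1, d, by omega⟩
    · by_cases hd : c = a + 1
      · exact ⟨c + 1, d, c + 1, d + 1, by omega⟩
      · exact ⟨c, d, c, d + 1, by omega⟩
  obtain ⟨s, t, s', t', h0, h1, h2, h3, h4⟩ := key
  rw [← Finset.card_pair h0]
  apply Finset.card_le_card
  intro v hv
  simp only [Finset.mem_insert, Finset.mem_singleton] at hv
  rcases hv with rfl | rfl <;> simp [*]

lemma dist2_geom {C D E : Cell} (h1 : EdgeAdj C D) (h2 : EdgeAdj D E) (h : C ≠ E) {v : Cell}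
    (hC : v ∈ cellVerts C) (hE : v ∈ cellVerts E) : v ∈ cellVerts D := by
  obtain ⟨a, b⟩ := C
  obtain ⟨c, d⟩ := D
  obtain ⟨e, f⟩ := E
  obtain ⟨s, t⟩ := v
  simp only [EdgeAdj, Prod.mk.injEq, ne_eq, mem_cellVerts] at *
  omega

lemma closed_card (hn : 5 < n) (hA : IsClosedPathSeq n A P) :
    P.card = n ∧ 2 * n ≤ (polyVerts P).card := by
  have : NeZero n := ⟨by omega⟩
  obtain ⟨h1, h2, h3, h4⟩ := hA
  have hP : P = Finset.univ.image A := by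
    apply Finset.coe_injective
    rw [h4]; simp
  have z2 := zne hn 2 (by norm_num) (by norm_num)
  push_cast at z2
  have hmem : ∀ i, A i ∈ P := fun i => by rw [hP]; simp
  refine ⟨?_, ?_⟩
  · rw [hP, Finset.card_image_of_injective _ h2, Finset.card_univ, ZMod.card]
  let N : ZMod n → Finset Cell := fun i => cellVerts (A (i + 1)) \ cellVerts (A i)
  have hd : ∀ i j, i ≠ j → Disjoint (N i) (N j) := by
    have key : ∀ i, ∀ v, v ∈ N i → v ∉ N (i + 1) ∧ v ∉ N (i + 2) := by
      intro i v hv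
      simp only [N, Finset.mem_sdiff] at hv ⊢
      refine ⟨fun h => h.2 hv.1, fun h => h.2 ?_⟩
      rw [show i + 2 + 1 = i + 3 by ring] at h
      have hA13 : A (i + 1) ≠ A (i + 3) := fun h => by
        have := h2 h
        exact z2 (by linear_combination - this)
      have a2 := h1 (i + 1)
      have a3 := h1 (i + 2)
      rw [show i + 1 + 1 = i + 2 by ring] at a2
      rw [show i + 2 + 1 = i + 3 by ring] at a3
      exact dist2_geom a2 a3 hA13 hv.1 h.1
    intro i j hij
    rw [Finset.disjoint_left]
    intro v hv hv'
    by_cases hs : (j + 1) ∈ ({i + 1 - 2, i + 1 - 1, i + 1, i + 1 + 1, i + 1 + 2} : Set (ZMod n))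
    · simp only [Set.mem_insert_iff, Set.mem_singleton_iff] at hs
      rcases hs with hs | hs | hs | hs | hs
      · obtain rfl : i = j + 2 := by linear_combination - hs
        exact (key _ _ hv').2 hv
      · obtain rfl : i = j + 1 := by linear_combination - hs
        exact (key _ _ hv').1 hv
      · exact hij (by linear_combination - hs)
      · obtain rfl : j = i + 1 := by linear_combination hs
        exact (key _ _ hv).1 hv'
      · obtain rfl : j = i + 2 := by linear_combination hs
        exact (key _ _ hv).2 hv'
    · have := h3 _ _ hs
      have hmem : v ∈ cellVerts (A (i + 1)) ∩ cellVerts (A (j + 1)) :=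
        Finset.mem_inter.2 ⟨(Finset.mem_sdiff.1 hv).1, (Finset.mem_sdiff.1 hv').1⟩
      rw [this] at hmem
      simp at hmem
  calc 2 * n = ∑ i : ZMod n, 2 := by simp [ZMod.card, mul_comm]
    _ ≤ ∑ i : ZMod n, (N i).card := Finset.sum_le_sum fun i _ => new_card (h1 i)
    _ = (Finset.univ.biUnion N).card := (Finset.card_biUnion fun i _ j _ h => hd i j h).symm
    _ ≤ _ := by
      apply Finset.card_le_card
      intro v hv
      simp only [Finset.mem_biUnion, Finset.mem_univ, true_and] at hv
      obtain ⟨i, hi⟩ := hv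
      exact Finset.mem_biUnion.2 ⟨_, hmem (i + 1), (Finset.mem_sdiff.1 hi).1⟩

lemma closed_rank {K R : Type*} [Field K] [CommRing R] [IsDomain R] [Algebra K R] {x : Cell → R}
    (hn : 5 < n) (hA : IsClosedPathSeq n A P) (hx : CellRel P x) :
    vrk K x (polyVerts P) ≤ n := by
  have : NeZero n := ⟨by omega⟩
  obtain ⟨i, hi1, hi2⟩ := exists_corner hn hA
  obtain ⟨h1, h2, h3, h4⟩ := hA
  have hmem : ∀ i, A i ∈ P := fun i => by
    rw [← Finset.mem_coe, h4]; simp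
  have z2 := zne hn 2 (by norm_num) (by norm_num)
  push_cast at z2
  have e1 : ((n - 1 : ℕ) : ZMod n) = - 1 := by
    rw [Nat.cast_sub (by omega)]; simp
  have e2 : ((n - 2 : ℕ) : ZMod n) = - 2 := by
    rw [Nat.cast_sub (by omega)]; simp
  refine (vrk_mono ?_).trans (cycle_rank (K := K) hx (fun k : ℕ => A (i + k)) (fun k => hmem _)
    (fun k => ?_) n hn (by simp) ?_ ?_ ?_)
  · intro v hv
    obtain ⟨c, hc, hv⟩ := Finset.mem_biUnion.1 hv
    rw [← Finset.mem_coe, h4] at hc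
    obtain ⟨j, rfl⟩ := hc
    simp only [Set.mem_iUnion, Finset.mem_coe, exists_prop]
    refine ⟨(j - i).val, ZMod.val_lt _, ?_⟩
    rw [ZMod.natCast_zmod_val]
    simpa using hv
  · have := h1 (i + k)
    push_cast
    rwa [← add_assoc]
  · simpa [e1, e2, sub_eq_add_neg] using hi1
  · simpa [e1, e2, sub_eq_add_neg] using hi2
  · intro h
    have := h2 h
    rw [e1] at this
    push_cast at this
    exact z2 (by linear_combination - this)

end comb


section final
variable {K : Type*} [Field K] {P : Finset Cell}

/-- The class of the variable of a vertex. -/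
noncomputable def xof (p : Ideal (MvPolynomial {v // v ∈ polyVerts P} K)) (c : Cell) :
    MvPolynomial {v // v ∈ polyVerts P} K ⧸ p :=
  open Classical in
  if h : c ∈ polyVerts P then Ideal.Quotient.mk p (MvPolynomial.X ⟨c, h⟩) else 0

lemma xof_eq (p : Ideal (MvPolynomial {v // v ∈ polyVerts P} K)) (v : {v // v ∈ polyVerts P}) :
    xof p v = Ideal.Quotient.mk p (MvPolynomial.X v) := by
  simp [xof]

lemma vert_mem_s3 {a b c d : ℤ} (h : (a, b) ∈ P) (h' : (c = a ∨ c = a + 1) ∧ (d = b ∨ d = b + 1)) :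
    (c, d) ∈ polyVerts P :=
  Finset.mem_biUnion.2 ⟨_, h, mem_cellVerts.2 h'⟩

lemma xof_rel (p : Ideal (MvPolynomial {v // v ∈ polyVerts P} K)) (hp : polyIdeal K P ≤ p)
    {a b c d : ℤ} (h1 : (a, b) ∈ polyVerts P) (h2 : (c, d) ∈ polyVerts P)
    (h3 : (a, d) ∈ polyVerts P) (h4 : (c, b) ∈ polyVerts P) (h : IsInnerInterval P (a, b) (c, d)) :
    xof p (a, b) * xof p (c, d) = xof p (a, d) * xof p (c, b) := by
  have e1 := xof_eq p ⟨_, h1⟩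
  have e2 := xof_eq p ⟨_, h2⟩
  have e3 := xof_eq p ⟨_, h3⟩
  have e4 := xof_eq p ⟨_, h4⟩
  simp only at e1 e2 e3 e4
  rw [e1, e2, e3, e4, ← map_mul, ← map_mul, Ideal.Quotient.eq]
  exact hp (Ideal.subset_span ⟨⟨_, h1⟩, ⟨_, h2⟩, ⟨_, h3⟩, ⟨_, h4⟩, h, rfl, rfl, rfl⟩)

lemma xof_cellRel (p : Ideal (MvPolynomial {v // v ∈ polyVerts P} K)) (hp : polyIdeal K P ≤ p) :
    CellRel P (xof p) := by
  refine ⟨fun a b h => ?_, fun a b h h' => ?_, fun a b h h' => ?_⟩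
  · refine xof_rel p hp (vert_mem_s3 h (by omega)) (vert_mem_s3 h (by omega)) (vert_mem_s3 h (by omega))
      (vert_mem_s3 h (by omega)) ⟨by simp, by simp, ?_⟩
    rintro ⟨c, d⟩ h1 h2 h3 h4
    simp only at h1 h2 h3 h4
    obtain rfl : c = a := by omega
    obtain rfl : d = b := by omega
    exact h
  · refine xof_rel p hp (vert_mem_s3 h (by omega)) (vert_mem_s3 h' (by omega)) (vert_mem_s3 h (by omega))
      (vert_mem_s3 h' (by omega)) ⟨by simp, by simp, ?_⟩
    rintro ⟨c, d⟩ h1 h2 h3 h4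
    simp only at h1 h2 h3 h4
    obtain rfl : d = b := by omega
    obtain rfl | rfl : c = a ∨ c = a + 1 := by omega
    · exact h
    · exact h'
  · refine xof_rel p hp (vert_mem_s3 h (by omega)) (vert_mem_s3 h' (by omega)) (vert_mem_s3 h' (by omega))
      (vert_mem_s3 h (by omega)) ⟨by simp, by simp, ?_⟩
    rintro ⟨c, d⟩ h1 h2 h3 h4
    simp only at h1 h2 h3 h4
    obtain rfl : c = a := by omega
    obtain rfl | rfl : d = b ∨ d = b + 1 := by omega
    · exact h
    · exact h'

lemma lower_bound {n : ℕ} {A : ZMod n → Cell} (hn : 5 < n) (hA : IsClosedPathSeq n A P)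
    (p : Ideal (MvPolynomial {v // v ∈ polyVerts P} K)) [p.IsPrime] (hp : polyIdeal K P ≤ p) :
    (n : ℕ∞) ≤ p.height := by
  have h1 := height_add_rk (K := K) {v // v ∈ polyVerts P}
    (fun v => Ideal.Quotient.mk p (MvPolynomial.X v))
  have hker : RingHom.ker (MvPolynomial.aeval (R := K) (fun v : {v // v ∈ polyVerts P} =>
      Ideal.Quotient.mk p (MvPolynomial.X v))) = p := by
    have : MvPolynomial.aeval (R := K) (fun v : {v // v ∈ polyVerts P} =>
      Ideal.Quotient.mk p (MvPolynomial.X v)) = Ideal.Quotient.mkₐ K p := by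
      apply MvPolynomial.algHom_ext
      intro i
      simp
    rw [this]
    exact Ideal.Quotient.mkₐ_ker K p
  have hr := closed_rank (K := K) hn hA (xof_cellRel p hp)
  have hrange : Set.range (fun v : {v // v ∈ polyVerts P} =>
      Ideal.Quotient.mk p (MvPolynomial.X v)) = xof p '' (polyVerts P) := by
    ext y
    constructor
    · rintro ⟨v, rfl⟩
      exact ⟨v, v.2, xof_eq p v⟩
    · rintro ⟨v, hv, rfl⟩
      exact ⟨⟨v, hv⟩, (xof_eq p ⟨v, hv⟩).symm⟩
  rw [hker, hrange] at h1
  have hc := (closed_card hn hA).2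
  have h2 : ((2 * n : ℕ) : ℕ∞) ≤ p.height + n := by
    refine (Nat.cast_le.2 ?_).trans (h1.trans (add_le_add_right hr _))
    simpa using hc
  by_cases ht : p.height = ⊤
  · rw [ht]; exact le_top
  obtain ⟨k, hk⟩ := ENat.ne_top_iff_exists.1 ht
  rw [← hk] at h2 ⊢
  norm_cast at h2 ⊢
  omega

lemma inner_rel {R : Type*} [CommRing R] [IsDomain R] {x : Cell → R}
    (h0 : ∀ v ∈ polyVerts P, x v ≠ 0)
    (hx : ∀ a b : ℤ, (a, b) ∈ P → x (a, b) * x (a + 1, b + 1) = x (a, b + 1) * x (a + 1, b))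
    (a b : ℤ) (k l : ℕ) (h : IsInnerInterval P (a, b) (a + k + 1, b + l + 1)) :
    x (a, b) * x (a + k + 1, b + l + 1) = x (a, b + l + 1) * x (a + k + 1, b) := by
  have row : ∀ (a b : ℤ) (k : ℕ), IsInnerInterval P (a, b) (a + k + 1, b + 1) →
      x (a, b) * x (a + k + 1, b + 1) = x (a, b + 1) * x (a + k + 1, b) := by
    intro a b k
    induction k with
    | zero =>
      intro h
      have := hx a b (h.2.2 (a, b) (by simp) (by simp) (by simp) (by simp))
      simpa using this
    | succ k ih =>
      intro h
      obtain ⟨-, -, h3⟩ := h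
      simp only at h3
      have i1 := ih ⟨by simp <;> omega, by simp, fun c q1 q2 q3 q4 =>
        h3 c q1 (by push_cast; simp only at q2; omega) q3 q4⟩
      have hm : (a + k + 1, b) ∈ P := h3 _ (by simp <;> omega) (by simp) (by simp) (by simp)
      have i2 := hx _ _ hm
      have n1 := h0 _ (vert_mem_s3 (c := a + k + 1) (d := b) hm (by omega))
      push_cast
      rw [show a + (k + 1 : ℤ) + 1 = a + k + 1 + 1 by ring]
      apply mul_left_cancel₀ n1
      linear_combination x (a, b) * i2 + x (a + k + 1 + 1, b) * i1
  induction l with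
  | zero => simpa using row a b k (by simpa using h)
  | succ l ih =>
    obtain ⟨-, -, h3⟩ := h
    simp only at h3
    have i1 := ih ⟨by simp <;> omega, by simp <;> omega, fun c q1 q2 q3 q4 =>
      h3 c q1 q2 q3 (by push_cast; simp only at q4; omega)⟩
    have i2 := row a (b + l + 1) k ⟨by simp <;> omega, by simp, fun c q1 q2 q3 q4 =>
      h3 c q1 q2 (by simp only at q3; omega) (by push_cast; simp only at q4; omega)⟩
    have hm : (a, b + l + 1) ∈ P := h3 _ (by simp) (by simp) (by simp <;> omega) (by simp)
    have n1 := h0 _ (vert_mem_s3 (c := a) (d := b + l + 1) hm (by omega))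
    push_cast
    rw [show b + (l + 1 : ℤ) + 1 = b + l + 1 + 1 by ring]
    apply mul_left_cancel₀ n1
    linear_combination x (a, b) * i2 + x (a, b + l + 1 + 1) * i1

lemma upper_bound : ∃ p : Ideal (MvPolynomial {v // v ∈ polyVerts P} K), p.IsPrime ∧
    polyIdeal K P ≤ p ∧ p.height ≤ P.card := by
  classical
  let X' : Cell → MvPolynomial {v // v ∈ polyVerts P} K := fun c =>
    if h : c ∈ polyVerts P then MvPolynomial.X ⟨c, h⟩ else 0
  have hX' : ∀ v : {v // v ∈ polyVerts P}, X' v = MvPolynomial.X v := by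
    intro v; simp [X']
  let G : Finset (MvPolynomial {v // v ∈ polyVerts P} K) := P.image fun c =>
    X' c * X' (c.1 + 1, c.2 + 1) - X' (c.1, c.2 + 1) * X' (c.1 + 1, c.2)
  let φ : MvPolynomial {v // v ∈ polyVerts P} K →ₐ[K] K := MvPolynomial.aeval fun _ => (1 : K)
  have hφ : ∀ c ∈ polyVerts P, φ (X' c) = 1 := by
    intro c hc
    have := hX' ⟨c, hc⟩
    simp only at this
    rw [this]
    simp [φ]
  have hm : (RingHom.ker φ).IsPrime := RingHom.ker_isPrime _
  have hJ : Ideal.span (G : Set (MvPolynomial {v // v ∈ polyVerts P} K)) ≤ RingHom.ker φ := by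
    rw [Ideal.span_le]
    intro g hg
    obtain ⟨⟨a, b⟩, hc, rfl⟩ := Finset.mem_image.1 hg
    simp only [SetLike.mem_coe, RingHom.mem_ker, map_sub, map_mul]
    rw [hφ _ (vert_mem_s3 hc (by omega)), hφ _ (vert_mem_s3 hc (by omega)), hφ _ (vert_mem_s3 hc (by omega)),
      hφ _ (vert_mem_s3 hc (by omega))]
    simp
  obtain ⟨p, hp, hpm⟩ := Ideal.exists_minimalPrimes_le hJ
  have hpp : p.IsPrime := hp.1.1
  have hxX : ∀ c ∈ polyVerts P, xof p c = Ideal.Quotient.mk p (X' c) := by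
    intro c hc
    have h1 := hX' ⟨c, hc⟩
    have h2 := xof_eq p ⟨c, hc⟩
    simp only at h1 h2
    rw [h1, h2]
  refine ⟨p, hpp, ?_, ?_⟩
  · rw [polyIdeal, Ideal.span_le]
    rintro f ⟨⟨⟨a, b⟩, h1⟩, ⟨⟨c, d⟩, h2⟩, ⟨v3, h3⟩, ⟨v4, h4⟩, h, e3, e4, rfl⟩
    simp only at e3 e4
    subst e3
    subst e4
    simp only [SetLike.mem_coe]
    rw [← Ideal.Quotient.eq, map_mul, map_mul]
    rw [← xof_eq p, ← xof_eq p, ← xof_eq p, ← xof_eq p]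
    simp only
    obtain ⟨k, rfl⟩ : ∃ k : ℕ, c = a + k + 1 := ⟨(c - a - 1).toNat, by
      have := h.1
      simp only at this
      omega⟩
    obtain ⟨l, rfl⟩ : ∃ l : ℕ, d = b + l + 1 := ⟨(d - b - 1).toNat, by
      have := h.2.1
      simp only at this
      omega⟩
    refine inner_rel (P := P) (x := xof p) ?_ ?_ a b k l h
    · intro v hv h0
      rw [hxX v hv, Ideal.Quotient.eq_zero_iff_mem] at h0
      have := hpm h0
      rw [RingHom.mem_ker, hφ v hv] at this
      exact one_ne_zero this
    · intro a b hab
      rw [hxX _ (vert_mem_s3 hab (by omega)), hxX _ (vert_mem_s3 hab (by omega)),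
        hxX _ (vert_mem_s3 hab (by omega)), hxX _ (vert_mem_s3 hab (by omega)), ← map_mul, ← map_mul,
        Ideal.Quotient.eq]
      exact hp.1.2 (Ideal.subset_span (Finset.mem_coe.2 (Finset.mem_image.2 ⟨(a, b), hab, rfl⟩)))
  · refine (Ideal.height_le_card_of_mem_minimalPrimes_span_finset hp).trans ?_
    exact_mod_cast Finset.card_image_le

end final


/-- If `P` is a closed path polyomino and `K` a field, then the height of
the polyomino ideal `I_P ⊆ S_P` equals `rank(P)`, the number of cells of `P`. -/
theorem closedPath_height_eq_rank (K : Type*) [Field K] (P : Finset Cell)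
    (hP : IsClosedPath P) :
    idealHeight (polyIdeal K P) = (P.card : ℕ∞) := by
  obtain ⟨n, hn, A, hA⟩ := hP
  apply le_antisymm
  · obtain ⟨p, hp, h1, h2⟩ := upper_bound (K := K) (P := P)
    refine le_trans (iInf₂_le (⟨p, hp⟩ : PrimeSpectrum _) h1) ?_
    rw [← PrimeSpectrum.height_eq_orderHeight]
    exact h2
  · refine le_iInf₂ fun p hp => ?_
    rw [← PrimeSpectrum.height_eq_orderHeight, (closed_card hn hA).1]
    have := p.2
    exact lower_bound hn hA p.asIdeal hp
end

section
/- Let P be a closed path polyomino with n cells and K a field. Suppose there exist n inner 2-minors f_1,…,f_n of P and a lexicographic order <_lex on S_P induced by a total order on the variables {x_v : v ∈ V(P)} such that the initial monomials in_{<_lex}(f_1),…,in_{<_lex}(f_n) pairwise have no variable in common. Then the polyomino ideal I_P is of König type. -/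
open scoped MonomialOrder

universe u₁ u₂ u₃

open MvPolynomial in
theorem aux_reduce {σ K : Type*} [Field K] (m : MonomialOrder σ) (g p : MvPolynomial σ K)
    (hg : g ≠ 0) (hp : p ≠ 0) (h : m.degree p ≤ m.degree g) :
    ∃ s, g - s * p = 0 ∨ m.degree (g - s * p) ≺[m] m.degree g := by
  have hlp : m.leadingCoeff p ≠ 0 := by simpa using hp
  have hlg : m.leadingCoeff g ≠ 0 := by simpa using hg
  have hc : m.leadingCoeff g / m.leadingCoeff p ≠ 0 := div_ne_zero hlg hlp
  set s : MvPolynomial σ K := monomial (m.degree g - m.degree p) (m.leadingCoeff g / m.leadingCoeff p) with hs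
  have hs0 : s ≠ 0 := by simpa [hs] using hc
  have hds : m.degree s = m.degree g - m.degree p := by
    classical rw [hs, m.degree_monomial, if_neg hc]
  have hdsp : m.degree (s * p) = m.degree g := by
    rw [m.degree_mul hs0 hp, hds, tsub_add_cancel_of_le h]
  have hlsp : m.leadingCoeff (s * p) = m.leadingCoeff g := by
    rw [m.leadingCoeff_mul, hs, m.leadingCoeff_monomial, div_mul_cancel₀ _ hlp]
  refine ⟨s, ?_⟩
  by_cases h0 : g - s * p = 0
  · exact Or.inl h0
  right
  have hle : m.degree (g - s * p) ≼[m] m.degree g := by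
    refine m.degree_sub_le.trans ?_
    rw [hdsp]; simp
  refine lt_of_le_of_ne hle fun he => ?_
  have he' : m.degree (g - s * p) = m.degree g := m.toSyn.injective he
  have h1 := m.coeff_degree_ne_zero_iff.mpr h0
  apply h1
  rw [he', coeff_sub]
  nth_rewrite 2 [← hdsp]
  exact sub_eq_zero.mpr hlsp.symm

theorem aux_coprime {σ : Type*} (a b c : σ →₀ ℕ) (h : a ≤ b + c)
    (hd : Disjoint a.support c.support) : a ≤ b := by
  intro i
  by_cases hi : a i = 0
  · simp [hi]
  · have : c i = 0 := by
      by_contra hc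
      exact Finset.disjoint_left.mp hd (Finsupp.mem_support_iff.mpr hi) (Finsupp.mem_support_iff.mpr hc)
    have := h i
    simp_all

/-- Leading-term divisibility property. -/
def AuxGB {σ K : Type*} [Field K] (m : MonomialOrder σ) (F : List (MvPolynomial σ K)) : Prop :=
  ∀ h ∈ Ideal.ofList F, h ≠ 0 → ∃ p ∈ F, m.degree p ≤ m.degree h

theorem aux_regular {σ K : Type*} [Field K] (m : MonomialOrder σ) (F : List (MvPolynomial σ K))
    (hF0 : ∀ p ∈ F, p ≠ 0) (hF : AuxGB m F) (q : MvPolynomial σ K) (hq : q ≠ 0)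
    (hd : ∀ p ∈ F, Disjoint (m.degree p).support (m.degree q).support)
    (g : MvPolynomial σ K) (hg : g * q ∈ Ideal.ofList F) : g ∈ Ideal.ofList F := by
  induction hn : m.toSyn (m.degree g) using WellFoundedLT.induction generalizing g with
  | ind n ih =>
    by_cases h0 : g = 0
    · simp [h0]
    obtain ⟨p, hp, hle⟩ := hF _ hg (mul_ne_zero h0 hq)
    rw [m.degree_mul h0 hq] at hle
    have hpJ : p ∈ Ideal.ofList F := Ideal.subset_span hp
    obtain ⟨s, hs⟩ := aux_reduce m g p h0 (hF0 p hp) (aux_coprime _ _ _ hle (hd p hp))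
    have : g - s * p ∈ Ideal.ofList F := by
      rcases hs with hs | hs
      · simp [hs]
      · refine ih _ (hn ▸ hs) _ ?_ rfl
        have : (g - s * p) * q = g * q - (s * q) * p := by ring
        rw [this]
        exact sub_mem hg (Ideal.mul_mem_left _ _ hpJ)
    have h2 := add_mem this (Ideal.mul_mem_left _ s hpJ)
    simpa using h2

theorem aux_gb_append {σ K : Type*} [Field K] (m : MonomialOrder σ) (F : List (MvPolynomial σ K))
    (hF0 : ∀ p ∈ F, p ≠ 0) (hF : AuxGB m F) (q : MvPolynomial σ K) (hq : q ≠ 0)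
    (hd : ∀ p ∈ F, Disjoint (m.degree p).support (m.degree q).support) : AuxGB m (F ++ [q]) := by
  intro h hh h0
  rw [Ideal.ofList_append, Ideal.ofList_singleton, Submodule.mem_sup] at hh
  obtain ⟨j, hj, y, hy, rfl⟩ := hh
  obtain ⟨g, rfl⟩ := Ideal.mem_span_singleton'.mp hy
  clear hy
  induction hn : m.toSyn (m.degree g) using WellFoundedLT.induction generalizing g j with
  | ind n ih =>
    by_cases hg0 : g = 0
    · subst hg0
      obtain ⟨p, hp, hle⟩ := hF (j + 0 * q) (by simpa using hj) h0
      exact ⟨p, by simp [hp], hle⟩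
    by_cases hex : ∃ p ∈ F, m.degree p ≤ m.degree g
    · obtain ⟨p, hp, hle⟩ := hex
      have hpJ : p ∈ Ideal.ofList F := Ideal.subset_span hp
      obtain ⟨s, hs⟩ := aux_reduce m g p hg0 (hF0 p hp) hle
      have e : j + g * q = (j + (s * q) * p) + (g - s * p) * q := by ring
      have hj' : j + (s * q) * p ∈ Ideal.ofList F := add_mem hj (Ideal.mul_mem_left _ _ hpJ)
      rw [e] at h0 ⊢
      rcases hs with hs | hs
      · rw [hs] at h0 ⊢
        obtain ⟨p, hp, hle⟩ := hF _ (by simpa using hj') h0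
        exact ⟨p, by simp [hp], hle⟩
      · exact ih _ (hn ▸ hs) _ hj' _ h0 rfl
    · push Not at hex
      have hdeg : m.degree (g * q) = m.degree g + m.degree q := m.degree_mul hg0 hq
      by_cases hj0 : j = 0
      · refine ⟨q, by simp, ?_⟩
        rw [hj0, zero_add, hdeg]; exact le_add_self
      obtain ⟨p, hp, hle⟩ := hF j hj hj0
      have hne : m.degree j ≠ m.degree (g * q) := by
        intro he
        rw [he, hdeg] at hle
        exact hex p hp (aux_coprime _ _ _ hle (hd p hp))
      rcases lt_or_gt_of_ne (fun h => hne (m.toSyn.injective h)) with hlt | hlt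
      · refine ⟨q, by simp, ?_⟩
        rw [m.degree_add_eq_right_of_lt hlt, hdeg]; exact le_add_self
      · refine ⟨p, by simp [hp], ?_⟩
        rw [m.degree_add_of_lt hlt]; exact hle

theorem aux_gb {σ K : Type*} [Field K] (m : MonomialOrder σ) (F : List (MvPolynomial σ K))
    (hF0 : ∀ p ∈ F, p ≠ 0)
    (hd : F.Pairwise fun p q => Disjoint (m.degree p).support (m.degree q).support) :
    AuxGB m F := by
  induction F using List.reverseRecOn with
  | nil => intro h hh h0; simp_all
  | append_singleton F q ih =>
    rw [List.pairwise_append] at hd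
    exact aux_gb_append m F (fun p hp => hF0 p (by simp [hp]))
      (ih (fun p hp => hF0 p (by simp [hp])) hd.1) q (hF0 q (by simp))
      (fun p hp => hd.2.2 p hp q (by simp))

theorem aux_height {σ K : Type*} [Field K] (m : MonomialOrder σ) (F : List (MvPolynomial σ K))
    (hF0 : ∀ p ∈ F, p ≠ 0)
    (hd : F.Pairwise fun p q => Disjoint (m.degree p).support (m.degree q).support)
    (p : Ideal (MvPolynomial σ K)) [p.IsPrime] (hp : Ideal.ofList F ≤ p) :
    (F.length : ℕ∞) ≤ p.height := by
  induction F using List.reverseRecOn generalizing p with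
  | nil => simp
  | append_singleton F q ih =>
    rw [List.pairwise_append] at hd
    have hF0' : ∀ p ∈ F, p ≠ 0 := fun p hp => hF0 p (by simp [hp])
    rw [Ideal.ofList_append, Ideal.ofList_singleton, sup_le_iff] at hp
    obtain ⟨Q, hQ, hQp⟩ := Ideal.exists_minimalPrimes_le hp.1
    have : Q.IsPrime := hQ.1.1
    have h1 := ih hF0' hd.1 Q hQ.1.2
    have hqQ : q ∉ Q := by
      intro hqQ
      obtain ⟨y, hy, hy'⟩ := Ideal.exists_mul_mem_of_mem_minimalPrimes hQ hqQ
      exact hy (aux_regular m F hF0' (aux_gb m F hF0' hd.1) q (hF0 q (by simp))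
        (fun p hp => hd.2.2 p hp q (by simp)) y (by rwa [mul_comm]))
    have hlt : Q < p := lt_of_le_of_ne hQp (by
      rintro rfl
      exact hqQ (hp.2 (Ideal.mem_span_singleton_self q)))
    have := Ideal.height_add_one_le_of_lt_of_isPrime hlt
    rw [List.length_append, List.length_singleton, Nat.cast_add, Nat.cast_one]
    exact (add_le_add_left h1 1).trans this

theorem aux_weaklyRegular {σ K : Type*} [Field K] (m : MonomialOrder σ)
    (F : List (MvPolynomial σ K)) (hF0 : ∀ p ∈ F, p ≠ 0)
    (hd : F.Pairwise fun p q => Disjoint (m.degree p).support (m.degree q).support) :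
    RingTheory.Sequence.IsWeaklyRegular (MvPolynomial σ K) F := by
  constructor
  intro i hi
  rw [isSMulRegular_iff_right_eq_zero_of_smul]
  intro x
  obtain ⟨g, rfl⟩ := Submodule.Quotient.mk_surjective _ x
  rw [← Submodule.Quotient.mk_smul, Submodule.Quotient.mk_eq_zero, Submodule.Quotient.mk_eq_zero]
  simp only [smul_eq_mul, Ideal.mul_top]
  intro h
  have h0 : ∀ p ∈ F.take i, p ≠ 0 := fun p hp => hF0 p (List.mem_of_mem_take hp)
  refine aux_regular m _ h0 (aux_gb m _ h0 (hd.sublist (List.take_sublist _ _))) F[i]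
    (hF0 _ (by simp)) ?_ g (by rwa [mul_comm])
  intro p hp
  obtain ⟨k, hk, rfl⟩ := List.mem_take_iff_getElem.mp hp
  exact List.pairwise_iff_getElem.mp hd _ _ _ _ (by omega)

theorem aux_rect_row {D : Type*} [CommRing D] [IsDomain D] (y : ℤ → ℤ → D)
    (hy : ∀ u v, y u v ≠ 0) (u v : ℤ) (k : ℕ)
    (h : ∀ i : ℕ, i < k → y (u + i) v * y (u + i + 1) (v + 1) = y (u + i) (v + 1) * y (u + i + 1) v) :
    y u v * y (u + k) (v + 1) = y u (v + 1) * y (u + k) v := by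
  induction k with
  | zero => simp [mul_comm]
  | succ k ih =>
    have h1 := ih (fun i hi => h i (by omega))
    have h2 := h k (by omega)
    have e : u + ((k + 1 : ℕ) : ℤ) = u + k + 1 := by push_cast; ring
    rw [e]
    apply mul_left_cancel₀ (mul_ne_zero (hy (u + k) v) (hy (u + k) (v + 1)))
    linear_combination (y (u+k) v * y (u+k+1) (v+1)) * h1 + (y u (v+1) * y (u+k) v) * h2

theorem aux_rect {D : Type*} [CommRing D] [IsDomain D] (y : ℤ → ℤ → D)
    (hy : ∀ u v, y u v ≠ 0) (u v : ℤ) (k l : ℕ)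
    (h : ∀ i j : ℕ, i < k → j < l → y (u + i) (v + j) * y (u + i + 1) (v + j + 1)
      = y (u + i) (v + j + 1) * y (u + i + 1) (v + j)) :
    y u v * y (u + k) (v + l) = y u (v + l) * y (u + k) v := by
  induction l with
  | zero => simp
  | succ l ih =>
    have h1 := ih (fun i j hi hj => h i j hi (by omega))
    have h2 := aux_rect_row y hy u (v + l) k (fun i hi => h i l hi (by omega))
    have e : v + ((l + 1 : ℕ) : ℤ) = v + l + 1 := by push_cast; ring
    rw [e]
    apply mul_left_cancel₀ (mul_ne_zero (hy u (v + l)) (hy (u + k) (v + l)))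
    linear_combination (y u (v+l) * y (u+k) (v+l+1)) * h1 + (y u (v+l) * y (u+k) v) * h2

theorem aux_cell_mem {P : Finset Cell} {c : Cell} (hc : c ∈ P) (v : Cell) (hv : v ∈ cellVerts c) :
    v ∈ polyVerts P := Finset.mem_biUnion.mpr ⟨c, hc, hv⟩

open MvPolynomial in
theorem aux_upper (K : Type*) [Field K] (P : Finset Cell) :
    ∃ q : Ideal (MvPolynomial {v // v ∈ polyVerts P} K), q.IsPrime ∧ polyIdeal K P ≤ q ∧
      q.height ≤ P.card := by
  classical
  let T : Finset (MvPolynomial {v // v ∈ polyVerts P} K) := P.attach.image fun c =>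
    X ⟨c.1, aux_cell_mem c.2 _ (by simp [cellVerts])⟩ *
      X ⟨(c.1.1 + 1, c.1.2 + 1), aux_cell_mem c.2 _ (by simp [cellVerts])⟩ -
    X ⟨(c.1.1, c.1.2 + 1), aux_cell_mem c.2 _ (by simp [cellVerts])⟩ *
      X ⟨(c.1.1 + 1, c.1.2), aux_cell_mem c.2 _ (by simp [cellVerts])⟩
  let ev : MvPolynomial {v // v ∈ polyVerts P} K →+* K := eval (fun _ => 1)
  have hker : (RingHom.ker ev).IsPrime := RingHom.ker_isPrime ev
  have hT : Ideal.span (T : Set (MvPolynomial {v // v ∈ polyVerts P} K)) ≤ RingHom.ker ev := by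
    rw [Ideal.span_le]
    intro t ht
    obtain ⟨c, -, rfl⟩ := Finset.mem_image.mp ht
    simp [RingHom.mem_ker, ev]
  obtain ⟨q, hq, hqk⟩ := Ideal.exists_minimalPrimes_le hT
  have hqp : q.IsPrime := hq.1.1
  have hX : ∀ v, (X v : MvPolynomial {v // v ∈ polyVerts P} K) ∉ q := by
    intro v hv
    have := hqk hv
    simp [RingHom.mem_ker, ev] at this
  refine ⟨q, hqp, ?_, (Ideal.height_le_card_of_mem_minimalPrimes_span_finset hq).trans ?_⟩
  swap
  · exact_mod_cast Finset.card_image_le.trans (by simp)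
  let y : ℤ → ℤ → MvPolynomial {v // v ∈ polyVerts P} K ⧸ q := fun s t =>
    if h : (s, t) ∈ polyVerts P then Ideal.Quotient.mk q (X ⟨(s, t), h⟩) else 1
  have hyv : ∀ w : {v // v ∈ polyVerts P}, y w.1.1 w.1.2 = Ideal.Quotient.mk q (X w) := by
    intro w
    simp [y]
  have hy0 : ∀ s t, y s t ≠ 0 := by
    intro s t
    by_cases h : (s, t) ∈ polyVerts P
    · rw [hyv ⟨(s, t), h⟩, Ne, Ideal.Quotient.eq_zero_iff_mem]
      exact hX _
    · simp [y, h]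
  have hcell : ∀ s t, (s, t) ∈ P → y s t * y (s + 1) (t + 1) = y s (t + 1) * y (s + 1) t := by
    intro s t hc
    have hmem := hq.1.2 (Ideal.subset_span (Finset.mem_coe.mpr
      (Finset.mem_image.mpr ⟨⟨(s, t), hc⟩, Finset.mem_attach _ _, rfl⟩)))
    rw [← Ideal.Quotient.eq_zero_iff_mem, map_sub, map_mul, map_mul, sub_eq_zero] at hmem
    rw [← hyv, ← hyv, ← hyv, ← hyv] at hmem
    exact hmem
  unfold polyIdeal
  rw [Ideal.span_le]
  rintro f ⟨a, b, c, d, ⟨h1, h2, h3⟩, hc, hd, rfl⟩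
  rw [SetLike.mem_coe, ← Ideal.Quotient.eq_zero_iff_mem, map_sub, map_mul, map_mul, sub_eq_zero,
    ← hyv, ← hyv, ← hyv, ← hyv, hc, hd]
  obtain ⟨k, hk⟩ := Int.eq_ofNat_of_zero_le (sub_nonneg.mpr h1.le)
  obtain ⟨l, hl⟩ := Int.eq_ofNat_of_zero_le (sub_nonneg.mpr h2.le)
  have ek : b.1.1 = a.1.1 + k := by omega
  have el : b.1.2 = a.1.2 + l := by omega
  have := aux_rect y hy0 a.1.1 a.1.2 k l (fun i j hi hj => hcell _ _
    (h3 (a.1.1 + i, a.1.2 + j) (by simp) (by simp only; omega) (by simp) (by simp only; omega)))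
  simpa only [ek, el] using this

open MvPolynomial in
theorem aux_XX {σ K : Type*} [Field K] (a b : σ) :
    (X a * X b : MvPolynomial σ K) = monomial (Finsupp.single a 1 + Finsupp.single b 1) 1 := by
  rw [X, X, monomial_mul, one_mul]

theorem aux_single {σ : Type*} (a b c d : σ)
    (h : Finsupp.single a 1 + Finsupp.single b 1 = Finsupp.single c 1 + Finsupp.single d (1 : ℕ)) :
    (a = c ∧ b = d) ∨ (a = d ∧ b = c) := by
  rw [Finsupp.single_add_single_eq_single_add_single one_ne_zero one_ne_zero] at h
  rcases h with h | h | h | h | h <;> simp_all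

open MvPolynomial in
theorem aux_homog {K : Type*} [Field K] {P : Finset Cell} 
    (g : MvPolynomial {v // v ∈ polyVerts P} K) (hg : g ∈ innerMinors K P) :
    g.IsHomogeneous 2 := by
  obtain ⟨a, b, c, d, -, -, -, rfl⟩ := hg
  exact ((isHomogeneous_X K a).mul (isHomogeneous_X K b)).sub
    ((isHomogeneous_X K c).mul (isHomogeneous_X K d))

open MvPolynomial in
theorem aux_minimal {K : Type*} [Field K] {P : Finset Cell} 
    (g : MvPolynomial {v // v ∈ polyVerts P} K) (hg : g ∈ innerMinors K P) :
    Ideal.span (innerMinors K P \ {g}) ≠ polyIdeal K P := by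
  classical
  have hg' := hg
  obtain ⟨a, b, c, d, ⟨h1, h2, -⟩, hc, hd, hge⟩ := hg'
  set e : {v // v ∈ polyVerts P} →₀ ℕ := Finsupp.single a 1 + Finsupp.single b 1 with he
  have hac : a ≠ c := by
    rintro rfl
    rw [Prod.ext_iff] at hc
    simp only at hc; omega
  have hbd : b ≠ d := by
    rintro rfl
    rw [Prod.ext_iff] at hd
    simp only at hd; omega
  have had : a ≠ d := by
    rintro rfl
    rw [Prod.ext_iff] at hd
    simp only at hd; omega
  have hcoeff : coeff e g = 1 := by
    rw [hge, aux_XX, aux_XX, coeff_sub, coeff_monomial, coeff_monomial, if_pos rfl, if_neg, sub_zero]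
    intro h
    rcases aux_single _ _ _ _ h with h | h
    · exact hac h.1.symm
    · exact had h.2.symm
  have hother : ∀ h ∈ innerMinors K P, coeff e h ≠ 0 → h = g := by
    rintro h ⟨a', b', c', d', ⟨h1', h2', -⟩, hc', hd', rfl⟩ hne
    rw [aux_XX, aux_XX, coeff_sub, coeff_monomial, coeff_monomial] at hne
    rw [Prod.ext_iff] at hc hd hc' hd'
    simp only at hc hd hc' hd'
    by_cases ha : Finsupp.single a' 1 + Finsupp.single b' 1 = e
    · rcases aux_single _ _ _ _ ha with ⟨rfl, rfl⟩ | ⟨rfl, rfl⟩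
      · have hcc : c' = c := Subtype.ext (Prod.ext (by omega) (by omega))
        have hdd : d' = d := Subtype.ext (Prod.ext (by omega) (by omega))
        rw [hge, hcc, hdd]
      · omega
    · by_cases hb : Finsupp.single c' 1 + Finsupp.single d' 1 = e
      · rcases aux_single _ _ _ _ hb with ⟨rfl, rfl⟩ | ⟨rfl, rfl⟩ <;> omega
      · simp [ha, hb] at hne
  intro hspan
  have hmem : g ∈ Ideal.span (innerMinors K P \ {g}) := by
    rw [hspan]; exact Ideal.subset_span hg
  have hz : ∀ p ∈ Ideal.span (innerMinors K P \ {g}), ∀ e' ≤ e, coeff e' p = 0 := by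
    intro p hp
    induction hp using Submodule.span_induction with
    | mem x hx =>
      intro e' hle
      by_contra hne
      have hd1 : e'.degree = 2 := by
        have := aux_homog x hx.1 hne
        rwa [Finsupp.degree_eq_weight_one]
      have hd2 : e.degree = 2 := by simp [he]
      have hee : e' = e := by
        obtain ⟨r, hr⟩ := exists_add_of_le hle
        have : r.degree = 0 := by
          rw [hr, map_add] at hd2; omega
        rw [Finsupp.degree_eq_zero_iff] at this
        rw [hr, this, add_zero]
      rw [hee] at hne
      exact hx.2 (hother x hx.1 hne)
    | zero => simp
    | add x y _ _ hx hy => intro e' hle; rw [coeff_add, hx e' hle, hy e' hle, add_zero]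
    | smul r x _ hx =>
      intro e' hle
      rw [smul_eq_mul, coeff_mul]
      refine Finset.sum_eq_zero fun z hz => ?_
      rw [Finset.HasAntidiagonal.mem_antidiagonal] at hz
      rw [hx z.2 (le_trans (hz ▸ le_add_self) hle), mul_zero]
  have := hz g hmem e le_rfl
  rw [hcoeff] at this
  exact one_ne_zero this

theorem aux_initial {σ K : Type*} [Field K] (m : MonomialOrder σ) (f g : MvPolynomial σ K)
    (h : IsInitialTerm m f g) : f ≠ 0 ∧ g ≠ 0 ∧ m.degree g = m.degree f ∧
      g.vars = (m.degree f).support ∧ g = MvPolynomial.monomial (m.degree f) (m.leadingCoeff f) := by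
  classical
  obtain ⟨d, hd, hle, rfl⟩ := h
  have hf : f ≠ 0 := by rintro rfl; simp at hd
  have hc := MvPolynomial.mem_support_iff.mp hd
  have hdeg : m.degree f = d :=
    m.toSyn.injective (le_antisymm (hle _ (m.degree_mem_support hf)) (m.le_degree hd))
  subst hdeg
  refine ⟨hf, by simpa using hf, ?_, MvPolynomial.vars_monomial hc, rfl⟩
  rw [m.degree_monomial, if_neg hc]

/-- Let `P` be a closed path polyomino with `n = rank(P)` cells and `K` a
field. If there exist `n` (distinct) inner 2-minors `f i` of `P` and a lexicographic order
on `S_P`, induced by a total order `r` on the variables, whose initial terms `ini i`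
pairwise have no variable in common, then `I_P` is of König type. -/
theorem closedPath_koenig_of_lex_coprime_initial_terms (K : Type*) [Field K]
    (P : Finset Cell) (hP : IsClosedPath P)
    (f ini : Fin P.card → MvPolynomial {v // v ∈ polyVerts P} K)
    (hinj : Function.Injective f) (hmem : ∀ i, f i ∈ innerMinors K P)
    (r : LinearOrder {v // v ∈ polyVerts P})
    (hini : ∀ i, IsInitialTerm
      (@MonomialOrder.lex _ r (@Finite.to_wellFoundedGT _ _ r.toPreorder)) (f i) (ini i))
    (hdisj : ∀ i j, i ≠ j → Disjoint (ini i).vars (ini j).vars) :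
    IsKoenigType (polyIdeal K P) := by
  classical
  set m : MonomialOrder {v // v ∈ polyVerts P} :=
    @MonomialOrder.lex _ r (@Finite.to_wellFoundedGT _ _ r.toPreorder) with hm
  have hI := fun i => aux_initial m (f i) (ini i) (hini i)
  have hdd : ∀ i j, i ≠ j → Disjoint (m.degree (f i)).support (m.degree (f j)).support := by
    intro i j hij
    rw [← (hI i).2.2.2.1, ← (hI j).2.2.2.1]
    exact hdisj i j hij
  have hpf : (List.ofFn f).Pairwise
      fun p q => Disjoint (m.degree p).support (m.degree q).support :=
    List.pairwise_ofFn.mpr fun i j hij => hdd i j hij.ne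
  have hpi : (List.ofFn ini).Pairwise
      fun p q => Disjoint (m.degree p).support (m.degree q).support := by
    refine List.pairwise_ofFn.mpr fun i j hij => ?_
    rw [(hI i).2.2.1, (hI j).2.2.1]
    exact hdd i j hij.ne
  have hf0 : ∀ p ∈ List.ofFn f, p ≠ 0 := by
    intro p hp
    obtain ⟨i, rfl⟩ := List.mem_ofFn.mp hp
    exact (hI i).1
  have hi0 : ∀ p ∈ List.ofFn ini, p ≠ 0 := by
    intro p hp
    obtain ⟨i, rfl⟩ := List.mem_ofFn.mp hp
    exact (hI i).2.1
  refine ⟨P.card, ?_, f, innerMinors K P, hinj, hmem, fun g hg => ⟨2, aux_homog g hg⟩, rfl,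
    fun g hg => aux_minimal g hg, m, ini, hini, aux_weaklyRegular m _ hi0 hpi, ?_⟩
  · apply le_antisymm
    · obtain ⟨q, hqp, hle, hh⟩ := aux_upper K P
      refine (iInf₂_le (⟨q, hqp⟩ : PrimeSpectrum _) hle).trans ?_
      rw [← PrimeSpectrum.height_eq_orderHeight]
      exact hh
    · refine le_iInf₂ fun p hp => ?_
      rw [← PrimeSpectrum.height_eq_orderHeight]
      have := aux_height m (List.ofFn f) hf0 hpf p.asIdeal ?_
      · rwa [List.length_ofFn] at this
      · refine le_trans (Ideal.span_le.mpr ?_) hp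
        intro x hx
        obtain ⟨i, rfl⟩ := List.mem_ofFn.mp hx
        exact Ideal.subset_span (hmem i)
  · intro htop
    have hle : Ideal.ofList (List.ofFn ini) ≤
        RingHom.ker (MvPolynomial.constantCoeff :
          MvPolynomial {v // v ∈ polyVerts P} K →+* K) := by
      refine Ideal.span_le.mpr ?_
      intro x hx
      obtain ⟨i, rfl⟩ := List.mem_ofFn.mp hx
      rw [SetLike.mem_coe, RingHom.mem_ker, (hI i).2.2.2.2, MvPolynomial.constantCoeff_monomial,
        if_neg]
      intro h0
      have h2 := aux_homog (f i) (hmem i) (m.coeff_degree_ne_zero_iff.mpr (hI i).1)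
      rw [h0] at h2
      simp at h2
    have h1 : (1 : MvPolynomial {v // v ∈ polyVerts P} K) ∈ Ideal.ofList (List.ofFn ini) := by
      have : (1 : MvPolynomial {v // v ∈ polyVerts P} K) ∈ 
        (⊤ : Submodule (MvPolynomial {v // v ∈ polyVerts P} K)
          (MvPolynomial {v // v ∈ polyVerts P} K)) := trivial
      rw [htop] at this
      simpa using this
    have := hle h1
    simp [RingHom.mem_ker] at this
end
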